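/- arXiv:math/0512386 — 2 statements merged into one kernel-verified Lean document; each statement's English description precedes it below -/
import Mathlib

section
/- Let A be a nonempty finite set, let Q_X and Q_Y be strictly positive stochastic matrices on A with stationary probability vectors mu and mu~, and let P, P~ be the stationary Markov measures determined by (Q_X, mu) and (Q_Y, mu~). For p in (-1,1) let Lambda(p) := lim_{n->infinity} (1/n) log E_{P tensor P~ tensor P} ( ( W_n(X|Y) / W_n(X|X') )^p ) (which exists, is finite, real-analytic and convex on (-1,1)). Set c_- := lim_{p -> -1+} Lambda'(p), c_+ := lim_{p -> 1-} Lambda'(p), and let I(q) := sup_{p in (-1,1)} ( p q - Lambda(p) ) be the Legendre transform of Lambda. Then the sequence log W_n(X|Y) - log W_n(X|X') satisfies the following large deviation principle: for every open interval J of real numbers with J cap (c_-, c_+) nonempty, lim_{n->infinity} (1/n) log (P tensor P~ tensor P){ (X,Y,X') : (1/n) log( W_n(X|Y) / W_n(X|X') ) in J } = - inf_{q in J cap (c_-, c_+)} I(q). -/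
open MeasureTheory Filter Finset Real

/-- Waiting time: `W_n(x|y) = inf { k ≥ 1 : y_{k+i} = x_i for all 1 ≤ i ≤ n }`
(with the convention `sInf ∅ = 0` in `ℕ`; the set is a.s. nonempty). -/
noncomputable def waitingTime {A : Type*} (n : ℕ) (x y : ℕ → A) : ℕ :=
  sInf {k | 1 ≤ k ∧ ∀ i, 1 ≤ i → i ≤ n → y (k + i) = x i}


lemma tangent_ineq {Lam : ℝ → ℝ} (hconv : ConvexOn ℝ (Set.Ioo (-1:ℝ) 1) Lam)
    {p0 p : ℝ} (hp0 : p0 ∈ Set.Ioo (-1:ℝ) 1) (hp : p ∈ Set.Ioo (-1:ℝ) 1)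
    (hd : DifferentiableAt ℝ Lam p0) : Lam p0 + deriv Lam p0 * (p - p0) ≤ Lam p := by
  rcases lt_trichotomy p p0 with h | h | h
  · have := hconv.slope_le_deriv hp hp0 h hd
    rw [slope_def_field, div_le_iff₀ (by linarith)] at this
    linarith
  · subst h; simp
  · have := hconv.deriv_le_slope hp0 hp h hd
    rw [slope_def_field, le_div_iff₀ (by linarith)] at this
    linarith

lemma cgf_convex_ineq {Ω : Type*} [MeasurableSpace Ω] {ν : Measure Ω} [IsProbabilityMeasure ν]
    {X : Ω → ℝ} {p q a b : ℝ} (ha : 0 ≤ a) (hb : 0 ≤ b) (hab : a + b = 1)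
    (hp : Integrable (fun ω => Real.exp (p * X ω)) ν)
    (hq : Integrable (fun ω => Real.exp (q * X ω)) ν)
    (hpq : Integrable (fun ω => Real.exp ((a * p + b * q) * X ω)) ν) :
    ProbabilityTheory.cgf X ν (a * p + b * q)
      ≤ a * ProbabilityTheory.cgf X ν p + b * ProbabilityTheory.cgf X ν q := by
  set cp := ProbabilityTheory.cgf X ν p with hcp
  set cq := ProbabilityTheory.cgf X ν q with hcq
  have e1 : Real.exp cp = ∫ ω, Real.exp (p * X ω) ∂ν := ProbabilityTheory.exp_cgf hp
  have e2 : Real.exp cq = ∫ ω, Real.exp (q * X ω) ∂ν := ProbabilityTheory.exp_cgf hq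
  have e3 : Real.exp (ProbabilityTheory.cgf X ν (a * p + b * q))
      = ∫ ω, Real.exp ((a * p + b * q) * X ω) ∂ν := ProbabilityTheory.exp_cgf hpq
  rw [← Real.exp_le_exp, e3]
  have hpt : ∀ ω, Real.exp ((a * p + b * q) * X ω) ≤
      Real.exp (a * cp + b * cq) * (a * Real.exp (-cp)) * Real.exp (p * X ω)
      + Real.exp (a * cp + b * cq) * (b * Real.exp (-cq)) * Real.exp (q * X ω) := by
    intro ω
    have h := convexOn_exp.2 (Set.mem_univ (p * X ω - cp)) (Set.mem_univ (q * X ω - cq)) ha hb hab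
    simp only [smul_eq_mul] at h
    have h2 : Real.exp ((a * p + b * q) * X ω) = Real.exp (a * cp + b * cq) *
       Real.exp (a * (p * X ω - cp) + b * (q * X ω - cq)) := by
      rw [← Real.exp_add]; congr 1; ring
    rw [h2]
    calc _ ≤ Real.exp (a * cp + b * cq) * (a * Real.exp (p * X ω - cp) + b * Real.exp (q * X ω - cq)) :=
          mul_le_mul_of_nonneg_left h (Real.exp_pos _).le
      _ = _ := by
          rw [sub_eq_add_neg, sub_eq_add_neg, Real.exp_add (p * X ω), Real.exp_add (q * X ω)]; ring
  calc _ ≤ ∫ ω, (Real.exp (a * cp + b * cq) * (a * Real.exp (-cp)) * Real.exp (p * X ω)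
      + Real.exp (a * cp + b * cq) * (b * Real.exp (-cq)) * Real.exp (q * X ω)) ∂ν :=
        integral_mono hpq ((hp.const_mul _).add (hq.const_mul _)) hpt
    _ = Real.exp (a * cp + b * cq) * (a * (Real.exp (-cp) * Real.exp cp) + b * (Real.exp (-cq) * Real.exp cq)) := by
        rw [integral_add (hp.const_mul _) (hq.const_mul _), integral_const_mul, integral_const_mul,
          ← e1, ← e2]; ring
    _ = _ := by
        rw [← Real.exp_add, ← Real.exp_add]; simp [hab]

lemma ge_convex {Ω : Type*} [MeasurableSpace Ω] {ν : Measure Ω} [IsProbabilityMeasure ν]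
    {X : ℕ → Ω → ℝ} {Lam : ℝ → ℝ}
    (hint : ∀ p ∈ Set.Ioo (-1:ℝ) 1, ∀ n, 1 ≤ n → Integrable (fun ω => Real.exp (p * X n ω)) ν)
    (hLam : ∀ p ∈ Set.Ioo (-1 : ℝ) 1,
      Tendsto (fun n : ℕ => ProbabilityTheory.cgf (X n) ν p / n) atTop (nhds (Lam p))) :
    ConvexOn ℝ (Set.Ioo (-1:ℝ) 1) Lam := by
  refine ⟨convex_Ioo _ _, ?_⟩
  intro p hp q hq a b ha hb hab
  have hpq := convex_Ioo (-1:ℝ) 1 hp hq ha hb hab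
  simp only [smul_eq_mul] at hpq ⊢
  refine le_of_tendsto_of_tendsto (hLam _ hpq)
    (((hLam p hp).const_mul a).add ((hLam q hq).const_mul b)) ?_
  filter_upwards [eventually_ge_atTop 1] with n hn
  have := cgf_convex_ineq (X := X n) ha hb hab (hint p hp n hn) (hint q hq n hn) (hint _ hpq n hn)
  calc _ ≤ (a * ProbabilityTheory.cgf (X n) ν p + b * ProbabilityTheory.cgf (X n) ν q) / n := by
        gcongr
    _ = _ := by ring

lemma ge_lower {Ω : Type*} [MeasurableSpace Ω] {ν : Measure Ω} [IsProbabilityMeasure ν]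
    {X : ℕ → Ω → ℝ} {Lam : ℝ → ℝ} (hX : ∀ n, Measurable (X n))
    (hint : ∀ p ∈ Set.Ioo (-1:ℝ) 1, ∀ n, 1 ≤ n → Integrable (fun ω => Real.exp (p * X n ω)) ν)
    (hLam : ∀ p ∈ Set.Ioo (-1 : ℝ) 1,
      Tendsto (fun n : ℕ => ProbabilityTheory.cgf (X n) ν p / n) atTop (nhds (Lam p)))
    {p0 : ℝ} (hp0 : p0 ∈ Set.Ioo (-1:ℝ) 1) {q : ℝ} (hd : HasDerivAt Lam q p0)
    {ε : ℝ} (hε : 0 < ε) :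
    ∀ᶠ n : ℕ in atTop, Real.exp (n * (Lam p0 - p0 * q - 3 * ε))
      ≤ ν.real {ω | |X n ω / n - q| < ε} := by
  obtain ⟨δ, hδ, hder⟩ : ∃ δ > 0, ∀ p, |p - p0| < δ →
      |Lam p - Lam p0 - (p - p0) * q| ≤ ε / 2 * |p - p0| := by
    have h1 := (hasDerivAt_iff_isLittleO.1 hd).def (half_pos hε)
    obtain ⟨δ, hδ, h⟩ := Metric.eventually_nhds_iff.1 h1
    refine ⟨δ, hδ, fun p hp => ?_⟩
    have := h (y := p) (by rwa [Real.dist_eq])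
    simpa [Real.norm_eq_abs] using this
  obtain ⟨h, hh0, hhδ, hh1, hhp, hhm⟩ : ∃ h : ℝ, 0 < h ∧ h < δ ∧ h ≤ 1 ∧ p0 + h < 1 ∧ -1 < p0 - h := by
    refine ⟨min (min (δ/2) 1) (min ((1-p0)/2) ((p0+1)/2)), ?_, ?_, ?_, ?_, ?_⟩
    · have := hp0.1; have := hp0.2
      refine lt_min (lt_min ?_ ?_) (lt_min ?_ ?_) <;> linarith
    · have : min (min (δ/2) 1) (min ((1-p0)/2) ((p0+1)/2)) ≤ δ/2 :=
        (min_le_left _ _).trans (min_le_left _ _)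
      linarith
    · exact (min_le_left _ _).trans (min_le_right _ _)
    · have : min (min (δ/2) 1) (min ((1-p0)/2) ((p0+1)/2)) ≤ (1-p0)/2 :=
        (min_le_right _ _).trans (min_le_left _ _)
      have := hp0.2; linarith
    · have : min (min (δ/2) 1) (min ((1-p0)/2) ((p0+1)/2)) ≤ (p0+1)/2 :=
        (min_le_right _ _).trans (min_le_right _ _)
      have := hp0.1; linarith
  have hpp : p0 + h ∈ Set.Ioo (-1:ℝ) 1 := ⟨by linarith [hp0.1], hhp⟩
  have hpm : p0 - h ∈ Set.Ioo (-1:ℝ) 1 := ⟨hhm, by linarith [hp0.2]⟩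
  have d1 : Lam (p0 + h) ≤ Lam p0 + h * q + ε / 2 * h := by
    have := (abs_le.1 (hder (p0 + h) (by simpa [abs_of_pos hh0] using hhδ))).2
    simp only [add_sub_cancel_left, abs_of_pos hh0] at this; linarith
  have d2 : Lam (p0 - h) ≤ Lam p0 - h * q + ε / 2 * h := by
    have := (abs_le.1 (hder (p0 - h) (by simpa [abs_of_pos hh0] using hhδ))).2
    have e : p0 - h - p0 = -h := by ring
    simp only [e, abs_neg, abs_of_pos hh0] at this; linarith
  set η := h * ε / 6 with hη
  have hη0 : 0 < η := by positivity
  have hηε : η ≤ ε := by rw [hη]; nlinarith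
  have t1 := (hLam _ hp0).eventually_const_lt (show Lam p0 - η < Lam p0 by linarith)
  have t2 := (hLam _ hpp).eventually_lt_const (show Lam (p0+h) < Lam (p0+h) + η by linarith)
  have t3 := (hLam _ hpm).eventually_lt_const (show Lam (p0-h) < Lam (p0-h) + η by linarith)
  have t4 : ∀ᶠ n : ℕ in atTop, Real.log 4 / η ≤ n := tendsto_natCast_atTop_atTop.eventually_ge_atTop _
  have t5 : ∀ᶠ n : ℕ in atTop, Real.log 2 / ε ≤ n := tendsto_natCast_atTop_atTop.eventually_ge_atTop _
  filter_upwards [t1, t2, t3, t4, t5, eventually_ge_atTop 1] with n t1 t2 t3 t4 t5 hn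
  have hn0 : (0:ℝ) < n := by exact_mod_cast hn
  rw [lt_div_iff₀ hn0] at t1
  rw [div_lt_iff₀ hn0] at t2 t3
  rw [div_le_iff₀ hη0] at t4
  rw [div_le_iff₀ hε] at t5
  set E := {ω | |X n ω / n - q| < ε} with hE
  have hEm : MeasurableSet E := by
    have : Measurable fun ω => |X n ω / n - q| := (((hX n).div_const _).sub_const _).abs
    exact this measurableSet_Iio
  have i0 := hint p0 hp0 n hn
  have i1 := hint _ hpp n hn
  have i2 := hint _ hpm n hn
  have e0 := ProbabilityTheory.exp_cgf i0
  have e1 := ProbabilityTheory.exp_cgf i1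
  have e2 := ProbabilityTheory.exp_cgf i2
  have hpt : ∀ ω, Real.exp (p0 * X n ω) ≤ E.indicator (fun _ => Real.exp (n * (p0 * q + ε))) ω
      + Real.exp (-(h * n * (q + ε))) * Real.exp ((p0 + h) * X n ω)
      + Real.exp (h * n * (q - ε)) * Real.exp ((p0 - h) * X n ω) := by
    intro ω
    have P1 := (Real.exp_pos (-(h * n * (q + ε)) + ((p0 + h) * X n ω))).le
    have P2 := (Real.exp_pos (h * n * (q - ε) + ((p0 - h) * X n ω))).le
    rw [← Real.exp_add, ← Real.exp_add]
    by_cases hω : ω ∈ E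
    · rw [Set.indicator_of_mem hω]
      have h1 : |X n ω / n - q| < ε := hω
      have : p0 * X n ω ≤ n * (p0 * q + ε) := by
        have h2 : p0 * (X n ω / n - q) ≤ ε := by
          calc _ ≤ |p0 * (X n ω / n - q)| := le_abs_self _
            _ = |p0| * |X n ω / n - q| := abs_mul _ _
            _ ≤ 1 * ε := by
                gcongr
                exact abs_le.2 ⟨hp0.1.le, hp0.2.le⟩
            _ = ε := one_mul _
        have h3 : X n ω = n * (X n ω / n) := by field_simp
        rw [h3]; nlinarith
      have := Real.exp_le_exp.2 this
      linarith
    · rw [Set.indicator_of_notMem hω]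
      have h1 : ε ≤ |X n ω / n - q| := not_lt.1 hω
      rcases le_abs.1 h1 with h2 | h2
      · have : n * (q + ε) ≤ X n ω := by
          have : q + ε ≤ X n ω / n := by linarith
          rw [le_div_iff₀ hn0] at this; linarith
        have : p0 * X n ω ≤ -(h * n * (q + ε)) + ((p0 + h) * X n ω) := by nlinarith
        have := Real.exp_le_exp.2 this
        linarith
      · have : X n ω ≤ n * (q - ε) := by
          have : X n ω / n ≤ q - ε := by linarith
          rw [div_le_iff₀ hn0] at this; linarith
        have : p0 * X n ω ≤ h * n * (q - ε) + ((p0 - h) * X n ω) := by nlinarith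
        have := Real.exp_le_exp.2 this
        linarith
  have iE : Integrable (E.indicator (fun _ : Ω => Real.exp (n * (p0 * q + ε)))) ν :=
    (integrable_const _).indicator hEm
  have hmain : Real.exp (ProbabilityTheory.cgf (X n) ν p0) ≤
      ν.real E * Real.exp (n * (p0 * q + ε))
      + Real.exp (-(h * n * (q + ε))) * Real.exp (ProbabilityTheory.cgf (X n) ν (p0 + h))
      + Real.exp (h * n * (q - ε)) * Real.exp (ProbabilityTheory.cgf (X n) ν (p0 - h)) := by
    rw [e0, e1, e2]
    unfold ProbabilityTheory.mgf
    refine (integral_mono i0 ((iE.add (i1.const_mul _)).add (i2.const_mul _)) hpt).trans_eq ?_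
    rw [integral_add' (iE.add (i1.const_mul _)) (i2.const_mul _), integral_add' iE (i1.const_mul _), integral_const_mul,
      integral_const_mul, integral_indicator hEm]
    simp
  rw [← Real.exp_add, ← Real.exp_add] at hmain
  have b1 : Real.exp (-(h * n * (q + ε)) + ProbabilityTheory.cgf (X n) ν (p0 + h))
      ≤ Real.exp (n * (Lam p0 - 2 * η)) := by
    apply Real.exp_le_exp.2
    have : (Lam (p0+h) + η) * n ≤ (Lam p0 + h * q + ε / 2 * h + η) * n := by gcongr
    have e : n * (h * ε) = 6 * (n * η) := by rw [hη]; ring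
    nlinarith
  have b2 : Real.exp (h * n * (q - ε) + ProbabilityTheory.cgf (X n) ν (p0 - h))
      ≤ Real.exp (n * (Lam p0 - 2 * η)) := by
    apply Real.exp_le_exp.2
    have : (Lam (p0-h) + η) * n ≤ (Lam p0 - h * q + ε / 2 * h + η) * n := by gcongr
    have e : n * (h * ε) = 6 * (n * η) := by rw [hη]; ring
    nlinarith
  have b0 : Real.exp (n * (Lam p0 - η)) ≤ Real.exp (ProbabilityTheory.cgf (X n) ν p0) :=
    Real.exp_le_exp.2 (by linarith)
  have b3 : Real.exp (n * (Lam p0 - 2 * η)) * 4 ≤ Real.exp (n * (Lam p0 - η)) := by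
    have l4 : Real.exp (Real.log 4) = 4 := Real.exp_log (by norm_num)
    calc _ = Real.exp (n * (Lam p0 - 2 * η) + Real.log 4) := by rw [Real.exp_add, l4]
      _ ≤ _ := Real.exp_le_exp.2 (by linarith)
  have b4 : Real.exp (n * (Lam p0 - η)) ≤ 2 * (ν.real E * Real.exp (n * (p0 * q + ε))) := by
    linarith
  have b5 : 2 * Real.exp (n * (Lam p0 - p0 * q - 3 * ε)) * Real.exp (n * (p0 * q + ε)) ≤ Real.exp (n * (Lam p0 - η)) := by
    have l2 : Real.exp (Real.log 2) = 2 := Real.exp_log (by norm_num)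
    have : (n:ℝ) * η ≤ n * ε := by gcongr
    calc _ = Real.exp (Real.log 2 + n * (Lam p0 - p0 * q - 3 * ε) + n * (p0 * q + ε)) := by
            rw [Real.exp_add, Real.exp_add, l2]
      _ ≤ _ := Real.exp_le_exp.2 (by linarith)
  have b6 := b5.trans b4
  have : Real.exp (n * (Lam p0 - p0 * q - 3 * ε)) * Real.exp (n * (p0 * q + ε)) ≤ ν.real E * Real.exp (n * (p0 * q + ε)) := by linarith
  exact le_of_mul_le_mul_right this (Real.exp_pos _)

lemma ge_chernoff_right {Ω : Type*} [MeasurableSpace Ω] {ν : Measure Ω} [IsProbabilityMeasure ν]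
    {X : ℕ → Ω → ℝ} {Lam : ℝ → ℝ}
    (hint : ∀ p ∈ Set.Ioo (-1:ℝ) 1, ∀ n, 1 ≤ n → Integrable (fun ω => Real.exp (p * X n ω)) ν)
    (hLam : ∀ p ∈ Set.Ioo (-1 : ℝ) 1,
      Tendsto (fun n : ℕ => ProbabilityTheory.cgf (X n) ν p / n) atTop (nhds (Lam p)))
    {p a c : ℝ} (hp : p ∈ Set.Ioo (-1 : ℝ) 1) (hp0 : 0 ≤ p) (hc : c < p * a - Lam p) :
    ∀ᶠ n : ℕ in atTop, ν.real {ω | a ≤ X n ω / n} ≤ Real.exp (n * (-c)) := by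
  have t1 := (hLam _ hp).eventually_lt_const (show Lam p < p * a - c by linarith)
  filter_upwards [t1, eventually_ge_atTop 1] with n t1 hn
  have hn0 : (0:ℝ) < n := by exact_mod_cast hn
  rw [div_lt_iff₀ hn0] at t1
  have h := ProbabilityTheory.measure_ge_le_exp_cgf (μ := ν) (X := X n) (a * n) hp0 (hint p hp n hn)
  have e : {ω | a ≤ X n ω / n} = {ω | a * n ≤ X n ω} := by
    ext ω; exact le_div_iff₀ hn0
  rw [e]
  refine h.trans (Real.exp_le_exp.2 ?_)
  nlinarith

lemma ge_chernoff_left {Ω : Type*} [MeasurableSpace Ω] {ν : Measure Ω} [IsProbabilityMeasure ν]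
    {X : ℕ → Ω → ℝ} {Lam : ℝ → ℝ}
    (hint : ∀ p ∈ Set.Ioo (-1:ℝ) 1, ∀ n, 1 ≤ n → Integrable (fun ω => Real.exp (p * X n ω)) ν)
    (hLam : ∀ p ∈ Set.Ioo (-1 : ℝ) 1,
      Tendsto (fun n : ℕ => ProbabilityTheory.cgf (X n) ν p / n) atTop (nhds (Lam p)))
    {p a c : ℝ} (hp : p ∈ Set.Ioo (-1 : ℝ) 1) (hp0 : p ≤ 0) (hc : c < p * a - Lam p) :
    ∀ᶠ n : ℕ in atTop, ν.real {ω | X n ω / n ≤ a} ≤ Real.exp (n * (-c)) := by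
  have t1 := (hLam _ hp).eventually_lt_const (show Lam p < p * a - c by linarith)
  filter_upwards [t1, eventually_ge_atTop 1] with n t1 hn
  have hn0 : (0:ℝ) < n := by exact_mod_cast hn
  rw [div_lt_iff₀ hn0] at t1
  have h := ProbabilityTheory.measure_le_le_exp_cgf (μ := ν) (X := X n) (a * n) hp0 (hint p hp n hn)
  have e : {ω | X n ω / n ≤ a} = {ω | X n ω ≤ a * n} := by
    ext ω; exact div_le_iff₀ hn0
  rw [e]
  refine h.trans (Real.exp_le_exp.2 ?_)
  nlinarith

/-- Gärtner–Ellis for open intervals. -/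
lemma ge_main {Ω : Type*} [MeasurableSpace Ω] {ν : Measure Ω} [IsProbabilityMeasure ν]
    {X : ℕ → Ω → ℝ} {Lam : ℝ → ℝ} (hX : ∀ n, Measurable (X n))
    (hint : ∀ p ∈ Set.Ioo (-1:ℝ) 1, ∀ n, 1 ≤ n → Integrable (fun ω => Real.exp (p * X n ω)) ν)
    (hLam : ∀ p ∈ Set.Ioo (-1 : ℝ) 1,
      Tendsto (fun n : ℕ => ProbabilityTheory.cgf (X n) ν p / n) atTop (nhds (Lam p)))
    (hdiff : ∀ p ∈ Set.Ioo (-1:ℝ) 1, DifferentiableAt ℝ Lam p)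
    (cm cp : ℝ)
    (hcm : Tendsto (deriv Lam) (nhdsWithin (-1 : ℝ) (Set.Ioo (-1 : ℝ) 1)) (nhds cm))
    (hcp : Tendsto (deriv Lam) (nhdsWithin (1 : ℝ) (Set.Ioo (-1 : ℝ) 1)) (nhds cp))
    (I : ℝ → ℝ)
    (hI : ∀ q : ℝ, I q = sSup {r : ℝ | ∃ p ∈ Set.Ioo (-1 : ℝ) 1, r = p * q - Lam p})
    (J : Set ℝ) (hJo : IsOpen J) (hJc : J.OrdConnected) (hK : (J ∩ Set.Ioo cm cp).Nonempty) :
    Tendsto (fun n : ℕ => Real.log (ν.real {ω | X n ω / n ∈ J}) / n) atTop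
      (nhds (- sInf (I '' (J ∩ Set.Ioo cm cp)))) := by
  have hconv := ge_convex hint hLam
  have h0 : (0:ℝ) ∈ Set.Ioo (-1:ℝ) 1 := by constructor <;> norm_num
  have hL0 : Lam 0 = 0 := by
    have := hLam 0 h0
    simp only [ProbabilityTheory.cgf_zero, zero_div] at this
    exact tendsto_nhds_unique this tendsto_const_nhds
  set m := deriv Lam 0 with hm
  have htan : ∀ p ∈ Set.Ioo (-1:ℝ) 1, m * p ≤ Lam p := by
    intro p hp
    have := tangent_ineq hconv h0 hp (hdiff 0 h0)
    rw [hL0] at this; simpa using this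
  have hmono : ∀ p ∈ Set.Ioo (-1:ℝ) 1, ∀ p' ∈ Set.Ioo (-1:ℝ) 1, p < p' → deriv Lam p ≤ deriv Lam p' := by
    intro p hp p' hp' h
    exact (hconv.deriv_le_slope hp hp' h (hdiff p hp)).trans (hconv.slope_le_deriv hp hp' h (hdiff p' hp'))
  have nb1 : (nhdsWithin (-1 : ℝ) (Set.Ioo (-1 : ℝ) 1)).NeBot := by
    rw [nhdsWithin_Ioo_eq_nhdsGT (by norm_num)]; infer_instance
  have nb2 : (nhdsWithin (1 : ℝ) (Set.Ioo (-1 : ℝ) 1)).NeBot := by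
    rw [nhdsWithin_Ioo_eq_nhdsLT (by norm_num)]; infer_instance
  have hcmm : cm ≤ m := by
    refine le_of_tendsto hcm ?_
    filter_upwards [self_mem_nhdsWithin, mem_nhdsWithin_of_mem_nhds (Iio_mem_nhds (show (-1:ℝ) < 0 by norm_num))] with p hp hp2
    exact hmono p hp 0 h0 hp2
  have hmcp : m ≤ cp := by
    refine ge_of_tendsto hcp ?_
    filter_upwards [self_mem_nhdsWithin, mem_nhdsWithin_of_mem_nhds (Ioi_mem_nhds (show (0:ℝ) < 1 by norm_num))] with p hp hp2
    exact hmono 0 h0 p hp hp2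
  -- facts on I
  have hbd : ∀ q, BddAbove {r : ℝ | ∃ p ∈ Set.Ioo (-1 : ℝ) 1, r = p * q - Lam p} := by
    intro q
    refine ⟨|q - m|, ?_⟩
    rintro r ⟨p, hp, rfl⟩
    have h1 := htan p hp
    have h2 : p * (q - m) ≤ |q - m| := by
      calc _ ≤ |p * (q - m)| := le_abs_self _
        _ = |p| * |q - m| := abs_mul _ _
        _ ≤ 1 * |q - m| := by
            gcongr
            exact abs_le.2 ⟨hp.1.le, hp.2.le⟩
        _ = _ := one_mul _
    linarith
  have hIle : ∀ q, ∀ p ∈ Set.Ioo (-1:ℝ) 1, p * q - Lam p ≤ I q := by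
    intro q p hp
    rw [hI]; exact le_csSup (hbd q) ⟨p, hp, rfl⟩
  have hne : ∀ q, {r : ℝ | ∃ p ∈ Set.Ioo (-1 : ℝ) 1, r = p * q - Lam p}.Nonempty :=
    fun q => ⟨_, 0, h0, rfl⟩
  have hIub : ∀ q c, (∀ p ∈ Set.Ioo (-1:ℝ) 1, p * q - Lam p ≤ c) → I q ≤ c := by
    intro q c h
    rw [hI]
    refine csSup_le (hne q) ?_
    rintro r ⟨p, hp, rfl⟩; exact h p hp
  have hInn : ∀ q, 0 ≤ I q := by
    intro q
    have := hIle q 0 h0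
    rw [hL0] at this; simpa using this
  have hIlip : ∀ q q', I q ≤ I q' + |q - q'| := by
    intro q q'
    refine hIub _ _ fun p hp => ?_
    have h1 := hIle q' p hp
    have h2 : p * (q - q') ≤ |q - q'| := by
      calc _ ≤ |p * (q - q')| := le_abs_self _
        _ = |p| * |q - q'| := abs_mul _ _
        _ ≤ 1 * |q - q'| := by
            gcongr
            exact abs_le.2 ⟨hp.1.le, hp.2.le⟩
        _ = _ := one_mul _
    linarith
  have hIm : I m ≤ 0 := hIub _ _ fun p hp => by linarith [htan p hp]
  set K := J ∩ Set.Ioo cm cp with hKdef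
  set s := sInf (I '' K) with hs
  have hsle : ∀ q ∈ K, s ≤ I q := fun q hq =>
    csInf_le ⟨0, by rintro _ ⟨q, _, rfl⟩; exact hInn q⟩ ⟨q, hq, rfl⟩
  -- s ≤ I a for a in closure of K
  have hscl : ∀ a, (∀ ε > 0, ∃ q ∈ K, |q - a| < ε) → s ≤ I a := by
    intro a ha
    refine le_of_forall_pos_le_add fun ε hε => ?_
    obtain ⟨q, hq, hqa⟩ := ha ε hε
    have := hsle q hq
    have := hIlip q a
    linarith
  -- lower bound
  have hlow : ∀ ε > 0, ∀ᶠ n : ℕ in atTop,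
      Real.exp (n * (-s - ε)) ≤ ν.real {ω | X n ω / n ∈ J} := by
    intro ε hε
    obtain ⟨_, ⟨q, hq, rfl⟩, hqs⟩ := exists_lt_of_csInf_lt (hK.image I) (show s < s + ε / 2 by linarith)
    -- q is a derivative
    obtain ⟨p0, hp0, hd⟩ : ∃ p0 ∈ Set.Ioo (-1:ℝ) 1, deriv Lam p0 = q := by
      have o := (Set.ordConnected_Ioo (a := (-1:ℝ)) (b := 1)).image_deriv hdiff
      obtain ⟨p1, hp1, hq1⟩ := ((hcm.eventually_lt_const hq.2.1).and self_mem_nhdsWithin).exists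
      obtain ⟨p2, hp2, hq2⟩ := ((hcp.eventually_const_lt hq.2.2).and self_mem_nhdsWithin).exists
      have := o.out ⟨p1, hq1, rfl⟩ ⟨p2, hq2, rfl⟩ ⟨hp1.le, hp2.le⟩
      exact this
    have hIq : I q ≤ p0 * q - Lam p0 := hIub _ _ fun p hp => by
      have := tangent_ineq hconv hp0 hp (hdiff p0 hp0)
      rw [hd] at this; linarith
    have hIq2 := hIle q p0 hp0
    obtain ⟨δ, hδ, hball⟩ := Metric.isOpen_iff.1 hJo q hq.1
    have hmin : 0 < min δ (ε / 6) := lt_min hδ (by linarith)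
    have hdd : HasDerivAt Lam q p0 := hd ▸ (hdiff p0 hp0).hasDerivAt
    filter_upwards [ge_lower hX hint hLam hp0 hdd hmin] with n hn
    have hle := min_le_right δ (ε / 6)
    refine (Real.exp_le_exp.2 ?_).trans (hn.trans (measureReal_mono ?_))
    · exact mul_le_mul_of_nonneg_left (by linarith) (Nat.cast_nonneg n)
    · intro ω hω
      apply hball
      rw [Metric.mem_ball, Real.dist_eq]
      exact lt_of_lt_of_le hω (min_le_left _ _)
  -- upper bound
  have hup : ∀ ε > 0, ∀ᶠ n : ℕ in atTop,
      ν.real {ω | X n ω / n ∈ J} ≤ Real.exp (n * (-s + ε)) := by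
    intro ε hε
    have triv : s ≤ 0 → ∀ᶠ n : ℕ in atTop,
      ν.real {ω | X n ω / n ∈ J} ≤ Real.exp (n * (-s + ε)) := by
      intro hs0
      refine Eventually.of_forall fun n => measureReal_le_one.trans (Real.one_le_exp ?_)
      have : 0 ≤ -s + ε := by linarith
      positivity
    obtain ⟨q0, hq0⟩ := hK
    rcases le_total m q0 with hq0m | hq0m
    · set B := {q | q ∈ K ∧ m ≤ q} with hB
      have hBne : B.Nonempty := ⟨q0, hq0, hq0m⟩
      have hBbd : BddBelow B := ⟨m, fun q hq => hq.2⟩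
      set a := sInf B with ha
      have ham : m ≤ a := le_csInf hBne fun q hq => hq.2
      have haq0 : a ≤ q0 := csInf_le hBbd ⟨hq0, hq0m⟩
      have hacl : ∀ ε > 0, ∃ q ∈ K, |q - a| < ε := by
        intro ε hε
        obtain ⟨q, hq, hqa⟩ := exists_lt_of_csInf_lt hBne (show a < a + ε by linarith)
        have := csInf_le hBbd hq
        exact ⟨q, hq.1, by rw [abs_lt]; constructor <;> linarith⟩
      have hsa := hscl a hacl
      rcases ham.eq_or_lt with hma | hma
      · exact triv (by rw [← hma] at hsa; linarith)
      · have hJa : ∀ q ∈ J, a ≤ q := by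
          intro q hq
          by_contra hlt
          push Not at hlt
          obtain ⟨r, hr1, hr2⟩ := exists_between (max_lt hlt hma)
          have hr : r ∈ B := by
            have h1 := (max_lt_iff.1 hr1)
            refine ⟨⟨hJc.out hq hq0.1 ⟨h1.1.le, by linarith⟩, by linarith [h1.2], ?_⟩, h1.2.le⟩
            linarith [hq0.2.2]
          linarith [csInf_le hBbd hr]
        obtain ⟨p, hp, hp0, hpc⟩ : ∃ p ∈ Set.Ioo (-1:ℝ) 1, 0 ≤ p ∧ I a - ε < p * a - Lam p := by
          have h1 : I a - ε < I a := by linarith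
          nth_rw 2 [hI] at h1
          obtain ⟨_, ⟨p, hp, rfl⟩, hlt⟩ := exists_lt_of_lt_csSup (hne a) h1
          rcases le_total 0 p with h | h
          · exact ⟨p, hp, h, hlt⟩
          · refine ⟨0, h0, le_rfl, ?_⟩
            have := htan p hp
            rw [hL0]; nlinarith
        filter_upwards [ge_chernoff_right hint hLam hp hp0 hpc] with n hn
        refine (measureReal_mono ?_).trans (hn.trans (Real.exp_le_exp.2 ?_))
        · exact fun ω hω => hJa _ hω
        · gcongr; linarith
    · set B := {q | q ∈ K ∧ q ≤ m} with hB
      have hBne : B.Nonempty := ⟨q0, hq0, hq0m⟩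
      have hBbd : BddAbove B := ⟨m, fun q hq => hq.2⟩
      set a := sSup B with ha
      have ham : a ≤ m := csSup_le hBne fun q hq => hq.2
      have haq0 : q0 ≤ a := le_csSup hBbd ⟨hq0, hq0m⟩
      have hacl : ∀ ε > 0, ∃ q ∈ K, |q - a| < ε := by
        intro ε hε
        obtain ⟨q, hq, hqa⟩ := exists_lt_of_lt_csSup hBne (show a - ε < a by linarith)
        have := le_csSup hBbd hq
        exact ⟨q, hq.1, by rw [abs_lt]; constructor <;> linarith⟩
      have hsa := hscl a hacl
      rcases ham.eq_or_lt with hma | hma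
      · exact triv (by rw [hma] at hsa; linarith)
      · have hJa : ∀ q ∈ J, q ≤ a := by
          intro q hq
          by_contra hlt
          push Not at hlt
          obtain ⟨r, hr1, hr2⟩ := exists_between (lt_min hlt hma)
          have hr : r ∈ B := by
            have h1 := (lt_min_iff.1 hr2)
            refine ⟨⟨hJc.out hq0.1 hq ⟨by linarith, h1.1.le⟩, ?_, by linarith [h1.2]⟩, h1.2.le⟩
            linarith [hq0.2.1]
          linarith [le_csSup hBbd hr]
        obtain ⟨p, hp, hp0, hpc⟩ : ∃ p ∈ Set.Ioo (-1:ℝ) 1, p ≤ 0 ∧ I a - ε < p * a - Lam p := by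
          have h1 : I a - ε < I a := by linarith
          nth_rw 2 [hI] at h1
          obtain ⟨_, ⟨p, hp, rfl⟩, hlt⟩ := exists_lt_of_lt_csSup (hne a) h1
          rcases le_total 0 p with h | h
          · refine ⟨0, h0, le_rfl, ?_⟩
            have := htan p hp
            rw [hL0]; nlinarith
          · exact ⟨p, hp, h, hlt⟩
        filter_upwards [ge_chernoff_left hint hLam hp hp0 hpc] with n hn
        refine (measureReal_mono ?_).trans (hn.trans (Real.exp_le_exp.2 ?_))
        · exact fun ω hω => hJa _ hω
        · gcongr; linarith
  rw [Metric.tendsto_atTop']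
  intro ε hε
  have := (hlow (ε/2) (by linarith)).and ((hup (ε/2) (by linarith)).and (eventually_ge_atTop 1))
  obtain ⟨N, hN⟩ := eventually_atTop.1 this
  refine ⟨N, fun n hn => ?_⟩
  obtain ⟨h1, h2, h3⟩ := hN n hn.le
  have hn0 : (0:ℝ) < n := by exact_mod_cast h3
  have hpos := (Real.exp_pos _).trans_le h1
  have l1 := (Real.le_log_iff_exp_le hpos).2 h1
  have l2 := (Real.log_le_iff_le_exp hpos).2 h2
  have g1 : -s - ε/2 ≤ Real.log (ν.real {ω | X n ω / n ∈ J}) / n := by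
    rw [le_div_iff₀ hn0]; linarith
  have g2 : Real.log (ν.real {ω | X n ω / n ∈ J}) / n ≤ -s + ε/2 := by
    rw [div_le_iff₀ hn0]; linarith
  rw [Real.dist_eq, abs_lt]; constructor <;> linarith

lemma pf_exists {A : Type*} [Fintype A] [Nonempty A] (M : A → A → ℝ) (hM : ∀ x y, 0 < M x y) :
    ∃ (ρ : ℝ) (v : A → ℝ), 0 < ρ ∧ (∀ x, 0 < v x) ∧ ∑ x, v x = 1 ∧
      ∀ x, ∑ y, M x y * v y = ρ * v x := by
  classical
  set C := ∑ x, ∑ y, M x y with hC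
  have hMC : ∀ x y, M x y ≤ C := by
    intro x y
    calc M x y ≤ ∑ y, M x y := Finset.single_le_sum (fun y _ => (hM x y).le) (Finset.mem_univ y)
      _ ≤ C := Finset.single_le_sum (f := fun x => ∑ y, M x y)
          (fun x _ => Finset.sum_nonneg fun y _ => (hM x y).le) (Finset.mem_univ x)
  set S : Set (ℝ × (A → ℝ)) := (Set.Icc 0 C ×ˢ stdSimplex ℝ A) ∩
    {z | ∀ x, z.1 * z.2 x ≤ ∑ y, M x y * z.2 y} with hS
  have hScomp : IsCompact S := by
    refine (isCompact_Icc.prod (isCompact_stdSimplex ℝ A)).inter_right ?_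
    rw [Set.ofPred_forall]
    refine isClosed_iInter fun x => isClosed_le (by fun_prop) (by fun_prop)
  have hCpos : 0 < C := by
    obtain ⟨x⟩ := ‹Nonempty A›
    exact (hM x x).trans_le (hMC x x)
  have hSne : S.Nonempty := by
    obtain ⟨x0⟩ := ‹Nonempty A›
    refine ⟨(0, Pi.single x0 1), ⟨⟨⟨le_rfl, hCpos.le⟩, single_mem_stdSimplex ℝ x0⟩, ?_⟩⟩
    intro x
    simp only [zero_mul]
    refine Finset.sum_nonneg fun y _ => mul_nonneg (hM x y).le ?_
    by_cases h : y = x0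
    · subst h; simp
    · simp [h]
  obtain ⟨⟨ρ, v⟩, hmem, hmax⟩ := hScomp.exists_isMaxOn hSne continuous_fst.continuousOn
  obtain ⟨⟨⟨hρ0, hρC⟩, hv⟩, hineq⟩ := hmem
  simp only at hρ0 hρC hineq
  have hv : (∀ x, 0 ≤ v x) ∧ ∑ x, v x = 1 := hv
  -- positivity of M w for w ≥ 0, w ≠ 0
  have hMpos : ∀ w : A → ℝ, (∀ x, 0 ≤ w x) → (∃ x, 0 < w x) → ∀ x, 0 < ∑ y, M x y * w y := by
    intro w hw ⟨x1, hx1⟩ x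
    exact Finset.sum_pos' (fun y _ => mul_nonneg (hM x y).le (hw y)) ⟨x1, Finset.mem_univ _, mul_pos (hM x x1) hx1⟩
  have hvex : ∃ x, 0 < v x := by
    by_contra h
    push Not at h
    have : ∑ x, v x ≤ 0 := Finset.sum_nonpos fun x _ => h x
    linarith [hv.2]
  have hMv := hMpos v hv.1 hvex
  have heq : ∀ x, ∑ y, M x y * v y = ρ * v x := by
    by_contra hne
    push Not at hne
    obtain ⟨x0, hx0⟩ := hne
    set w : A → ℝ := fun x => ∑ y, M x y * v y with hw
    have hwpos : ∀ x, 0 < w x := hMv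
    have hd := hMpos (fun x => w x - ρ * v x) (fun x => sub_nonneg.2 (hineq x))
      ⟨x0, sub_pos.2 (lt_of_le_of_ne (hineq x0) (Ne.symm hx0))⟩
    have hd2 : ∀ x, ρ * w x < ∑ y, M x y * w y := by
      intro x
      have h1 := hd x
      simp only [mul_sub, Finset.sum_sub_distrib] at h1
      have h2 : ∑ y, M x y * (ρ * v y) = ρ * w x := by
        rw [hw, Finset.mul_sum]; exact Finset.sum_congr rfl fun y _ => by ring
      linarith
    -- new ratio
    obtain ⟨x1, -, hx1⟩ := Finset.exists_min_image Finset.univ (fun x => (∑ y, M x y * w y) / w x) Finset.univ_nonempty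
    set r := (∑ y, M x1 y * w y) / w x1 with hr
    have hrρ : ρ < r := by rw [hr, lt_div_iff₀ (hwpos x1)]; exact hd2 x1
    have hrw : ∀ x, r * w x ≤ ∑ y, M x y * w y := fun x =>
      (le_div_iff₀ (hwpos x)).1 (hx1 x (Finset.mem_univ x))
    set T := ∑ x, w x with hT
    have hTpos : 0 < T := Finset.sum_pos (fun x _ => hwpos x) Finset.univ_nonempty
    have hrC : r ≤ C := by
      have h1 : r * T ≤ C * T := by
        rw [hT, Finset.mul_sum]
        calc _ ≤ ∑ x, ∑ y, M x y * w y := Finset.sum_le_sum fun x _ => hrw x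
          _ ≤ ∑ x, ∑ y, M x y * T := Finset.sum_le_sum fun x _ => Finset.sum_le_sum fun y _ =>
              mul_le_mul_of_nonneg_left (Finset.single_le_sum (fun z _ => (hwpos z).le) (Finset.mem_univ y)) (hM x y).le
          _ = C * T := by rw [hC, Finset.sum_mul]; simp_rw [Finset.sum_mul]
      exact le_of_mul_le_mul_right h1 hTpos
    have : (r, fun x => w x / T) ∈ S := by
      refine ⟨⟨⟨hρ0.trans hrρ.le, hrC⟩, ⟨fun x => (div_pos (hwpos x) hTpos).le, ?_⟩⟩, ?_⟩
      · rw [← Finset.sum_div]; exact div_self hTpos.ne'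
      · intro x
        simp only
        calc r * (w x / T) = (r * w x) / T := by ring
          _ ≤ (∑ y, M x y * w y) / T := by gcongr; exact hrw x
          _ = _ := by rw [Finset.sum_div]; exact Finset.sum_congr rfl fun y _ => by ring
    have := hmax this
    simp only [Set.mem_ofPred_eq] at this
    linarith
  have hρv : ∀ x, 0 < ρ * v x := fun x => heq x ▸ hMv x
  have hρpos : 0 < ρ := by
    rcases hρ0.eq_or_lt with h | h
    · obtain ⟨x⟩ := ‹Nonempty A›
      have := hρv x; rw [← h] at this; simp at this
    · exact h
  exact ⟨ρ, v, hρpos, fun x => (mul_pos_iff_of_pos_left hρpos).1 (hρv x), hv.2, heq⟩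

lemma pf_unique {A : Type*} [Fintype A] [Nonempty A] (M : A → A → ℝ) (hM : ∀ x y, 0 < M x y)
    {ρ : ℝ} {v w : A → ℝ} (hv : ∀ x, 0 < v x) (hv1 : ∑ x, v x = 1)
    (hvM : ∀ x, ∑ y, M x y * v y = ρ * v x)
    (hw1 : ∑ x, w x = 1)
    (hwM : ∀ x, ∑ y, M x y * w y = ρ * w x) : w = v := by
  obtain ⟨x1, -, hx1⟩ := Finset.exists_min_image Finset.univ (fun x => w x / v x) Finset.univ_nonempty
  set t := w x1 / v x1 with ht
  have hz : ∀ x, 0 ≤ w x - t * v x := fun x =>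
    sub_nonneg.2 ((le_div_iff₀ (hv x)).1 (hx1 x (Finset.mem_univ x)))
  have hz1 : w x1 - t * v x1 = 0 := by
    have := (hv x1).ne'
    rw [ht]; field_simp; ring
  have hsum : ∑ y, M x1 y * (w y - t * v y) = 0 := by
    have : ∑ y, M x1 y * (w y - t * v y) = (∑ y, M x1 y * w y) - t * ∑ y, M x1 y * v y := by
      rw [Finset.mul_sum, ← Finset.sum_sub_distrib]; exact Finset.sum_congr rfl fun y _ => by ring
    rw [this, hvM, hwM]
    linear_combination ρ * hz1
  have h0 := (Finset.sum_eq_zero_iff_of_nonneg (fun y _ => mul_nonneg (hM x1 y).le (hz y))).1 hsum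
  have hall : ∀ y, w y = t * v y := by
    intro y
    have := (mul_eq_zero.1 (h0 y (Finset.mem_univ y))).resolve_left (hM x1 y).ne'
    linarith
  have ht1 : t = 1 := by
    have : ∑ x, w x = t * ∑ x, v x := by
      rw [Finset.mul_sum]; exact Finset.sum_congr rfl fun y _ => hall y
    rw [hw1, hv1] at this; linarith
  funext y; rw [hall y, ht1, one_mul]

/-- left Perron eigenvector -/
lemma pf_left {A : Type*} [Fintype A] [Nonempty A] (M : A → A → ℝ) (hM : ∀ x y, 0 < M x y)
    {ρ : ℝ} {v : A → ℝ} (hv : ∀ x, 0 < v x)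
    (hvM : ∀ x, ∑ y, M x y * v y = ρ * v x) :
    ∃ u : A → ℝ, (∀ x, 0 < u x) ∧ ∀ y, ∑ x, u x * M x y = ρ * u y := by
  obtain ⟨σ, u, hσ, hu, -, hu2⟩ := pf_exists (fun x y => M y x) (fun x y => hM y x)
  have h1 : ∑ x, u x * ∑ y, M x y * v y = ρ * ∑ x, u x * v x := by
    rw [Finset.mul_sum]; exact Finset.sum_congr rfl fun x _ => by rw [hvM]; ring
  have h2 : ∑ x, u x * ∑ y, M x y * v y = σ * ∑ x, u x * v x := by
    rw [Finset.mul_sum]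
    simp_rw [Finset.mul_sum]
    rw [Finset.sum_comm]
    refine Finset.sum_congr rfl fun y _ => ?_
    calc _ = (∑ x, M x y * u x) * v y := by
          rw [Finset.sum_mul]; exact Finset.sum_congr rfl fun x _ => by ring
      _ = _ := by rw [hu2]; ring
  have hpos : 0 < ∑ x, u x * v x := Finset.sum_pos (fun x _ => mul_pos (hu x) (hv x)) Finset.univ_nonempty
  have hσρ : σ = ρ := mul_right_cancel₀ hpos.ne' (h2.symm.trans h1)
  refine ⟨u, hu, fun y => ?_⟩
  rw [← hσρ, ← hu2]
  exact Finset.sum_congr rfl fun x _ => by ring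

/-- differentiability of the Perron root -/
lemma pf_diff {A : Type*} [Fintype A] [Nonempty A] (M : ℝ → A → A → ℝ)
    (hM : ∀ p x y, 0 < M p x y) (hMd : ∀ x y, Differentiable ℝ (fun p => M p x y))
    (ρ : ℝ → ℝ) (v : ℝ → A → ℝ) (hv : ∀ p x, 0 < v p x) (hv1 : ∀ p, ∑ x, v p x = 1)
    (hvM : ∀ p x, ∑ y, M p x y * v p y = ρ p * v p x) : Differentiable ℝ ρ := by
  intro p
  obtain ⟨u, hu, huM⟩ := pf_left (M p) (hM p) (hv p) (hvM p)
  have hvsimp : ∀ q, v q ∈ stdSimplex ℝ A := fun q => ⟨fun x => (hv q x).le, hv1 q⟩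
  have hpos : ∀ w ∈ stdSimplex ℝ A, 0 < ∑ x, u x * w x := by
    intro w hw
    obtain ⟨x1, hx1⟩ : ∃ x, 0 < w x := by
      by_contra h
      push Not at h
      have : ∑ x, w x ≤ 0 := Finset.sum_nonpos fun x _ => h x
      have := hw.2
      linarith
    exact Finset.sum_pos' (fun y _ => mul_nonneg (hu y).le (hw.1 y)) ⟨x1, Finset.mem_univ _, mul_pos (hu x1) hx1⟩
  -- key identity
  have key : ∀ q, (ρ q - ρ p) * ∑ x, u x * v q x = ∑ x, ∑ y, u x * (M q x y - M p x y) * v q y := by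
    intro q
    have h1 : ρ q * ∑ x, u x * v q x = ∑ x, ∑ y, u x * M q x y * v q y := by
      rw [Finset.mul_sum]
      refine Finset.sum_congr rfl fun x _ => ?_
      calc _ = u x * (ρ q * v q x) := by ring
        _ = _ := by rw [← hvM, Finset.mul_sum]; exact Finset.sum_congr rfl fun y _ => by ring
    have h2 : ρ p * ∑ x, u x * v q x = ∑ x, ∑ y, u x * M p x y * v q y := by
      rw [Finset.sum_comm, Finset.mul_sum]
      refine Finset.sum_congr rfl fun y _ => ?_
      rw [← Finset.sum_mul, huM]; ring
    rw [sub_mul, h1, h2, ← Finset.sum_sub_distrib]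
    refine Finset.sum_congr rfl fun x _ => ?_
    rw [← Finset.sum_sub_distrib]
    exact Finset.sum_congr rfl fun y _ => by ring
  have key' : ∀ q, ρ q - ρ p = (∑ x, ∑ y, u x * (M q x y - M p x y) * v q y) / ∑ x, u x * v q x := by
    intro q
    rw [eq_div_iff (hpos _ (hvsimp q)).ne']; exact key q
  -- continuity of rho at p, through a lower bound for the denominator
  obtain ⟨x1, -, hx1⟩ := Finset.exists_min_image Finset.univ u Finset.univ_nonempty
  have hden : ∀ q, u x1 ≤ ∑ x, u x * v q x := by
    intro q
    calc u x1 = ∑ x, u x1 * v q x := by rw [← Finset.mul_sum, hv1, mul_one]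
      _ ≤ _ := Finset.sum_le_sum fun x _ => mul_le_mul_of_nonneg_right (hx1 x (Finset.mem_univ x)) (hv q x).le
  have hvle : ∀ q x, v q x ≤ 1 := fun q x => by
    rw [← hv1 q]; exact Finset.single_le_sum (fun z _ => (hv q z).le) (Finset.mem_univ x)
  have hρc : Tendsto ρ (nhds p) (nhds (ρ p)) := by
    have hb : ∀ q, |ρ q - ρ p| ≤ (∑ x, ∑ y, u x * |M q x y - M p x y|) / u x1 := by
      intro q
      rw [key' q, abs_div, abs_of_pos (hpos _ (hvsimp q))]
      have : |∑ x, ∑ y, u x * (M q x y - M p x y) * v q y| ≤ ∑ x, ∑ y, u x * |M q x y - M p x y| := by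
        refine (Finset.abs_sum_le_sum_abs _ _).trans (Finset.sum_le_sum fun x _ => ?_)
        refine (Finset.abs_sum_le_sum_abs _ _).trans (Finset.sum_le_sum fun y _ => ?_)
        rw [abs_mul, abs_mul, abs_of_pos (hu x), abs_of_pos (hv q y)]
        exact mul_le_of_le_one_right (mul_nonneg (hu x).le (abs_nonneg _)) (hvle q y)
      exact div_le_div₀ ((abs_nonneg _).trans this) this (hu x1) (hden q)
    have hlim : Tendsto (fun q => (∑ x, ∑ y, u x * |M q x y - M p x y|) / u x1) (nhds p) (nhds 0) := by
      have hc : Continuous (fun q => (∑ x, ∑ y, u x * |M q x y - M p x y|) / u x1) := by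
        refine Continuous.div_const ?_ _
        refine continuous_finsetSum _ fun x _ => continuous_finsetSum _ fun y _ => ?_
        exact continuous_const.mul (((hMd x y).continuous.sub continuous_const).abs)
      have := hc.tendsto p
      simpa using this
    rw [tendsto_iff_norm_sub_tendsto_zero]
    exact squeeze_zero (fun _ => norm_nonneg _) hb hlim
  -- continuity of v at p
  have hvc : Tendsto v (nhds p) (nhds (v p)) := by
    refine (isCompact_stdSimplex ℝ A).tendsto_nhds_of_unique_mapClusterPt
      (Eventually.of_forall hvsimp) ?_
    intro w hw hcl
    have hcl2 : MapClusterPt w (nhds p) v := hcl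
    refine pf_unique (M p) (hM p) (hv p) (hv1 p) (hvM p) hw.2 ?_
    intro x
    obtain ⟨U, hU, hUw⟩ := mapClusterPt_iff_ultrafilter.1 hcl2
    have l1 : Tendsto (fun q => ∑ y, M q x y * v q y) U (nhds (∑ y, M p x y * w y)) := by
      refine tendsto_finsetSum _ fun y _ => Tendsto.mul ?_ ?_
      · exact ((hMd x y).continuous.tendsto p).mono_left hU
      · exact (tendsto_pi_nhds.1 hUw) y
    have l2 : Tendsto (fun q => ρ q * v q x) U (nhds (ρ p * w x)) :=
      (hρc.mono_left hU).mul ((tendsto_pi_nhds.1 hUw) x)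
    simp_rw [hvM] at l1
    exact tendsto_nhds_unique l1 l2
  refine (HasDerivAt.differentiableAt (f' := (∑ x, ∑ y, u x * deriv (fun q => M q x y) p * v p y) / ∑ x, u x * v p x) ?_)
  rw [hasDerivAt_iff_tendsto_slope]
  have hvc' : ∀ x, Tendsto (fun q => v q x) (nhdsWithin p {p}ᶜ) (nhds (v p x)) := fun x =>
    ((tendsto_pi_nhds.1 hvc) x).mono_left nhdsWithin_le_nhds
  have : Tendsto (fun q => (∑ x, ∑ y, u x * slope (fun q => M q x y) p q * v q y) / ∑ x, u x * v q x)
      (nhdsWithin p {p}ᶜ) (nhds ((∑ x, ∑ y, u x * deriv (fun q => M q x y) p * v p y) / ∑ x, u x * v p x)) := by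
    refine Tendsto.div ?_ ?_ (hpos _ (hvsimp p)).ne'
    · refine tendsto_finsetSum _ fun x _ => tendsto_finsetSum _ fun y _ => ?_
      refine Tendsto.mul (Tendsto.const_mul _ ?_) (hvc' y)
      exact hasDerivAt_iff_tendsto_slope.1 (hMd x y p).hasDerivAt
    · exact tendsto_finsetSum _ fun x _ => (hvc' x).const_mul _
  refine this.congr fun q => ?_
  rw [slope_def_field, key' q, div_right_comm]
  congr 1
  rw [Finset.sum_div]
  refine Finset.sum_congr rfl fun x _ => ?_
  rw [Finset.sum_div]
  refine Finset.sum_congr rfl fun y _ => ?_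
  rw [slope_def_field]; ring

/-- `F` depends only on the coordinates `≤ m`. -/
def DepLe {A β : Type*} (m : ℕ) (F : (ℕ → A) → β) : Prop :=
  ∀ ω ω' : ℕ → A, (∀ i ≤ m, ω i = ω' i) → F ω = F ω'

def extWord {A : Type*} (m : ℕ) (w : Fin (m + 1) → A) : ℕ → A :=
  fun i => if h : i < m + 1 then w ⟨i, h⟩ else w 0

lemma depLe_eq {A β : Type*} {m : ℕ} {F : (ℕ → A) → β} (hF : DepLe m F) (ω : ℕ → A) :
    F ω = F (extWord m (fun i => ω i)) := by
  apply hF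
  intro i hi
  simp [extWord, Nat.lt_succ_of_le hi]

section Markov

variable {A : Type*} [Fintype A] [MeasurableSpace A] [MeasurableSingletonClass A]

lemma coord_meas (k : ℕ) (y : A) : MeasurableSet {ω : ℕ → A | ω k = y} := by
  have h : Measurable (fun ω : ℕ → A => ω k) := measurable_pi_apply k
  exact h (measurableSet_singleton y)

lemma depLe_measurable {β : Type*} [MeasurableSpace β] {m : ℕ} {F : (ℕ → A) → β} (hF : DepLe m F) :
    Measurable F := by
  have h1 : F = (fun w => F (extWord m w)) ∘ (fun (ω : ℕ → A) (i : Fin (m + 1)) => ω i) := by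
    funext ω; exact depLe_eq hF ω
  rw [h1]
  exact (measurable_of_finite _).comp (by fun_prop)

lemma depLe_integrable (ν : Measure (ℕ → A)) [IsFiniteMeasure ν] {m : ℕ} {F : (ℕ → A) → ℝ}
    (hF : DepLe m F) : Integrable F ν := by
  classical
  refine Integrable.of_bound (depLe_measurable hF).aestronglyMeasurable
    (∑ w : Fin (m + 1) → A, ‖F (extWord m w)‖) (ae_of_all _ fun ω => ?_)
  rw [depLe_eq hF ω]
  exact Finset.single_le_sum (f := fun w => ‖F (extWord m w)‖) (fun w _ => norm_nonneg _)
    (Finset.mem_univ (fun i : Fin (m + 1) => ω i))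

lemma depLe_integral (ν : Measure (ℕ → A)) [IsFiniteMeasure ν] {m : ℕ} {F : (ℕ → A) → ℝ}
    (hF : DepLe m F) :
    ∫ ω, F ω ∂ν = ∑ w : Fin (m + 1) → A,
      ν.real {ω | ∀ i ≤ m, ω i = extWord m w i} * F (extWord m w) := by
  classical
  set r : (ℕ → A) → (Fin (m + 1) → A) := fun ω i => ω i with hr
  have hrm : Measurable r := by fun_prop
  have h1 : ∫ ω, F ω ∂ν = ∫ w, F (extWord m w) ∂(ν.map r) := by
    rw [integral_map hrm.aemeasurable (measurable_of_finite _).aestronglyMeasurable]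
    exact integral_congr_ae (ae_of_all _ fun ω => depLe_eq hF ω)
  rw [h1, integral_fintype .of_finite]
  refine Finset.sum_congr rfl fun w _ => ?_
  rw [map_measureReal_apply hrm (measurableSet_singleton w), smul_eq_mul]
  congr 2
  ext ω
  simp only [Set.mem_preimage, Set.mem_singleton_iff, Set.mem_ofPred_eq, hr, funext_iff]
  constructor
  · intro h i hi
    have := h ⟨i, Nat.lt_succ_of_le hi⟩
    simp [extWord, Nat.lt_succ_of_le hi, ← this]
  · intro h i
    have := h i (Nat.le_of_lt_succ i.2)
    rw [this]; simp [extWord, i.2]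

variable {Q : A → A → ℝ} {μ : A → ℝ} {P : Measure (ℕ → A)} [IsProbabilityMeasure P]

lemma markov_fun
    (hP : ∀ (n : ℕ) (a : ℕ → A), (P {ω | ∀ i ≤ n, ω i = a i}).toReal
        = μ (a 0) * ∏ i ∈ Finset.range n, Q (a i) (a (i + 1)))
    {m : ℕ} {F : (ℕ → A) → ℝ} (hF : DepLe m F) (g : A → A → ℝ) :
    ∫ ω, F ω * g (ω m) (ω (m + 1)) ∂P = ∫ ω, F ω * ∑ y, Q (ω m) y * g (ω m) y ∂P := by
  classical
  have hC : ∀ y, MeasurableSet {ω : ℕ → A | ω (m + 1) = y} := fun y =>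
    coord_meas (m + 1) y
  have hFy : ∀ y, DepLe m (fun ω => F ω * g (ω m) y) := by
    intro y ω ω' h
    simp only [hF ω ω' h, h m le_rfl]
  have hFQ : ∀ y, DepLe m (fun ω => F ω * (Q (ω m) y * g (ω m) y)) := by
    intro y ω ω' h
    simp only [hF ω ω' h, h m le_rfl]
  have h1 : ∀ ω : ℕ → A, F ω * g (ω m) (ω (m + 1)) =
      ∑ y, ({ω : ℕ → A | ω (m + 1) = y}).indicator (fun ω => F ω * g (ω m) y) ω := by
    intro ω
    rw [Finset.sum_eq_single (ω (m + 1))]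
    · rw [Set.indicator_of_mem]; exact rfl
    · intro y _ hy
      have hn : ω ∉ {ω : ℕ → A | ω (m + 1) = y} := fun h => hy (Eq.symm h)
      rw [Set.indicator_of_notMem hn]
    · simp
  simp_rw [h1, Finset.mul_sum]
  rw [integral_finsetSum _ fun y _ => (depLe_integrable P (hFy y)).indicator (hC y),
    integral_finsetSum _ fun y _ => depLe_integrable P (hFQ y)]
  refine Finset.sum_congr rfl fun y _ => ?_
  rw [integral_indicator (hC y), depLe_integral _ (hFy y), depLe_integral _ (hFQ y)]
  refine Finset.sum_congr rfl fun w _ => ?_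
  have hcyl : (P.restrict {ω : ℕ → A | ω (m + 1) = y}).real {ω | ∀ i ≤ m, ω i = extWord m w i}
      = P.real {ω | ∀ i ≤ m, ω i = extWord m w i} * Q (extWord m w m) y := by
    rw [measureReal_restrict_apply' (hC y)]
    have e : {ω : ℕ → A | ∀ i ≤ m, ω i = extWord m w i} ∩ {ω | ω (m + 1) = y}
        = {ω | ∀ i ≤ m + 1, ω i = Function.update (extWord m w) (m + 1) y i} := by
      ext ω
      simp only [Set.mem_inter_iff, Set.mem_ofPred_eq]
      constructor
      · rintro ⟨h1, h2⟩ i hi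
        rcases Nat.lt_or_ge m i with h | h
        · have : i = m + 1 := by omega
          subst this; simp [h2]
        · rw [Function.update_of_ne (by omega)]; exact h1 i h
      · intro h
        refine ⟨fun i hi => ?_, ?_⟩
        · have := h i (by omega)
          rwa [Function.update_of_ne (by omega)] at this
        · have := h (m + 1) le_rfl
          simpa using this
    rw [e]
    unfold Measure.real
    rw [hP, hP, Finset.prod_range_succ, mul_assoc]
    congr 2
    · refine Finset.prod_congr rfl fun i hi => ?_
      have := Finset.mem_range.1 hi
      rw [Function.update_of_ne (by omega), Function.update_of_ne (by omega)]
    · rw [Function.update_of_ne (by omega)]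
      simp
  rw [hcyl]; ring

/-- the event that the word `x 1, ..., x n` is seen at position `k` -/
def matchSet {A : Type*} (n : ℕ) (x : ℕ → A) (k : ℕ) : Set (ℕ → A) :=
  {y | ∀ i, 1 ≤ i → i ≤ n → y (k + i) = x i}

lemma matchSet_dep {A : Type*} (n : ℕ) (x : ℕ → A) (k : ℕ) :
    DepLe (k + n) (fun y => y ∈ matchSet n x k) := by
  intro y y' h
  apply propext
  constructor
  · intro hy i h1 h2
    rw [← h _ (by omega)]; exact hy i h1 h2
  · intro hy i h1 h2
    rw [h _ (by omega)]; exact hy i h1 h2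

lemma dep_meas {m : ℕ} {B : Set (ℕ → A)} (hB : DepLe m (fun y => y ∈ B)) : MeasurableSet B :=
  measurableSet_setOfPred.2 (depLe_measurable hB)

lemma dep_mono {A β : Type*} {m m' : ℕ} (h : m ≤ m') {F : (ℕ → A) → β} (hF : DepLe m F) : DepLe m' F :=
  fun ω ω' hh => hF ω ω' fun i hi => hh i (hi.trans h)

lemma dep_inter {A : Type*} {m : ℕ} {B C : Set (ℕ → A)} (hB : DepLe m (fun y => y ∈ B))
    (hC : DepLe m (fun y => y ∈ C)) : DepLe m (fun y => y ∈ B ∩ C) := by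
  intro ω ω' h
  have h1 := hB ω ω' h
  have h2 := hC ω ω' h
  simp only [Set.mem_inter_iff] at *
  rw [h1, h2]

lemma dep_indicator {A : Type*} {m : ℕ} {B : Set (ℕ → A)} (hB : DepLe m (fun y => y ∈ B)) :
    DepLe m (B.indicator (fun _ => (1:ℝ))) := by
  classical
  intro ω ω' h
  have h1 := hB ω ω' h
  simp only [Set.indicator_apply]
  simp only at h1
  simp only [h1]

/-- one step -/
lemma markov_set
    (hP : ∀ (n : ℕ) (a : ℕ → A), (P {ω | ∀ i ≤ n, ω i = a i}).toReal
        = μ (a 0) * ∏ i ∈ Finset.range n, Q (a i) (a (i + 1)))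
    {m : ℕ} {B : Set (ℕ → A)} (hB : DepLe m (fun y => y ∈ B)) (y : A) :
    P.real (B ∩ {ω | ω (m + 1) = y}) = ∫ ω in B, Q (ω m) y ∂P := by
  classical
  have h := markov_fun hP (dep_indicator hB) (fun _ y' => if y' = y then 1 else 0)
  have hC : MeasurableSet {ω : ℕ → A | ω (m + 1) = y} :=
    coord_meas (m + 1) y
  have e1 : ∀ ω : ℕ → A, B.indicator (fun _ => (1:ℝ)) ω * (if ω (m + 1) = y then 1 else 0)
      = (B ∩ {ω | ω (m + 1) = y}).indicator (fun _ => (1:ℝ)) ω := by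
    intro ω
    by_cases h1 : ω ∈ B <;> by_cases h2 : ω (m + 1) = y <;> simp [h1, h2]
  have e2 : ∀ ω : ℕ → A, B.indicator (fun _ => (1:ℝ)) ω * ∑ y', Q (ω m) y' * (if y' = y then 1 else 0)
      = B.indicator (fun ω => Q (ω m) y) ω := by
    intro ω
    by_cases h1 : ω ∈ B <;> simp [h1]
  simp_rw [e1, e2] at h
  rw [integral_indicator ((dep_meas hB).inter hC), integral_indicator (dep_meas hB)] at h
  simpa using h

lemma match_succ
    (hP : ∀ (n : ℕ) (a : ℕ → A), (P {ω | ∀ i ≤ n, ω i = a i}).toReal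
        = μ (a 0) * ∏ i ∈ Finset.range n, Q (a i) (a (i + 1)))
    {k : ℕ} {B : Set (ℕ → A)} (hB : DepLe k (fun y => y ∈ B)) (x : ℕ → A) (j : ℕ) :
    P.real (B ∩ matchSet (j + 2) x k) = P.real (B ∩ matchSet (j + 1) x k) * Q (x (j + 1)) (x (j + 2)) := by
  have hB' : DepLe (k + (j + 1)) (fun y => y ∈ B ∩ matchSet (j + 1) x k) :=
    dep_inter (dep_mono (by omega) hB) (matchSet_dep _ _ _)
  have e : B ∩ matchSet (j + 2) x k = (B ∩ matchSet (j + 1) x k) ∩ {ω | ω (k + (j + 1) + 1) = x (j + 2)} := by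
    ext y
    simp only [matchSet, Set.mem_inter_iff, Set.mem_ofPred_eq]
    constructor
    · rintro ⟨h1, h2⟩
      exact ⟨⟨h1, fun i hi hi2 => h2 i hi (by omega)⟩, h2 (j + 2) (by omega) le_rfl⟩
    · rintro ⟨⟨h1, h2⟩, h3⟩
      refine ⟨h1, fun i hi hi2 => ?_⟩
      rcases Nat.lt_or_ge (j + 1) i with h | h
      · have : i = j + 2 := by omega
        subst this; exact h3
      · exact h2 i hi h
  rw [e, markov_set hP hB']
  rw [setIntegral_congr_fun (g := fun _ => Q (x (j + 1)) (x (j + 2))) (dep_meas hB')]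
  · simp
  · intro y hy
    have : y (k + (j + 1)) = x (j + 1) := hy.2 (j + 1) (by omega) le_rfl
    simp only [this]

/-- probability of the word `x 1, ..., x n` -/
def pw {A : Type*} (μ : A → ℝ) (Q : A → A → ℝ) (n : ℕ) (x : ℕ → A) : ℝ :=
  μ (x 1) * ∏ i ∈ Finset.range (n - 1), Q (x (i + 1)) (x (i + 2))

lemma match_prod
    (hP : ∀ (n : ℕ) (a : ℕ → A), (P {ω | ∀ i ≤ n, ω i = a i}).toReal
        = μ (a 0) * ∏ i ∈ Finset.range n, Q (a i) (a (i + 1)))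
    {k : ℕ} {B : Set (ℕ → A)} (hB : DepLe k (fun y => y ∈ B)) (x : ℕ → A) (j : ℕ) :
    P.real (B ∩ matchSet (j + 1) x k) =
      P.real (B ∩ {ω | ω (k + 1) = x 1}) * ∏ i ∈ Finset.range j, Q (x (i + 1)) (x (i + 2)) := by
  induction j with
  | zero =>
    simp only [Finset.range_zero, Finset.prod_empty, mul_one, zero_add]
    congr 2
    ext y
    simp only [matchSet, Set.mem_ofPred_eq]
    constructor
    · intro h; exact h 1 le_rfl le_rfl
    · intro h i h1 h2
      have : i = 1 := by omega
      subst this; exact h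
  | succ j ih => rw [match_succ hP hB, ih, Finset.prod_range_succ, mul_assoc]

lemma marginal
    (hP : ∀ (n : ℕ) (a : ℕ → A), (P {ω | ∀ i ≤ n, ω i = a i}).toReal
        = μ (a 0) * ∏ i ∈ Finset.range n, Q (a i) (a (i + 1)))
    (hstat : ∀ y, ∑ x, μ x * Q x y = μ y) (k : ℕ) (y : A) :
    P.real {ω | ω k = y} = μ y := by
  classical
  induction k generalizing y with
  | zero =>
    have := hP 0 (fun _ => y)
    simpa [Measure.real] using this
  | succ k ih =>
    have h := markov_fun hP (m := k) (F := fun _ => 1) (fun _ _ _ => rfl) (fun _ y' => if y' = y then 1 else 0)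
    have hC : ∀ k (y : A), MeasurableSet {ω : ℕ → A | ω k = y} := fun k y =>
      coord_meas k y
    have e1 : ∀ ω : ℕ → A, (1:ℝ) * (if ω (k + 1) = y then 1 else 0)
      = ({ω : ℕ → A | ω (k + 1) = y}).indicator (fun _ => (1:ℝ)) ω := by
      intro ω; by_cases h2 : ω (k + 1) = y <;> simp [h2]
    have e2 : ∀ ω : ℕ → A, (1:ℝ) * ∑ y', Q (ω k) y' * (if y' = y then 1 else 0)
      = ∑ x, ({ω : ℕ → A | ω k = x}).indicator (fun _ => Q x y) ω := by
      intro ω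
      simp [Set.indicator_apply]
    simp_rw [e1, e2] at h
    rw [integral_indicator (hC _ _), integral_finsetSum] at h
    · simp only [integral_indicator (hC _ _)] at h
      simp only [integral_const, MeasurableSet.univ, measureReal_restrict_apply, Set.univ_inter, smul_eq_mul, mul_one] at h
      rw [h, ← hstat]
      simp_rw [ih]
    · intro x _
      exact (integrable_const _).indicator (hC _ _)

lemma match_prob
    (hP : ∀ (n : ℕ) (a : ℕ → A), (P {ω | ∀ i ≤ n, ω i = a i}).toReal
        = μ (a 0) * ∏ i ∈ Finset.range n, Q (a i) (a (i + 1)))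
    (hstat : ∀ y, ∑ x, μ x * Q x y = μ y) (x : ℕ → A) (k n : ℕ) (hn : 1 ≤ n) :
    P.real (matchSet n x k) = pw μ Q n x := by
  obtain ⟨j, rfl⟩ : ∃ j, n = j + 1 := ⟨n - 1, by omega⟩
  have := match_prod hP (B := Set.univ) (k := k) (fun _ _ _ => rfl) x j
  simp only [Set.univ_inter] at this
  rw [this, marginal hP hstat]; simp [pw]

lemma match_lower
    (hP : ∀ (n : ℕ) (a : ℕ → A), (P {ω | ∀ i ≤ n, ω i = a i}).toReal
        = μ (a 0) * ∏ i ∈ Finset.range n, Q (a i) (a (i + 1)))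
    (hμ1 : ∀ x, μ x ≤ 1) {δ : ℝ} (hδ0 : 0 < δ) (hδ : ∀ x y, δ ≤ Q x y)
    {k : ℕ} {B : Set (ℕ → A)} (hB : DepLe k (fun y => y ∈ B)) (x : ℕ → A) (n : ℕ) (hn : 1 ≤ n) :
    δ * pw μ Q n x * P.real B ≤ P.real (B ∩ matchSet n x k) := by
  obtain ⟨j, rfl⟩ : ∃ j, n = j + 1 := ⟨n - 1, by omega⟩
  rw [match_prod hP hB, markov_set hP hB]
  have h1 : δ * P.real B ≤ ∫ ω in B, Q (ω k) (x 1) ∂P := by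
    have : ∫ ω in B, δ ∂P = δ * P.real B := by simp [mul_comm]
    rw [← this]
    refine integral_mono (integrable_const _) ?_ fun ω => hδ _ _
    exact depLe_integrable (m := k) _ (fun ω ω' h => by simp only [h k le_rfl])
  have h2 : 0 ≤ ∏ i ∈ Finset.range j, Q (x (i + 1)) (x (i + 2)) :=
    Finset.prod_nonneg fun i _ => hδ0.le.trans (hδ _ _)
  simp only [pw, Nat.add_sub_cancel]
  calc _ = μ (x 1) * (δ * P.real B * ∏ i ∈ Finset.range j, Q (x (i + 1)) (x (i + 2))) := by ring
    _ ≤ 1 * (δ * P.real B * ∏ i ∈ Finset.range j, Q (x (i + 1)) (x (i + 2))) := by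
        gcongr; exact hμ1 _
    _ ≤ _ := by rw [one_mul]; gcongr

end Markov

lemma measurable_sInf_nat {Ω : Type*} [MeasurableSpace Ω] (S : Ω → Set ℕ)
    (hS : ∀ k, MeasurableSet {z | k ∈ S z}) : Measurable fun z => sInf (S z) := by
  refine measurable_to_countable' fun k => ?_
  have e : (fun z => sInf (S z)) ⁻¹' {k} =
      ({z | k ∈ S z} ∩ ⋂ j : ℕ, ⋂ _ : j < k, {z | j ∈ S z}ᶜ) ∪ ({z | k = 0} ∩ ⋂ j : ℕ, {z | j ∈ S z}ᶜ) := by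
    ext z
    simp only [Set.mem_preimage, Set.mem_singleton_iff, Set.mem_union, Set.mem_inter_iff,
      Set.mem_iInter, Set.mem_compl_iff, Set.mem_ofPred_eq]
    constructor
    · intro h
      rcases Set.eq_empty_or_nonempty (S z) with he | he
      · right; rw [he] at h ⊢; simp at h; simp [h]
      · left
        refine ⟨h ▸ Nat.sInf_mem he, fun j hj hjS => ?_⟩
        have := Nat.sInf_le hjS
        omega
    · rintro (⟨h1, h2⟩ | ⟨h1, h2⟩)
      · have h3 := Nat.sInf_le h1
        have h4 := Nat.sInf_mem ⟨k, h1⟩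
        by_contra hne
        exact h2 _ (by omega) h4
      · have : S z = ∅ := Set.eq_empty_iff_forall_notMem.2 h2
        rw [this, h1]; simp
  rw [e]
  refine ((hS k).inter (MeasurableSet.iInter fun j => MeasurableSet.iInter fun _ => (hS j).compl)).union
    ((MeasurableSet.const _).inter (MeasurableSet.iInter fun j => (hS j).compl))

lemma wt_measurable {A Ω : Type*} [Fintype A] [MeasurableSpace A] [MeasurableSingletonClass A] [MeasurableSpace Ω]
    (n : ℕ) {f g : Ω → ℕ → A} (hf : Measurable f) (hg : Measurable g) :
    Measurable fun z => waitingTime n (f z) (g z) := by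
  refine measurable_sInf_nat _ fun k => ?_
  have e : {z | k ∈ {k | 1 ≤ k ∧ ∀ i, 1 ≤ i → i ≤ n → g z (k + i) = f z i}} =
      {z | 1 ≤ k} ∩ ⋂ i : ℕ, ⋂ _ : 1 ≤ i, ⋂ _ : i ≤ n, {z | g z (k + i) = f z i} := by
    ext z; simp
  rw [e]
  refine (MeasurableSet.const _).inter (MeasurableSet.iInter fun i => MeasurableSet.iInter fun _ =>
    MeasurableSet.iInter fun _ => ?_)
  have h1 : Measurable fun z => g z (k + i) := (measurable_pi_apply _).comp hg
  have h2 : Measurable fun z => f z i := (measurable_pi_apply _).comp hf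
  exact measurableSet_eq_fun h1 h2

lemma wt_le {A : Type*} {n : ℕ} {x y : ℕ → A} {k : ℕ} (hk : 1 ≤ k) (h : y ∈ matchSet n x k) :
    waitingTime n x y ≤ k := Nat.sInf_le ⟨hk, h⟩

lemma wt_mem {A : Type*} {n : ℕ} {x y : ℕ → A} (h : waitingTime n x y ≠ 0) :
    y ∈ matchSet n x (waitingTime n x y) := by
  have hne : {k | 1 ≤ k ∧ ∀ i, 1 ≤ i → i ≤ n → y (k + i) = x i}.Nonempty := by
    by_contra he
    rw [Set.not_nonempty_iff_eq_empty] at he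
    apply h
    unfold waitingTime
    rw [he]; simp
  exact (Nat.sInf_mem hne).2

lemma wt_ne_zero {A : Type*} {n : ℕ} {x y : ℕ → A} {k : ℕ} (hk : 1 ≤ k) (h : y ∈ matchSet n x k) :
    waitingTime n x y ≠ 0 := by
  have hne : {k | 1 ≤ k ∧ ∀ i, 1 ≤ i → i ≤ n → y (k + i) = x i}.Nonempty := ⟨k, hk, h⟩
  have := (Nat.sInf_mem hne).1
  unfold waitingTime
  omega

/-- no match at the first `j` block positions -/
def noMatch {A : Type*} (n : ℕ) (x : ℕ → A) (j : ℕ) : Set (ℕ → A) :=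
  {y | ∀ i < j, y ∉ matchSet n x (1 + i * n)}

lemma noMatch_dep {A : Type*} (n : ℕ) (x : ℕ → A) (j : ℕ) :
    DepLe (1 + j * n) (fun y => y ∈ noMatch n x j) := by
  intro y y' h
  have : ∀ i < j, (y ∈ matchSet n x (1 + i * n)) = (y' ∈ matchSet n x (1 + i * n)) := by
    intro i hi
    apply matchSet_dep
    intro l hl
    apply h
    have : (i + 1) * n ≤ j * n := Nat.mul_le_mul_right n hi
    have e : (i + 1) * n = i * n + n := by ring
    omega
  apply propext
  constructor
  · intro hy i hi; rw [← this i hi]; exact hy i hi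
  · intro hy i hi; rw [this i hi]; exact hy i hi

section Wait

variable {A : Type*} [Fintype A] [MeasurableSpace A] [MeasurableSingletonClass A]
variable {Q : A → A → ℝ} {μ : A → ℝ} {P : Measure (ℕ → A)} [IsProbabilityMeasure P]

lemma noMatch_prob
    (hP : ∀ (n : ℕ) (a : ℕ → A), (P {ω | ∀ i ≤ n, ω i = a i}).toReal
        = μ (a 0) * ∏ i ∈ Finset.range n, Q (a i) (a (i + 1)))
    (hμ1 : ∀ x, μ x ≤ 1) {δ : ℝ} (hδ0 : 0 < δ) (hδ : ∀ x y, δ ≤ Q x y)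
    (x : ℕ → A) (n : ℕ) (hn : 1 ≤ n) (hθ : δ * pw μ Q n x ≤ 1) (j : ℕ) :
    P.real (noMatch n x j) ≤ (1 - δ * pw μ Q n x) ^ j := by
  induction j with
  | zero => simpa using measureReal_le_one
  | succ j ih =>
    have e : noMatch n x (j + 1) = noMatch n x j \ (noMatch n x j ∩ matchSet n x (1 + j * n)) := by
      ext y
      simp only [noMatch, Set.mem_diff, Set.mem_inter_iff, Set.mem_ofPred_eq]
      constructor
      · intro h
        exact ⟨fun i hi => h i (by omega), fun hh => h j (by omega) hh.2⟩
      · rintro ⟨h1, h2⟩ i hi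
        rcases Nat.lt_or_ge i j with h | h
        · exact h1 i h
        · have : i = j := by omega
          subst this
          exact fun hh => h2 ⟨h1, hh⟩
    have hm : MeasurableSet (noMatch n x j ∩ matchSet n x (1 + j * n)) :=
      (dep_meas (noMatch_dep n x j)).inter (dep_meas (matchSet_dep n x _))
    rw [e, measureReal_diff Set.inter_subset_left hm]
    have := match_lower hP hμ1 hδ0 hδ (noMatch_dep n x j) x n hn
    rw [pow_succ]
    calc _ ≤ P.real (noMatch n x j) * (1 - δ * pw μ Q n x) := by linarith
      _ ≤ _ := by
        have : 0 ≤ 1 - δ * pw μ Q n x := by linarith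
        gcongr

lemma wt_pos_ae
    (hP : ∀ (n : ℕ) (a : ℕ → A), (P {ω | ∀ i ≤ n, ω i = a i}).toReal
        = μ (a 0) * ∏ i ∈ Finset.range n, Q (a i) (a (i + 1)))
    (hμ1 : ∀ x, μ x ≤ 1) {δ : ℝ} (hδ0 : 0 < δ) (hδ : ∀ x y, δ ≤ Q x y)
    (x : ℕ → A) (n : ℕ) (hn : 1 ≤ n) (hπ : 0 < pw μ Q n x) (hθ : δ * pw μ Q n x ≤ 1) :
    ∀ᵐ y ∂P, waitingTime n x y ≠ 0 := by
  rw [ae_iff]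
  have h1 : ∀ j, P.real {y | ¬ waitingTime n x y ≠ 0} ≤ (1 - δ * pw μ Q n x) ^ j := by
    intro j
    refine (measureReal_mono ?_).trans (noMatch_prob hP hμ1 hδ0 hδ x n hn hθ j)
    intro y hy i hi hm
    exact hy (wt_ne_zero (by omega) hm)
  have h2 : P.real {y | ¬ waitingTime n x y ≠ 0} ≤ 0 := by
    refine ge_of_tendsto' (tendsto_pow_atTop_nhds_zero_of_lt_one (by linarith) ?_) h1
    have := mul_pos hδ0 hπ
    linarith
  have h3 := le_antisymm h2 measureReal_nonneg
  exact (measureReal_eq_zero_iff).1 h3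

lemma wt_expect
    (hP : ∀ (n : ℕ) (a : ℕ → A), (P {ω | ∀ i ≤ n, ω i = a i}).toReal
        = μ (a 0) * ∏ i ∈ Finset.range n, Q (a i) (a (i + 1)))
    (hμ1 : ∀ x, μ x ≤ 1) {δ : ℝ} (hδ0 : 0 < δ) (hδ : ∀ x y, δ ≤ Q x y)
    (x : ℕ → A) (n : ℕ) (hn : 1 ≤ n) (hπ : 0 < pw μ Q n x) (hθ : δ * pw μ Q n x ≤ 1) :
    Integrable (fun y => (waitingTime n x y : ℝ)) P ∧
      ∫ y, (waitingTime n x y : ℝ) ∂P ≤ 1 + n / (δ * pw μ Q n x) := by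
  have hWm : Measurable fun y => waitingTime n x y := wt_measurable n measurable_const measurable_id
  set θ := δ * pw μ Q n x with hθdef
  have hθ0 : 0 < θ := mul_pos hδ0 hπ
  have hmN : ∀ j, MeasurableSet (noMatch n x j) := fun j => dep_meas (noMatch_dep n x j)
  have hpt : ∀ y : ℕ → A, ENNReal.ofReal (waitingTime n x y : ℝ) ≤
      1 + (n : ENNReal) * ∑' j : ℕ, (noMatch n x (j + 1)).indicator (fun _ => (1:ENNReal)) y := by
    intro y
    rw [ENNReal.ofReal_natCast]
    have hsum : ∀ i, (∀ j < i, y ∉ matchSet n x (1 + j * n)) →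
        (i : ENNReal) ≤ ∑' j : ℕ, (noMatch n x (j + 1)).indicator (fun _ => (1:ENNReal)) y := by
      intro i hi
      have : ∑ j ∈ Finset.range i, (noMatch n x (j + 1)).indicator (fun _ => (1:ENNReal)) y = i := by
        rw [Finset.sum_congr rfl (g := fun _ => (1:ENNReal))]
        · simp
        · intro j hj
          have hj := Finset.mem_range.1 hj
          refine Set.indicator_of_mem ?_ _
          intro l hl
          exact hi l (by omega)
      rw [← this]
      exact ENNReal.sum_le_tsum _
    by_cases hex : ∃ i, y ∈ matchSet n x (1 + i * n)
    · classical
      have hspec := Nat.find_spec hex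
      have hmin : ∀ j < Nat.find hex, y ∉ matchSet n x (1 + j * n) := fun j hj => Nat.find_min hex hj
      have h1 := hsum _ hmin
      have h2 := wt_le (by omega) hspec
      calc (waitingTime n x y : ENNReal) ≤ ((1 + Nat.find hex * n : ℕ) : ENNReal) := by exact_mod_cast h2
        _ = 1 + n * (Nat.find hex : ENNReal) := by push_cast; ring
        _ ≤ _ := by gcongr
    · push Not at hex
      set i := waitingTime n x y
      have h1 := hsum i (fun j _ => hex j)
      have hn1 : (1 : ENNReal) ≤ n := by exact_mod_cast hn
      calc (i : ENNReal) = 1 * i := (one_mul _).symm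
        _ ≤ n * ∑' j : ℕ, (noMatch n x (j + 1)).indicator (fun _ => (1:ENNReal)) y := by gcongr
        _ ≤ _ := le_add_self
  have hlin : ∫⁻ y, ENNReal.ofReal (waitingTime n x y : ℝ) ∂P ≤ ENNReal.ofReal (1 + n / θ) := by
    refine (lintegral_mono hpt).trans ?_
    have hmi : ∀ j, Measurable ((noMatch n x (j + 1)).indicator (fun _ => (1:ENNReal))) :=
      fun j => measurable_const.indicator (hmN _)
    rw [lintegral_add_left measurable_const, lintegral_const_mul _ (Measurable.ennreal_tsum hmi),
      lintegral_tsum (fun j => (hmi j).aemeasurable)]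
    have hq0 : 0 ≤ 1 - θ := by linarith
    have hq1 : 1 - θ < 1 := by linarith
    have hj : ∀ j, ∫⁻ y, (noMatch n x (j + 1)).indicator (fun _ => (1:ENNReal)) y ∂P ≤ ENNReal.ofReal ((1 - θ) ^ j) := by
      intro j
      rw [lintegral_indicator (hmN _)]
      simp only [lintegral_const, MeasurableSet.univ, Measure.restrict_apply, Set.univ_inter, one_mul]
      rw [← ofReal_measureReal]
      apply ENNReal.ofReal_le_ofReal
      refine (noMatch_prob hP hμ1 hδ0 hδ x n hn hθ (j + 1)).trans ?_
      exact pow_le_pow_of_le_one hq0 hq1.le (by omega)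
    have hts : ∑' j : ℕ, ENNReal.ofReal ((1 - θ) ^ j) = ENNReal.ofReal (1 / θ) := by
      rw [← ENNReal.ofReal_tsum_of_nonneg (fun j => pow_nonneg hq0 j) (summable_geometric_of_lt_one hq0 hq1),
        tsum_geometric_of_lt_one hq0 hq1]
      congr 1; simp
    calc _ ≤ 1 + (n : ENNReal) * ∑' j : ℕ, ENNReal.ofReal ((1 - θ) ^ j) := by
          simp only [lintegral_const, measure_univ, mul_one]
          gcongr with j
          exact hj j
      _ = ENNReal.ofReal (1 + n / θ) := by
          rw [hts, ENNReal.ofReal_add zero_le_one (by positivity), ENNReal.ofReal_one, div_eq_mul_one_div (n:ℝ) θ,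
            ENNReal.ofReal_mul (Nat.cast_nonneg n), ENNReal.ofReal_natCast]
  have hWmR : Measurable fun y => (waitingTime n x y : ℝ) := measurable_from_nat.comp hWm
  have hnn : 0 ≤ᵐ[P] fun y => (waitingTime n x y : ℝ) := ae_of_all _ fun y => Nat.cast_nonneg _
  have hint : Integrable (fun y => (waitingTime n x y : ℝ)) P := by
    refine ⟨hWmR.aestronglyMeasurable, ?_⟩
    rw [hasFiniteIntegral_iff_ofReal hnn]
    exact hlin.trans_lt ENNReal.ofReal_lt_top
  refine ⟨hint, ?_⟩
  rw [integral_eq_lintegral_of_nonneg_ae hnn hWmR.aestronglyMeasurable]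
  exact ENNReal.toReal_le_of_le_ofReal (by positivity) hlin

lemma wt_inv_expect
    (hP : ∀ (n : ℕ) (a : ℕ → A), (P {ω | ∀ i ≤ n, ω i = a i}).toReal
        = μ (a 0) * ∏ i ∈ Finset.range n, Q (a i) (a (i + 1)))
    (hstat : ∀ y, ∑ x, μ x * Q x y = μ y)
    (x : ℕ → A) (n : ℕ) (hn : 1 ≤ n) (K : ℕ) (hK : 1 ≤ K) :
    Integrable (fun y => (waitingTime n x y : ℝ)⁻¹) P ∧
      ∫ y, (waitingTime n x y : ℝ)⁻¹ ∂P ≤ pw μ Q n x * (harmonic K : ℝ) + (K : ℝ)⁻¹ := by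
  have hWm : Measurable fun y => waitingTime n x y := wt_measurable n measurable_const measurable_id
  have hWmR : Measurable fun y => (waitingTime n x y : ℝ)⁻¹ := (measurable_from_nat.comp hWm).inv
  have hint : Integrable (fun y => (waitingTime n x y : ℝ)⁻¹) P := by
    refine Integrable.of_bound hWmR.aestronglyMeasurable 1 (ae_of_all _ fun y => ?_)
    rw [Real.norm_eq_abs, abs_of_nonneg (by positivity)]
    exact Nat.cast_inv_le_one _
  refine ⟨hint, ?_⟩
  have hmS : ∀ k, MeasurableSet (matchSet n x k) := fun k => dep_meas (matchSet_dep n x k)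
  have hpt : ∀ y : ℕ → A, (waitingTime n x y : ℝ)⁻¹ ≤
      ∑ k ∈ Finset.range K, (matchSet n x (k + 1)).indicator (fun _ => ((k + 1 : ℕ) : ℝ)⁻¹) y + (K : ℝ)⁻¹ := by
    intro y
    have hnn : ∀ k ∈ Finset.range K, 0 ≤ (matchSet n x (k + 1)).indicator (fun _ => ((k + 1 : ℕ) : ℝ)⁻¹) y :=
      fun k _ => Set.indicator_nonneg (fun _ _ => by positivity) y
    have hK0 : (0:ℝ) ≤ (K : ℝ)⁻¹ := by positivity
    rcases Nat.eq_zero_or_pos (waitingTime n x y) with h0 | h0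
    · rw [h0]; simp only [Nat.cast_zero, inv_zero]
      exact add_nonneg (Finset.sum_nonneg hnn) hK0
    · rcases Nat.lt_or_ge K (waitingTime n x y) with h | h
      · have : (waitingTime n x y : ℝ)⁻¹ ≤ (K : ℝ)⁻¹ := by
          apply inv_anti₀ (by exact_mod_cast hK)
          exact_mod_cast h.le
        linarith [Finset.sum_nonneg hnn]
      · have hmem := wt_mem h0.ne'
        obtain ⟨k, hk⟩ : ∃ k, waitingTime n x y = k + 1 := ⟨waitingTime n x y - 1, by omega⟩
        have h1 := Finset.single_le_sum hnn (Finset.mem_range.2 (show k < K by omega))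
        rw [hk] at hmem
        rw [Set.indicator_of_mem hmem] at h1
        rw [hk]; linarith
  have hi : ∀ k ∈ Finset.range K, Integrable ((matchSet n x (k + 1)).indicator (fun _ => ((k + 1 : ℕ) : ℝ)⁻¹)) P :=
    fun k _ => (integrable_const _).indicator (hmS _)
  refine (integral_mono hint ((integrable_finsetSum _ hi).add (integrable_const _)) hpt).trans_eq ?_
  rw [integral_add' (integrable_finsetSum _ hi) (integrable_const _), integral_finsetSum _ hi]
  simp only [integral_const, probReal_univ, one_mul, integral_indicator (hmS _),
    MeasurableSet.univ, measureReal_restrict_apply, Set.univ_inter, smul_eq_mul, match_prob hP hstat x _ n hn]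
  rw [← Finset.mul_sum, harmonic]
  push_cast
  rfl

end Wait

section Fin

variable {A : Type*} [Fintype A] [MeasurableSpace A] [MeasurableSingletonClass A]

lemma pw_bounds {Q : A → A → ℝ} {μ : A → ℝ} {δ : ℝ} (hδ0 : 0 < δ)
    (hδ : ∀ x y, δ ≤ Q x y) (hrow : ∀ x, ∑ y, Q x y = 1)
    (hμ0 : ∀ x, 0 ≤ μ x) (hμs : ∑ x, μ x = 1) (hstat : ∀ y, ∑ x, μ x * Q x y = μ y) :
    (∀ x, μ x ≤ 1) ∧ (∀ x, δ ≤ μ x) ∧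
    ∀ n, 1 ≤ n → ∀ x, δ ^ n ≤ pw μ Q n x ∧ pw μ Q n x ≤ 1 := by
  have h1 : ∀ x, μ x ≤ 1 := fun x => by
    rw [← hμs]; exact Finset.single_le_sum (fun i _ => hμ0 i) (Finset.mem_univ x)
  have hQ0 : ∀ x y, 0 ≤ Q x y := fun x y => hδ0.le.trans (hδ x y)
  have hQ1 : ∀ x y, Q x y ≤ 1 := fun x y => by
    rw [← hrow x]; exact Finset.single_le_sum (fun i _ => hQ0 x i) (Finset.mem_univ y)
  have h2 : ∀ x, δ ≤ μ x := fun y => by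
    rw [← hstat y]
    calc δ = ∑ x, μ x * δ := by rw [← Finset.sum_mul, hμs, one_mul]
      _ ≤ _ := Finset.sum_le_sum fun x _ => mul_le_mul_of_nonneg_left (hδ x y) (hμ0 x)
  refine ⟨h1, h2, fun n hn x => ⟨?_, ?_⟩⟩
  · obtain ⟨j, rfl⟩ : ∃ j, n = j + 1 := ⟨n - 1, by omega⟩
    rw [pow_succ', pw]
    refine mul_le_mul (h2 _) ?_ (by positivity) (hμ0 _)
    calc δ ^ j = ∏ i ∈ Finset.range (j + 1 - 1), δ := by simp
      _ ≤ _ := Finset.prod_le_prod (fun _ _ => hδ0.le) fun i _ => hδ _ _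
  · exact mul_le_one₀ (h1 _) (Finset.prod_nonneg fun _ _ => hQ0 _ _)
      (Finset.prod_le_one (fun _ _ => hQ0 _ _) fun _ _ => hQ1 _ _)

lemma rpow_le_aux {t p : ℝ} (ht : 0 < t) (hp1 : -1 ≤ p) (hp2 : p ≤ 1) : t ^ p ≤ 1 + t + t⁻¹ := by
  have hti : 0 < t⁻¹ := inv_pos.2 ht
  rcases le_total 1 t with h | h
  · have := Real.rpow_le_rpow_of_exponent_le h hp2
    rw [Real.rpow_one] at this; linarith
  · have := Real.rpow_le_rpow_of_exponent_ge ht h hp1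
    rw [Real.rpow_neg_one] at this; linarith

variable {Q : A → A → ℝ} {μ : A → ℝ} {P : Measure (ℕ → A)} [IsProbabilityMeasure P]

lemma moment_bound
    (hP : ∀ (n : ℕ) (a : ℕ → A), (P {ω | ∀ i ≤ n, ω i = a i}).toReal
        = μ (a 0) * ∏ i ∈ Finset.range n, Q (a i) (a (i + 1)))
    {δ : ℝ} (hδ0 : 0 < δ) (hδ1 : δ ≤ 1)
    (hδ : ∀ x y, δ ≤ Q x y) (hrow : ∀ x, ∑ y, Q x y = 1)
    (hμ0 : ∀ x, 0 ≤ μ x) (hμs : ∑ x, μ x = 1) (hstat : ∀ y, ∑ x, μ x * Q x y = μ y)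
    (x : ℕ → A) (n : ℕ) (hn : 1 ≤ n) (p : ℝ) (hp1 : -1 ≤ p) (hp2 : p ≤ 1) :
    Integrable (fun y => (pw μ Q n x * (waitingTime n x y : ℝ)) ^ p) P ∧
      ∫ y, (pw μ Q n x * (waitingTime n x y : ℝ)) ^ p ∂P ≤ 5 + 2 * n / δ := by
  obtain ⟨hμ1, -, hb⟩ := pw_bounds hδ0 hδ hrow hμ0 hμs hstat
  obtain ⟨hb1, hb2⟩ := hb n hn x
  set π' := pw μ Q n x with hπdef
  have hδn : 0 < δ ^ n := pow_pos hδ0 n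
  have hπ : 0 < π' := hδn.trans_le hb1
  have hθ : δ * π' ≤ 1 := mul_le_one₀ hδ1 hπ.le hb2
  have hpos := wt_pos_ae hP hμ1 hδ0 hδ x n hn hπ hθ
  obtain ⟨i1, e1⟩ := wt_expect hP hμ1 hδ0 hδ x n hn hπ hθ
  set K := ⌈π'⁻¹⌉₊ with hK
  have hKr : π'⁻¹ ≤ K := Nat.le_ceil _
  have hpi1 : 1 ≤ π'⁻¹ := (one_le_inv₀ hπ).2 hb2
  have hKr1 : (1:ℝ) ≤ K := hpi1.trans hKr
  have hK1 : 1 ≤ K := by exact_mod_cast hKr1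
  have hK2 : (K:ℝ) ≤ 2 * π'⁻¹ := by
    have := (Nat.ceil_lt_add_one (inv_pos.2 hπ).le).le
    linarith
  obtain ⟨i2, e2⟩ := wt_inv_expect hP hstat x n hn K hK1
  have hWm : Measurable fun y => (waitingTime n x y : ℝ) :=
    measurable_from_nat.comp (wt_measurable n measurable_const measurable_id)
  have hle : ∀ᵐ y ∂P, (π' * (waitingTime n x y : ℝ)) ^ p ≤
      1 + π' * (waitingTime n x y : ℝ) + π'⁻¹ * (waitingTime n x y : ℝ)⁻¹ := by
    filter_upwards [hpos] with y hy
    have hW : (0:ℝ) < waitingTime n x y := by exact_mod_cast Nat.pos_of_ne_zero hy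
    have := rpow_le_aux (mul_pos hπ hW) hp1 hp2
    rwa [mul_inv] at this
  have iT : Integrable (fun y => 1 + π' * (waitingTime n x y : ℝ) + π'⁻¹ * (waitingTime n x y : ℝ)⁻¹) P :=
    ((integrable_const _).add (i1.const_mul _)).add (i2.const_mul _)
  have hint : Integrable (fun y => (π' * (waitingTime n x y : ℝ)) ^ p) P := by
    refine iT.mono' ((hWm.const_mul _).pow_const p).aestronglyMeasurable ?_
    filter_upwards [hle] with y hy
    rwa [Real.norm_eq_abs, abs_of_nonneg (by positivity)]
  refine ⟨hint, (integral_mono_ae hint iT hle).trans ?_⟩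
  have e3 : ∫ y, (1 + π' * (waitingTime n x y : ℝ) + π'⁻¹ * (waitingTime n x y : ℝ)⁻¹) ∂P =
      1 + π' * ∫ y, (waitingTime n x y : ℝ) ∂P + π'⁻¹ * ∫ y, (waitingTime n x y : ℝ)⁻¹ ∂P := by
    have i0 : Integrable (fun y => 1 + π' * (waitingTime n x y : ℝ)) P :=
      (integrable_const _).add (i1.const_mul _)
    rw [integral_add i0 (i2.const_mul _),
      integral_add (integrable_const _) (i1.const_mul _), integral_const_mul, integral_const_mul]
    simp
  rw [e3]
  have f1 : π' * ∫ y, (waitingTime n x y : ℝ) ∂P ≤ 1 + n / δ := by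
    calc _ ≤ π' * (1 + n / (δ * π')) := by gcongr
      _ = π' + n / δ := by field_simp
      _ ≤ _ := by linarith
  have hlogK : Real.log K ≤ 1 + n / δ := by
    calc Real.log K ≤ Real.log (2 * π'⁻¹) := Real.log_le_log (by linarith) hK2
      _ = Real.log 2 + Real.log π'⁻¹ := Real.log_mul (by norm_num) (by positivity)
      _ ≤ 1 + Real.log (δ⁻¹ ^ n) := by
          gcongr
          · linarith [Real.log_two_lt_d9]
          · rw [inv_pow]; exact inv_anti₀ hδn hb1
      _ ≤ 1 + n / δ := by
          rw [Real.log_pow, div_eq_mul_inv]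
          gcongr
          have := Real.log_le_sub_one_of_pos (inv_pos.2 hδ0)
          linarith
  have f2 : π'⁻¹ * ∫ y, (waitingTime n x y : ℝ)⁻¹ ∂P ≤ 3 + n / δ := by
    calc _ ≤ π'⁻¹ * (π' * (harmonic K : ℝ) + (K : ℝ)⁻¹) := by gcongr
      _ = (harmonic K : ℝ) + π'⁻¹ * (K : ℝ)⁻¹ := by field_simp
      _ ≤ (1 + Real.log K) + 1 := by
          gcongr
          · exact harmonic_le_one_add_log K
          · rw [← div_eq_mul_inv]; exact (div_le_one (by linarith)).2 hKr
      _ ≤ _ := by linarith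
  have : 2 * (n:ℝ) / δ = n / δ + n / δ := by ring
  rw [this]; linarith

lemma moment_lower
    (hP : ∀ (n : ℕ) (a : ℕ → A), (P {ω | ∀ i ≤ n, ω i = a i}).toReal
        = μ (a 0) * ∏ i ∈ Finset.range n, Q (a i) (a (i + 1)))
    {δ : ℝ} (hδ0 : 0 < δ) (hδ1 : δ ≤ 1)
    (hδ : ∀ x y, δ ≤ Q x y) (hrow : ∀ x, ∑ y, Q x y = 1)
    (hμ0 : ∀ x, 0 ≤ μ x) (hμs : ∑ x, μ x = 1) (hstat : ∀ y, ∑ x, μ x * Q x y = μ y)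
    (x : ℕ → A) (n : ℕ) (hn : 1 ≤ n) (p : ℝ) (hp1 : -1 ≤ p) (hp2 : p ≤ 1) :
    (5 + 2 * n / δ)⁻¹ ≤ ∫ y, (pw μ Q n x * (waitingTime n x y : ℝ)) ^ p ∂P := by
  obtain ⟨i1, e1⟩ := moment_bound hP hδ0 hδ1 hδ hrow hμ0 hμs hstat x n hn p hp1 hp2
  obtain ⟨i2, e2⟩ := moment_bound hP hδ0 hδ1 hδ hrow hμ0 hμs hstat x n hn (-p) (by linarith) (by linarith)
  obtain ⟨hμ1, -, hb⟩ := pw_bounds hδ0 hδ hrow hμ0 hμs hstat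
  obtain ⟨hb1, hb2⟩ := hb n hn x
  have hδn : 0 < δ ^ n := pow_pos hδ0 n
  have hπ : 0 < pw μ Q n x := hδn.trans_le hb1
  have hθ : δ * pw μ Q n x ≤ 1 := mul_le_one₀ hδ1 hπ.le hb2
  have hpos := wt_pos_ae hP hμ1 hδ0 hδ x n hn hπ hθ
  set G : ℝ := 5 + 2 * n / δ with hG
  have hG0 : 0 < G := by positivity
  have key : ∀ᵐ y ∂P, (2:ℝ) ≤ G * (pw μ Q n x * (waitingTime n x y : ℝ)) ^ p
      + G⁻¹ * (pw μ Q n x * (waitingTime n x y : ℝ)) ^ (-p) := by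
    filter_upwards [hpos] with y hy
    have hW : (0:ℝ) < waitingTime n x y := by exact_mod_cast Nat.pos_of_ne_zero hy
    have hs : 0 < (pw μ Q n x * (waitingTime n x y : ℝ)) ^ p := Real.rpow_pos_of_pos (mul_pos hπ hW) p
    rw [Real.rpow_neg (mul_pos hπ hW).le, ← mul_inv]
    set s := G * (pw μ Q n x * (waitingTime n x y : ℝ)) ^ p
    have hs0 : 0 < s := mul_pos hG0 hs
    have : s * s⁻¹ = 1 := mul_inv_cancel₀ hs0.ne'
    have h3 : 0 < s⁻¹ := inv_pos.2 hs0
    nlinarith [sq_nonneg (s - s⁻¹), sq_nonneg (s + s⁻¹)]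
  have h := integral_mono_ae (integrable_const _) ((i1.const_mul G).add (i2.const_mul G⁻¹)) key
  rw [integral_add' (i1.const_mul G) (i2.const_mul G⁻¹), integral_const_mul, integral_const_mul] at h
  simp only [integral_const, probReal_univ, one_smul] at h
  have h4 : G⁻¹ * ∫ y, (pw μ Q n x * (waitingTime n x y : ℝ)) ^ (-p) ∂P ≤ 1 := by
    calc _ ≤ G⁻¹ * G := by gcongr
      _ = 1 := inv_mul_cancel₀ hG0.ne'
  rw [inv_le_iff_one_le_mul₀' hG0]
  linarith

end Fin

section Fin2

variable {A : Type*} [Fintype A] [MeasurableSpace A] [MeasurableSingletonClass A]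

/-- tilting weight -/
noncomputable def hw {A : Type*} (QX QY : A → A → ℝ) (μ μt : A → ℝ) (p : ℝ) (n : ℕ) (x : ℕ → A) : ℝ :=
  pw μt QY n x ^ (-p) * pw μ QX n x ^ p

lemma pw_dep {A : Type*} (μ : A → ℝ) (Q : A → A → ℝ) (n : ℕ) (hn : 1 ≤ n) : DepLe n (pw μ Q n) := by
  intro x y h
  unfold pw
  rw [h 1 hn]
  congr 1
  refine Finset.prod_congr rfl fun i hi => ?_
  have := Finset.mem_range.1 hi
  rw [h (i + 1) (by omega), h (i + 2) (by omega)]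

lemma pw_succ {A : Type*} (μ : A → ℝ) (Q : A → A → ℝ) (j : ℕ) (x : ℕ → A) :
    pw μ Q (j + 2) x = pw μ Q (j + 1) x * Q (x (j + 1)) (x (j + 2)) := by
  unfold pw
  have e1 : j + 2 - 1 = j + 1 := by omega
  have e2 : j + 1 - 1 = j := by omega
  rw [e1, e2, Finset.prod_range_succ, mul_assoc]

lemma hw_dep {A : Type*} (QX QY : A → A → ℝ) (μ μt : A → ℝ) (p : ℝ) (n : ℕ) (hn : 1 ≤ n) :
    DepLe n (hw QX QY μ μt p n) := by
  intro x y h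
  unfold hw
  rw [pw_dep μt QY n hn x y h, pw_dep μ QX n hn x y h]

lemma S_bounds [Nonempty A] {QX QY : A → A → ℝ} {μ μt : A → ℝ}
    {P : Measure (ℕ → A)} [IsProbabilityMeasure P]
    (hP : ∀ (n : ℕ) (a : ℕ → A), (P {ω | ∀ i ≤ n, ω i = a i}).toReal
        = μ (a 0) * ∏ i ∈ Finset.range n, QX (a i) (a (i + 1)))
    (hX : ∀ x y, 0 < QX x y) (hY : ∀ x y, 0 < QY x y)
    (hpX : ∀ n, 1 ≤ n → ∀ x, 0 < pw μ QX n x) (hpY : ∀ n, 1 ≤ n → ∀ x, 0 < pw μt QY n x)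
    (p ρ : ℝ) (v : A → ℝ) (hv : ∀ x, 0 < v x)
    (hvM : ∀ x, ∑ y, QX x y * (QY x y ^ (-p) * QX x y ^ p) * v y = ρ * v x) :
    ∃ c C : ℝ, 0 < c ∧ 0 < C ∧ ∀ j : ℕ, c * ρ ^ j ≤ ∫ x, hw QX QY μ μt p (j + 1) x ∂P ∧
      ∫ x, hw QX QY μ μt p (j + 1) x ∂P ≤ C * ρ ^ j := by
  have hhpos : ∀ n, 1 ≤ n → ∀ x, 0 < hw QX QY μ μt p n x := fun n hn x =>
    mul_pos (Real.rpow_pos_of_pos (hpY n hn x) _) (Real.rpow_pos_of_pos (hpX n hn x) _)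
  have hvd : ∀ n, DepLe n (fun x : ℕ → A => v (x n)) := fun n x y h => by
    simp only [h n le_rfl]
  have hmd : ∀ n, 1 ≤ n → DepLe n (fun x => hw QX QY μ μt p n x * v (x n)) := fun n hn x y h => by
    simp only [hw_dep QX QY μ μt p n hn x y h, h n le_rfl]
  have hstep : ∀ j, ∫ x, hw QX QY μ μt p (j + 1) x * v (x (j + 1)) ∂P =
      (∫ x, hw QX QY μ μt p 1 x * v (x 1) ∂P) * ρ ^ j := by
    intro j
    induction j with
    | zero => simp
    | succ j ih =>
      have e : ∀ x : ℕ → A, hw QX QY μ μt p (j + 1 + 1) x * v (x (j + 1 + 1)) =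
          hw QX QY μ μt p (j + 1) x * ((fun a b => QY a b ^ (-p) * QX a b ^ p * v b) (x (j + 1)) (x (j + 1 + 1))) := by
        intro x
        unfold hw
        rw [show j + 1 + 1 = j + 2 from rfl, pw_succ, pw_succ,
          Real.mul_rpow (hpY _ (by omega) x).le (hY _ _).le, Real.mul_rpow (hpX _ (by omega) x).le (hX _ _).le]
        ring
      simp only [e]
      have hmk := markov_fun hP (hw_dep QX QY μ μt p (j + 1) (by omega)) (fun a b => QY a b ^ (-p) * QX a b ^ p * v b)
      refine hmk.trans ?_
      have e2 : ∀ x : A, ∑ y, QX x y * (QY x y ^ (-p) * QX x y ^ p * v y) = ρ * v x := by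
        intro x
        rw [← hvM x]
        exact Finset.sum_congr rfl fun y _ => by ring
      simp only [e2]
      have e3 : ∀ x : ℕ → A, hw QX QY μ μt p (j + 1) x * (ρ * v (x (j + 1))) =
          ρ * (hw QX QY μ μt p (j + 1) x * v (x (j + 1))) := fun x => by ring
      simp only [e3]
      rw [integral_const_mul, ih, pow_succ]; ring
  obtain ⟨a0, ha0⟩ := Finite.exists_min v
  obtain ⟨a1, ha1⟩ := Finite.exists_max v
  set c0 := ∫ x, hw QX QY μ μt p 1 x * v (x 1) ∂P with hc0
  have hc0pos : 0 < c0 := by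
    rw [hc0, integral_pos_iff_support_of_nonneg (fun x => (mul_pos (hhpos 1 le_rfl x) (hv _)).le)
      (depLe_integrable P (hmd 1 le_rfl))]
    have : Function.support (fun x : ℕ → A => hw QX QY μ μt p 1 x * v (x 1)) = Set.univ := by
      ext x; simp [(hhpos 1 le_rfl x).ne', (hv (x 1)).ne']
    rw [this]; simp
  refine ⟨c0 / v a1, c0 / v a0, div_pos hc0pos (hv _), div_pos hc0pos (hv _), fun j => ?_⟩
  have iS := depLe_integrable P (hw_dep QX QY μ μt p (j + 1) (by omega))
  have iM := depLe_integrable P (hmd (j + 1) (by omega))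
  constructor
  · have : ∫ x, hw QX QY μ μt p (j + 1) x * v (x (j + 1)) ∂P ≤ ∫ x, hw QX QY μ μt p (j + 1) x * v a1 ∂P :=
      integral_mono iM (iS.mul_const _) fun x => mul_le_mul_of_nonneg_left (ha1 _) (hhpos _ (by omega) x).le
    rw [hstep, integral_mul_const] at this
    rw [div_mul_eq_mul_div, div_le_iff₀ (hv a1)]
    exact this
  · have : ∫ x, hw QX QY μ μt p (j + 1) x * v a0 ∂P ≤ ∫ x, hw QX QY μ μt p (j + 1) x * v (x (j + 1)) ∂P :=
      integral_mono (iS.mul_const _) iM fun x => mul_le_mul_of_nonneg_left (ha0 _) (hhpos _ (by omega) x).le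
    rw [hstep, integral_mul_const] at this
    rw [div_mul_eq_mul_div, le_div_iff₀ (hv a0)]
    exact this

lemma triple_bound {QX QY : A → A → ℝ} {μ μt : A → ℝ}
    {P Pt : Measure (ℕ → A)} [IsProbabilityMeasure P] [IsProbabilityMeasure Pt]
    (hpX : ∀ n, 1 ≤ n → ∀ x, 0 < pw μ QX n x) (hpY : ∀ n, 1 ≤ n → ∀ x, 0 < pw μt QY n x)
    (p : ℝ) (n : ℕ) (hn : 1 ≤ n) (G : ℝ) (hG : 0 < G)
    (hYi : ∀ x, Integrable (fun y => (pw μt QY n x * (waitingTime n x y : ℝ)) ^ p) Pt)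
    (hYu : ∀ x, ∫ y, (pw μt QY n x * (waitingTime n x y : ℝ)) ^ p ∂Pt ≤ G)
    (hYl : ∀ x, G⁻¹ ≤ ∫ y, (pw μt QY n x * (waitingTime n x y : ℝ)) ^ p ∂Pt)
    (hXi : ∀ x, Integrable (fun y => (pw μ QX n x * (waitingTime n x y : ℝ)) ^ (-p)) P)
    (hXu : ∀ x, ∫ y, (pw μ QX n x * (waitingTime n x y : ℝ)) ^ (-p) ∂P ≤ G)
    (hXl : ∀ x, G⁻¹ ≤ ∫ y, (pw μ QX n x * (waitingTime n x y : ℝ)) ^ (-p) ∂P) :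
    Integrable (fun z : ((ℕ → A) × (ℕ → A)) × (ℕ → A) =>
      ((waitingTime n z.1.1 z.1.2 : ℝ) / (waitingTime n z.1.1 z.2 : ℝ)) ^ p) ((P.prod Pt).prod P) ∧
    G⁻¹ * G⁻¹ * ∫ x, hw QX QY μ μt p n x ∂P ≤
      ∫ z, ((waitingTime n z.1.1 z.1.2 : ℝ) / (waitingTime n z.1.1 z.2 : ℝ)) ^ p ∂((P.prod Pt).prod P) ∧
    ∫ z, ((waitingTime n z.1.1 z.1.2 : ℝ) / (waitingTime n z.1.1 z.2 : ℝ)) ^ p ∂((P.prod Pt).prod P) ≤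
      G * G * ∫ x, hw QX QY μ μt p n x ∂P := by
  set F : ((ℕ → A) × (ℕ → A)) × (ℕ → A) → ℝ := fun z =>
      ((waitingTime n z.1.1 z.1.2 : ℝ) / (waitingTime n z.1.1 z.2 : ℝ)) ^ p with hF
  have hFm : Measurable F :=
    ((measurable_from_nat.comp (wt_measurable n (measurable_fst.comp measurable_fst)
      (measurable_snd.comp measurable_fst))).div (measurable_from_nat.comp
      (wt_measurable n (measurable_fst.comp measurable_fst) measurable_snd))).pow_const p
  have hF0 : ∀ z, 0 ≤ F z := fun z => by positivity
  have hhpos : ∀ x, 0 < hw QX QY μ μt p n x := fun x =>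
    mul_pos (Real.rpow_pos_of_pos (hpY n hn x) _) (Real.rpow_pos_of_pos (hpX n hn x) _)
  have hFe : ∀ x y x', F ((x, y), x') = hw QX QY μ μt p n x *
      (pw μt QY n x * (waitingTime n x y : ℝ)) ^ p * (pw μ QX n x * (waitingTime n x x' : ℝ)) ^ (-p) := by
    intro x y x'
    simp only [hF, hw]
    rw [Real.mul_rpow (hpY n hn x).le (Nat.cast_nonneg _), Real.mul_rpow (hpX n hn x).le (Nat.cast_nonneg _),
      Real.div_rpow (Nat.cast_nonneg _) (Nat.cast_nonneg _), Real.rpow_neg (hpY n hn x).le,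
      Real.rpow_neg (hpX n hn x).le, Real.rpow_neg (Nat.cast_nonneg _)]
    have h1 := (Real.rpow_pos_of_pos (hpY n hn x) p).ne'
    have h2 := (Real.rpow_pos_of_pos (hpX n hn x) p).ne'
    rw [div_eq_mul_inv]
    field_simp
  have hL : ∫⁻ z, ENNReal.ofReal (F z) ∂((P.prod Pt).prod P) =
      ∫⁻ x, ENNReal.ofReal (hw QX QY μ μt p n x *
        (∫ y, (pw μt QY n x * (waitingTime n x y : ℝ)) ^ p ∂Pt) *
        ∫ y, (pw μ QX n x * (waitingTime n x y : ℝ)) ^ (-p) ∂P) ∂P := by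
    rw [lintegral_prod _ hFm.ennreal_ofReal.aemeasurable,
      lintegral_prod _ (hFm.ennreal_ofReal.lintegral_prod_right').aemeasurable]
    refine lintegral_congr fun x => ?_
    have e1 : ∀ y, ∫⁻ x', ENNReal.ofReal (F ((x, y), x')) ∂P =
        ENNReal.ofReal (hw QX QY μ μt p n x * (∫ y, (pw μ QX n x * (waitingTime n x y : ℝ)) ^ (-p) ∂P))
          * ENNReal.ofReal ((pw μt QY n x * (waitingTime n x y : ℝ)) ^ p) := by
      intro y
      have hn0 : 0 ≤ (pw μt QY n x * (waitingTime n x y : ℝ)) ^ p :=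
        Real.rpow_nonneg (mul_nonneg (hpY n hn x).le (Nat.cast_nonneg _)) _
      have : ∀ x', F ((x, y), x') = (hw QX QY μ μt p n x *
        (pw μt QY n x * (waitingTime n x y : ℝ)) ^ p) * (pw μ QX n x * (waitingTime n x x' : ℝ)) ^ (-p) := hFe x y
      simp only [this]
      rw [← ofReal_integral_eq_lintegral_ofReal ((hXi x).const_mul _) (ae_of_all _ fun x' =>
        mul_nonneg (mul_nonneg (hhpos x).le hn0) (Real.rpow_nonneg (mul_nonneg (hpX n hn x).le (Nat.cast_nonneg _)) _)),
        integral_const_mul, ← ENNReal.ofReal_mul' hn0]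
      congr 1; ring
    simp only [e1]
    rw [lintegral_const_mul' _ _ ENNReal.ofReal_ne_top, ← ofReal_integral_eq_lintegral_ofReal (hYi x)
      (ae_of_all _ fun y => Real.rpow_nonneg (mul_nonneg (hpY n hn x).le (Nat.cast_nonneg _)) _),
      ← ENNReal.ofReal_mul' (le_trans (inv_pos.2 hG).le (hYl x))]
    congr 1; ring
  have iS := depLe_integrable P (hw_dep QX QY μ μt p n hn)
  have hS0 : 0 ≤ ∫ x, hw QX QY μ μt p n x ∂P := integral_nonneg fun x => (hhpos x).le
  have hSc : ∀ c : ℝ, 0 ≤ c → ∫⁻ x, ENNReal.ofReal (c * hw QX QY μ μt p n x) ∂P =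
      ENNReal.ofReal (c * ∫ x, hw QX QY μ μt p n x ∂P) := by
    intro c hc
    rw [← ofReal_integral_eq_lintegral_ofReal (iS.const_mul c) (ae_of_all _ fun x => mul_nonneg hc (hhpos x).le),
      integral_const_mul]
  have hG1 : 0 < G⁻¹ := inv_pos.2 hG
  have hU : ∫⁻ z, ENNReal.ofReal (F z) ∂((P.prod Pt).prod P) ≤
      ENNReal.ofReal (G * G * ∫ x, hw QX QY μ μt p n x ∂P) := by
    rw [hL, ← hSc _ (by positivity)]
    refine lintegral_mono fun x => ENNReal.ofReal_le_ofReal ?_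
    have h1 := mul_le_mul (hYu x) (hXu x) (hG1.le.trans (hXl x)) hG.le
    have := mul_le_mul_of_nonneg_left h1 (hhpos x).le
    linarith
  have hD : ENNReal.ofReal (G⁻¹ * G⁻¹ * ∫ x, hw QX QY μ μt p n x ∂P) ≤
      ∫⁻ z, ENNReal.ofReal (F z) ∂((P.prod Pt).prod P) := by
    rw [hL, ← hSc _ (by positivity)]
    refine lintegral_mono fun x => ENNReal.ofReal_le_ofReal ?_
    have h1 := mul_le_mul (hYl x) (hXl x) hG1.le (hG1.le.trans (hYl x))
    have := mul_le_mul_of_nonneg_left h1 (hhpos x).le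
    linarith
  have hint : Integrable F ((P.prod Pt).prod P) := by
    refine ⟨hFm.aestronglyMeasurable, ?_⟩
    rw [hasFiniteIntegral_iff_ofReal (ae_of_all _ hF0)]
    exact hU.trans_lt ENNReal.ofReal_lt_top
  refine ⟨hint, ?_, ?_⟩
  · rw [← ofReal_integral_eq_lintegral_ofReal hint (ae_of_all _ hF0)] at hD
    exact (ENNReal.ofReal_le_ofReal_iff (integral_nonneg hF0)).1 hD
  · rw [← ofReal_integral_eq_lintegral_ofReal hint (ae_of_all _ hF0)] at hU
    exact (ENNReal.ofReal_le_ofReal_iff (by positivity)).1 hU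

lemma log_asymp (E : ℕ → ℝ) (ρ c C g : ℝ) (hρ : 0 < ρ) (hc : 0 < c) (hC : 0 < C) (hg : 0 < g)
    (hl : ∀ j : ℕ, (g * (j + 1 : ℕ))⁻¹ * (g * (j + 1 : ℕ))⁻¹ * (c * ρ ^ j) ≤ E (j + 1))
    (hu : ∀ j : ℕ, E (j + 1) ≤ (g * (j + 1 : ℕ)) * (g * (j + 1 : ℕ)) * (C * ρ ^ j)) :
    Tendsto (fun n : ℕ => Real.log (E n) / n) atTop (nhds (Real.log ρ)) := by
  have hlog : Tendsto (fun n : ℕ => Real.log (n : ℝ) / n) atTop (nhds 0) := by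
    have h := Real.isLittleO_log_id_atTop.tendsto_div_nhds_zero
    exact h.comp tendsto_natCast_atTop_atTop
  have hinv : Tendsto (fun n : ℕ => (1:ℝ) / n) atTop (nhds 0) := tendsto_one_div_atTop_nhds_zero_nat
  have tl : Tendsto (fun n : ℕ => (-2 * Real.log g + Real.log c - Real.log ρ) * (1 / (n:ℝ)) + (-2) * (Real.log (n : ℝ) / n) + Real.log ρ)
      atTop (nhds (Real.log ρ)) := by
    have := ((hinv.const_mul (-2 * Real.log g + Real.log c - Real.log ρ)).add (hlog.const_mul (-2))).add_const (Real.log ρ)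
    simpa using this
  have tu : Tendsto (fun n : ℕ => (2 * Real.log g + Real.log C - Real.log ρ) * (1 / (n:ℝ)) + 2 * (Real.log (n : ℝ) / n) + Real.log ρ)
      atTop (nhds (Real.log ρ)) := by
    have := ((hinv.const_mul (2 * Real.log g + Real.log C - Real.log ρ)).add (hlog.const_mul 2)).add_const (Real.log ρ)
    simpa using this
  refine tendsto_of_tendsto_of_tendsto_of_le_of_le' tl tu ?_ ?_
  · filter_upwards [eventually_ge_atTop 1] with n hn
    obtain ⟨j, rfl⟩ : ∃ j, n = j + 1 := ⟨n - 1, by omega⟩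
    have hj : (0:ℝ) < (j + 1 : ℕ) := by positivity
    have hρj : 0 < ρ ^ j := pow_pos hρ j
    have h := Real.log_le_log (by positivity) (hl j)
    rw [Real.log_mul (by positivity) (by positivity), Real.log_mul (by positivity) (by positivity),
      Real.log_mul (by positivity) (by positivity), Real.log_inv, Real.log_mul (by positivity) (by positivity),
      Real.log_pow] at h
    rw [le_div_iff₀ hj]
    refine le_trans (le_of_eq ?_) h
    field_simp
    push_cast; ring
  · filter_upwards [eventually_ge_atTop 1] with n hn
    obtain ⟨j, rfl⟩ : ∃ j, n = j + 1 := ⟨n - 1, by omega⟩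
    have hj : (0:ℝ) < (j + 1 : ℕ) := by positivity
    have hρj : 0 < ρ ^ j := pow_pos hρ j
    have hE : 0 < E (j + 1) := lt_of_lt_of_le (by positivity) (hl j)
    have h := Real.log_le_log hE (hu j)
    rw [Real.log_mul (by positivity) (by positivity), Real.log_mul (by positivity) (by positivity),
      Real.log_mul (by positivity) (by positivity), Real.log_mul (by positivity) (by positivity),
      Real.log_pow] at h
    rw [div_le_iff₀ hj]
    refine le_trans h (le_of_eq ?_)
    field_simp
    push_cast; ring

end Fin2

/-- Large deviation principle for `log W_n(X|Y) - log W_n(X|X')` on open intervals meeting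
`(c₋, c₊)`, with rate function the Legendre transform of the scaled cumulant generating
function `Λ`. -/
theorem stmt10
    {A : Type*} [Fintype A] [Nonempty A] [MeasurableSpace A] [MeasurableSingletonClass A]
    (QX QY : A → A → ℝ) (μ μt : A → ℝ)
    (hQXpos : ∀ x y, 0 < QX x y) (hQXrow : ∀ x, ∑ y, QX x y = 1)
    (hQYpos : ∀ x y, 0 < QY x y) (hQYrow : ∀ x, ∑ y, QY x y = 1)
    (hμnonneg : ∀ x, 0 ≤ μ x) (hμsum : ∑ x, μ x = 1)
    (hμstat : ∀ y, ∑ x, μ x * QX x y = μ y)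
    (hμtnonneg : ∀ x, 0 ≤ μt x) (hμtsum : ∑ x, μt x = 1)
    (hμtstat : ∀ y, ∑ x, μt x * QY x y = μt y)
    (P Pt : Measure (ℕ → A)) [IsProbabilityMeasure P] [IsProbabilityMeasure Pt]
    (hP : ∀ (n : ℕ) (a : ℕ → A),
      (P {ω | ∀ i ≤ n, ω i = a i}).toReal
        = μ (a 0) * ∏ i ∈ Finset.range n, QX (a i) (a (i + 1)))
    (hPt : ∀ (n : ℕ) (a : ℕ → A),
      (Pt {ω | ∀ i ≤ n, ω i = a i}).toReal
        = μt (a 0) * ∏ i ∈ Finset.range n, QY (a i) (a (i + 1)))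
    -- the scaled cumulant generating function on (-1,1)
    (Lam : ℝ → ℝ)
    (hLam : ∀ p ∈ Set.Ioo (-1 : ℝ) 1,
      Tendsto (fun n : ℕ =>
          Real.log (∫ z, ((waitingTime n z.1.1 z.1.2 : ℝ) / (waitingTime n z.1.1 z.2 : ℝ)) ^ p
            ∂((P.prod Pt).prod P)) / n)
        atTop (nhds (Lam p)))
    -- c₋ and c₊, the one-sided limits of Λ' at ∓1
    (cm cp : ℝ)
    (hcm : Tendsto (deriv Lam) (nhdsWithin (-1 : ℝ) (Set.Ioo (-1 : ℝ) 1)) (nhds cm))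
    (hcp : Tendsto (deriv Lam) (nhdsWithin (1 : ℝ) (Set.Ioo (-1 : ℝ) 1)) (nhds cp))
    -- the Legendre transform of Λ
    (I : ℝ → ℝ)
    (hI : ∀ q : ℝ, I q = sSup {r : ℝ | ∃ p ∈ Set.Ioo (-1 : ℝ) 1, r = p * q - Lam p}) :
    ∀ J : Set ℝ, IsOpen J → J.OrdConnected → (J ∩ Set.Ioo cm cp).Nonempty →
      Tendsto (fun n : ℕ =>
          Real.log ((((P.prod Pt).prod P)
            {z : ((ℕ → A) × (ℕ → A)) × (ℕ → A) |
              Real.log ((waitingTime n z.1.1 z.1.2 : ℝ) / (waitingTime n z.1.1 z.2 : ℝ)) / n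
                ∈ J}).toReal) / n)
        atTop (nhds (- sInf (I '' (J ∩ Set.Ioo cm cp)))) := by
  intro J hJo hJc hK
  obtain ⟨δ, hδ0, hδ1, hδX, hδY⟩ : ∃ δ : ℝ, 0 < δ ∧ δ ≤ 1 ∧ (∀ x y, δ ≤ QX x y) ∧ (∀ x y, δ ≤ QY x y) := by
    obtain ⟨a, ha⟩ := Finite.exists_min (fun z : A × A => QX z.1 z.2)
    obtain ⟨b, hb⟩ := Finite.exists_min (fun z : A × A => QY z.1 z.2)
    refine ⟨min (QX a.1 a.2) (QY b.1 b.2), lt_min (hQXpos _ _) (hQYpos _ _), ?_, ?_, ?_⟩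
    · refine (min_le_left _ _).trans ?_
      rw [← hQXrow a.1]
      exact Finset.single_le_sum (fun i _ => (hQXpos a.1 i).le) (Finset.mem_univ a.2)
    · exact fun x y => (min_le_left _ _).trans (ha (x, y))
    · exact fun x y => (min_le_right _ _).trans (hb (x, y))
  obtain ⟨hμ1, -, hbX⟩ := pw_bounds hδ0 hδX hQXrow hμnonneg hμsum hμstat
  obtain ⟨hμt1, -, hbY⟩ := pw_bounds hδ0 hδY hQYrow hμtnonneg hμtsum hμtstat
  have hpX : ∀ n, 1 ≤ n → ∀ x, 0 < pw μ QX n x := fun n hn x => (pow_pos hδ0 n).trans_le (hbX n hn x).1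
  have hpY : ∀ n, 1 ≤ n → ∀ x, 0 < pw μt QY n x := fun n hn x => (pow_pos hδ0 n).trans_le (hbY n hn x).1
  -- the integrals
  have htri : ∀ p ∈ Set.Ioo (-1:ℝ) 1, ∀ n, 1 ≤ n → _ := fun p hp n hn =>
    triple_bound (P := P) (Pt := Pt) hpX hpY p n hn (5 + 2 * n / δ) (by positivity)
      (fun x => (moment_bound hPt hδ0 hδ1 hδY hQYrow hμtnonneg hμtsum hμtstat x n hn p hp.1.le hp.2.le).1)
      (fun x => (moment_bound hPt hδ0 hδ1 hδY hQYrow hμtnonneg hμtsum hμtstat x n hn p hp.1.le hp.2.le).2)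
      (fun x => moment_lower hPt hδ0 hδ1 hδY hQYrow hμtnonneg hμtsum hμtstat x n hn p hp.1.le hp.2.le)
      (fun x => (moment_bound hP hδ0 hδ1 hδX hQXrow hμnonneg hμsum hμstat x n hn (-p)
        (by linarith [hp.2]) (by linarith [hp.1])).1)
      (fun x => (moment_bound hP hδ0 hδ1 hδX hQXrow hμnonneg hμsum hμstat x n hn (-p)
        (by linarith [hp.2]) (by linarith [hp.1])).2)
      (fun x => moment_lower hP hδ0 hδ1 hδX hQXrow hμnonneg hμsum hμstat x n hn (-p)
        (by linarith [hp.2]) (by linarith [hp.1]))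
  -- Perron-Frobenius
  have hMpos : ∀ (p : ℝ) (x y : A), 0 < QX x y * (QY x y ^ (-p) * QX x y ^ p) := fun p x y =>
    mul_pos (hQXpos x y) (mul_pos (Real.rpow_pos_of_pos (hQYpos x y) _) (Real.rpow_pos_of_pos (hQXpos x y) _))
  choose ρ v hρ hv hv1 hvM using fun p : ℝ =>
    pf_exists (fun x y => QX x y * (QY x y ^ (-p) * QX x y ^ p)) (hMpos p)
  have hρd : Differentiable ℝ ρ := by
    refine pf_diff (fun p x y => QX x y * (QY x y ^ (-p) * QX x y ^ p)) hMpos ?_ ρ v hv hv1 hvM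
    intro x y
    simp only [Real.rpow_def_of_pos (hQYpos x y), Real.rpow_def_of_pos (hQXpos x y)]
    fun_prop
  have hLamEq : ∀ p ∈ Set.Ioo (-1:ℝ) 1, Lam p = Real.log (ρ p) := by
    intro p hp
    refine tendsto_nhds_unique (hLam p hp) ?_
    obtain ⟨c, C, hc, hC, hS⟩ := S_bounds hP hQXpos hQYpos hpX hpY p (ρ p) (v p) (hv p) (hvM p)
    have hGle : ∀ j : ℕ, 5 + 2 * ((j + 1 : ℕ) : ℝ) / δ ≤ (5 + 2 / δ) * ((j + 1 : ℕ) : ℝ) := by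
      intro j
      have h1 : (1:ℝ) ≤ (j + 1 : ℕ) := by exact_mod_cast Nat.le_add_left 1 j
      have : (5 + 2 / δ) * ((j + 1 : ℕ) : ℝ) = 5 * ((j + 1 : ℕ) : ℝ) + 2 * ((j + 1 : ℕ) : ℝ) / δ := by ring
      rw [this]; linarith
    have hρp := hρ p
    refine log_asymp _ (ρ p) c C (5 + 2 / δ) (hρ p) hc hC (by positivity) ?_ ?_
    · intro j
      refine le_trans ?_ (htri p hp (j + 1) (by omega)).2.1
      have h1 : ((5 + 2 / δ) * ((j + 1 : ℕ) : ℝ))⁻¹ ≤ (5 + 2 * ((j + 1 : ℕ) : ℝ) / δ)⁻¹ :=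
        inv_anti₀ (by positivity) (hGle j)
      have h2 := (hS j).1
      gcongr
    · intro j
      refine (htri p hp (j + 1) (by omega)).2.2.trans ?_
      have h1 := hGle j
      have h2 := (hS j).2
      have h3 : 0 ≤ ∫ x, hw QX QY μ μt p (j + 1) x ∂P := le_trans (by positivity) (hS j).1
      gcongr
  have hdiff : ∀ p ∈ Set.Ioo (-1:ℝ) 1, DifferentiableAt ℝ Lam p := by
    intro p hp
    have h1 : DifferentiableAt ℝ (fun p => Real.log (ρ p)) p := (hρd p).log (hρ p).ne'
    refine h1.congr_of_eventuallyEq ?_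
    filter_upwards [isOpen_Ioo.mem_nhds hp] with q hq using hLamEq q hq
  -- positivity of waiting times
  set ν := (P.prod Pt).prod P with hν
  have hm1 : ∀ n, Measurable fun z : ((ℕ → A) × (ℕ → A)) × (ℕ → A) => waitingTime n z.1.1 z.1.2 := fun n =>
    wt_measurable n (measurable_fst.comp measurable_fst) (measurable_snd.comp measurable_fst)
  have hm2 : ∀ n, Measurable fun z : ((ℕ → A) × (ℕ → A)) × (ℕ → A) => waitingTime n z.1.1 z.2 := fun n =>
    wt_measurable n (measurable_fst.comp measurable_fst) measurable_snd
  have hm3 : ∀ n, Measurable fun z : (ℕ → A) × (ℕ → A) => waitingTime n z.1 z.2 := fun n =>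
    wt_measurable n measurable_fst measurable_snd
  have hae : ∀ n, 1 ≤ n → ∀ᵐ z ∂ν, waitingTime n z.1.1 z.1.2 ≠ 0 ∧ waitingTime n z.1.1 z.2 ≠ 0 := by
    intro n hn
    refine Filter.Eventually.and ?_ ?_
    · have h : ∀ᵐ z ∂(P.prod Pt), waitingTime n z.1 z.2 ≠ 0 := by
        refine (Measure.ae_prod_iff_ae_ae (p := fun z => waitingTime n z.1 z.2 ≠ 0)
          ((hm3 n) (measurableSet_singleton 0).compl)).2 ?_
        exact ae_of_all _ fun x => wt_pos_ae hPt hμt1 hδ0 hδY x n hn (hpY n hn x)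
          (mul_le_one₀ hδ1 (hpY n hn x).le (hbY n hn x).2)
      exact Measure.quasiMeasurePreserving_fst.ae h
    · refine (Measure.ae_prod_iff_ae_ae (p := fun z : ((ℕ → A) × (ℕ → A)) × (ℕ → A) => waitingTime n z.1.1 z.2 ≠ 0)
        ((hm2 n) (measurableSet_singleton 0).compl)).2 ?_
      exact ae_of_all _ fun x => wt_pos_ae hP hμ1 hδ0 hδX x.1 n hn (hpX n hn x.1)
          (mul_le_one₀ hδ1 (hpX n hn x.1).le (hbX n hn x.1).2)
  have heq : ∀ n, 1 ≤ n → ∀ p : ℝ,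
      (fun z : ((ℕ → A) × (ℕ → A)) × (ℕ → A) =>
        ((waitingTime n z.1.1 z.1.2 : ℝ) / (waitingTime n z.1.1 z.2 : ℝ)) ^ p) =ᵐ[ν]
      fun z => Real.exp (p * Real.log ((waitingTime n z.1.1 z.1.2 : ℝ) / (waitingTime n z.1.1 z.2 : ℝ))) := by
    intro n hn p
    filter_upwards [hae n hn] with z hz
    have h1 : (0:ℝ) < waitingTime n z.1.1 z.1.2 := by exact_mod_cast Nat.pos_of_ne_zero hz.1
    have h2 : (0:ℝ) < waitingTime n z.1.1 z.2 := by exact_mod_cast Nat.pos_of_ne_zero hz.2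
    rw [Real.rpow_def_of_pos (div_pos h1 h2), mul_comm]
  refine ge_main (ν := ν) (X := fun n z => Real.log ((waitingTime n z.1.1 z.1.2 : ℝ) / (waitingTime n z.1.1 z.2 : ℝ)))
    (Lam := Lam) ?_ ?_ ?_ hdiff cm cp hcm hcp I hI J hJo hJc hK
  · intro n
    exact ((measurable_from_nat.comp (hm1 n)).div (measurable_from_nat.comp (hm2 n))).log
  · intro p hp n hn
    exact (integrable_congr (heq n hn p)).1 (htri p hp n hn).1
  · intro p hp
    refine (hLam p hp).congr' ?_
    filter_upwards [eventually_ge_atTop 1] with n hn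
    rw [ProbabilityTheory.cgf, ProbabilityTheory.mgf, integral_congr_ae (heq n hn p)]
end

section
/- Let A be a nonempty finite set, let Q_X and Q_Y be strictly positive stochastic matrices on A with stationary probability vectors mu and mu~, and let P, P~ be the stationary Markov measures determined by (Q_X, mu) and (Q_Y, mu~). Set h := sum_{x,y in A} mu(x) Q_X(x,y) log( Q_X(x,y) / Q_Y(x,y) ). Then the limit sigma^2 := lim_{n->infinity} (1/n) Var_P ( log( P_n(X_1,...,X_n) / P~_n(X_1,...,X_n) ) ) exists, and under P tensor P~ tensor P the random variables (1/sqrt(n)) ( log( W_n(X|Y) / W_n(X|X') ) - n h ) converge in distribution, as n -> infinity, to the centered normal law N(0, sigma^2). -/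
open MeasureTheory Filter Finset Real ProbabilityTheory

/-- Probability of the cylinder determined by the word `a_1, …, a_n` (coordinates `1 ≤ i ≤ n`). -/
noncomputable def cylProb {A : Type*} [MeasurableSpace A]
    (P : Measure (ℕ → A)) (n : ℕ) (a : ℕ → A) : ℝ :=
  (P {ω | ∀ i, 1 ≤ i → i ≤ n → ω i = a i}).toReal


/-- A stationary Markov measure with strictly positive transition matrix. -/
structure IsMk {A : Type*} [Fintype A] [MeasurableSpace A] (Q : A → A → ℝ) (μ : A → ℝ)
    (P : Measure (ℕ → A)) : Prop where
  pos : ∀ x y, 0 < Q x y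
  row : ∀ x, ∑ y, Q x y = 1
  nonneg : ∀ x, 0 ≤ μ x
  sum : ∑ x, μ x = 1
  stat : ∀ y, ∑ x, μ x * Q x y = μ y
  prob : IsProbabilityMeasure P
  law : ∀ (n : ℕ) (a : ℕ → A), (P {ω | ∀ i ≤ n, ω i = a i}).toReal
        = μ (a 0) * ∏ i ∈ Finset.range n, Q (a i) (a (i + 1))

set_option linter.unusedSectionVars false
set_option linter.unusedSimpArgs false
set_option linter.unnecessarySimpa false

namespace IsMk

variable {A : Type*} [Fintype A] [Nonempty A] [MeasurableSpace A] [MeasurableSingletonClass A]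
  {Q : A → A → ℝ} {μ : A → ℝ} {P : Measure (ℕ → A)}

/-- restriction to the first coordinates -/
def restr (n : ℕ) (ω : ℕ → A) : Fin (n + 1) → A := fun i => ω i

/-- extension of a finite word -/
def ext (n : ℕ) (a : Fin (n + 1) → A) : ℕ → A := fun i => a ⟨min i n, by omega⟩

lemma measurable_restr (n : ℕ) : Measurable (restr (A := A) n) := by
  unfold restr; fun_prop

lemma real_restr (h : IsMk Q μ P) (n : ℕ) (a : Fin (n + 1) → A) :
    (P.map (restr n)).real {a} = μ (a 0) * ∏ i : Fin n, Q (a i.castSucc) (a i.succ) := by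
  rw [measureReal_def, Measure.map_apply (measurable_restr n) (measurableSet_singleton a)]
  have h1 : restr n ⁻¹' {a} = {ω | ∀ i ≤ n, ω i = ext n a i} := by
    ext ω
    simp only [Set.mem_preimage, Set.mem_singleton_iff, Set.mem_ofPred_eq, funext_iff]
    constructor
    · intro hh i hi
      have := hh ⟨i, by omega⟩
      simp only [restr] at this
      rw [this]
      simp [ext, hi]
    · intro hh i
      have := hh i (by omega)
      simp only [restr]
      rw [this]
      simp only [ext]
      congr 1
      ext; simp; omega
  rw [h1, h.law, Finset.prod_range]
  congr 1
  apply Finset.prod_congr rfl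
  intro i _
  congr 1
  · simp only [ext]; congr 1; ext; simp
  · simp only [ext]; congr 1; ext; simp

variable {E : Type*} [NormedAddCommGroup E] [NormedSpace ℝ E] [CompleteSpace E]

lemma integral_restr (h : IsMk Q μ P) (n : ℕ) (F : (Fin (n + 1) → A) → E) :
    ∫ ω, F (restr n ω) ∂P
      = ∑ a, (μ (a 0) * ∏ i : Fin n, Q (a i.castSucc) (a i.succ)) • F a := by
  have := h.prob
  have hp : IsProbabilityMeasure (P.map (restr n)) :=
    Measure.isProbabilityMeasure_map (measurable_restr n).aemeasurable
  have hm : AEStronglyMeasurable F (P.map (restr n)) := 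
    (Integrable.of_finite (f := F)).aestronglyMeasurable
  rw [← integral_map (measurable_restr n).aemeasurable hm,
    integral_fintype (Integrable.of_finite)]
  simp_rw [h.real_restr]

lemma markov_fin (h : IsMk Q μ P) (n : ℕ) (G : (Fin (n + 1) → A) → A → E) :
    ∫ ω, G (restr n ω) (ω (n + 1)) ∂P = ∫ ω, ∑ y, Q (ω n) y • G (restr n ω) y ∂P := by
  have e1 := h.integral_restr (n + 1) (fun b => G (Fin.init b) (b (Fin.last _)))
  have e2 := h.integral_restr n (fun b => ∑ y, Q (b (Fin.last _)) y • G b y)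
  have e1' : ∀ ω : ℕ → A, G (Fin.init (restr (n + 1) ω)) (restr (n + 1) ω (Fin.last _))
      = G (restr n ω) (ω (n + 1)) := by
    intro ω; simp [restr, Fin.init]; rfl
  have e2' : ∀ ω : ℕ → A, restr n ω (Fin.last _) = ω n := by
    intro ω; simp [restr]
  simp only [e1'] at e1
  simp only [e2'] at e2
  rw [e1, e2, ← (Fin.snocEquiv (fun _ => A)).sum_comp, Fintype.sum_prod_type, Finset.sum_comm]
  apply Finset.sum_congr rfl
  intro a _
  rw [Finset.smul_sum]
  apply Finset.sum_congr rfl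
  intro y _
  rw [smul_smul]
  simp only [Fin.snocEquiv, Equiv.coe_fn_mk, Fin.init_snoc, Fin.snoc_last]
  congr 1
  rw [Fin.prod_univ_castSucc]
  have h0 : Fin.snoc (α := fun _ => A) a y 0 = a 0 := by
    have := Fin.snoc_castSucc (α := fun _ => A) y a 0
    simpa using this
  simp only [← Fin.castSucc_succ, Fin.succ_last, Fin.snoc_last, Fin.snoc_castSucc, h0]
  ring

/-- Markov property. -/
lemma markov (h : IsMk Q μ P) (n : ℕ) (G : (ℕ → A) → A → E)
    (hG : ∀ ω ω' y, (∀ i ≤ n, ω i = ω' i) → G ω y = G ω' y) :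
    ∫ ω, G ω (ω (n + 1)) ∂P = ∫ ω, ∑ y, Q (ω n) y • G ω y ∂P := by
  have := h.markov_fin n (fun a y => G (ext n a) y)
  have e : ∀ ω y, G (ext n (restr n ω)) y = G ω y := by
    intro ω y
    apply hG
    intro i hi
    simp [ext, restr, hi]
  simpa only [e] using this

/-- Functions depending on finitely many coordinates are integrable. -/
lemma integrable_dep (h : IsMk Q μ P) (n : ℕ) (G : (ℕ → A) → E)
    (hG : ∀ ω ω', (∀ i ≤ n, ω i = ω' i) → G ω = G ω') : Integrable G P := by
  have := h.prob
  have e : G = (fun a => G (ext n a)) ∘ restr n := by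
    funext ω
    apply hG
    intro i hi
    simp [ext, restr, hi]
  have hp : IsProbabilityMeasure (P.map (restr n)) :=
    Measure.isProbabilityMeasure_map (measurable_restr n).aemeasurable
  rw [e]
  exact (Integrable.of_finite (μ := P.map (restr n))).comp_measurable (measurable_restr n)

lemma integral_zero (h : IsMk Q μ P) (f : A → E) : ∫ ω, f (ω 0) ∂P = ∑ x, μ x • f x := by
  have := h.integral_restr 0 (fun b => f (b 0))
  simp only [Finset.univ_eq_empty, Finset.prod_empty, mul_one] at this
  have e : ∀ ω : ℕ → A, restr 0 ω 0 = ω 0 := fun ω => rfl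
  simp only [e] at this
  rw [this, ← (Equiv.funUnique (Fin 1) A).symm.sum_comp]
  simp [Equiv.funUnique]

lemma integral_coord (h : IsMk Q μ P) (n : ℕ) (f : A → E) :
    ∫ ω, f (ω n) ∂P = ∑ x, μ x • f x := by
  induction n generalizing f with
  | zero => exact h.integral_zero f
  | succ n ih =>
    rw [h.markov n (fun _ y => f y) (fun _ _ _ _ => rfl), ih (fun x => ∑ y, Q x y • f y)]
    simp_rw [Finset.smul_sum]
    rw [Finset.sum_comm]
    apply Finset.sum_congr rfl
    intro y _
    rw [← h.stat y, Finset.sum_smul]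
    simp_rw [smul_smul]

lemma mu_pos (h : IsMk Q μ P) (x : A) : 0 < μ x := by
  have : ∃ z, 0 < μ z := by
    by_contra hc
    push Not at hc
    have h1 := h.sum
    have : ∑ x, μ x ≤ 0 := Finset.sum_nonpos (fun x _ => hc x)
    linarith
  obtain ⟨z, hz⟩ := this
  rw [← h.stat x]
  exact Finset.sum_pos' (fun y _ => mul_nonneg (h.nonneg y) (h.pos y x).le)
    ⟨z, Finset.mem_univ _, mul_pos hz (h.pos z x)⟩

lemma exists_delta (h : IsMk Q μ P) : ∃ δ : ℝ, 0 < δ ∧ ∀ x y, δ ≤ Q x y := by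
  obtain ⟨z, hz⟩ := Finite.exists_min (fun p : A × A => Q p.1 p.2)
  exact ⟨Q z.1 z.2, h.pos _ _, fun x y => hz (x, y)⟩

/-- solvability of the Poisson equation -/
lemma poisson (h : IsMk Q μ P) (f : A → ℝ) (hf : ∑ x, μ x * f x = 0) :
    ∃ u : A → ℝ, ∀ x, u x - ∑ y, Q x y * u y = f x := by
  let T : (A → ℝ) →ₗ[ℝ] (A → ℝ) :=
    { toFun := fun u x => u x - ∑ y, Q x y * u y + ∑ y, μ y * u y
      map_add' := by
        intro u v; funext x
        simp only [Pi.add_apply, mul_add, Finset.sum_add_distrib]; ring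
      map_smul' := by
        intro c u; funext x
        simp only [Pi.smul_apply, smul_eq_mul, RingHom.id_apply, mul_sub, mul_add, Finset.mul_sum]
        congr 1
        · congr 1
          apply Finset.sum_congr rfl; intros; ring
        · apply Finset.sum_congr rfl; intros; ring }
  have hT : ∀ u x, T u x = u x - ∑ y, Q x y * u y + ∑ y, μ y * u y := fun _ _ => rfl
  have key : ∀ u, ∑ x, μ x * T u x = ∑ x, μ x * u x := by
    intro u
    simp only [hT, mul_add, mul_sub, Finset.sum_add_distrib, Finset.sum_sub_distrib]
    rw [← Finset.sum_mul, h.sum]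
    have : ∑ x, μ x * ∑ y, Q x y * u y = ∑ y, μ y * u y := by
      simp_rw [Finset.mul_sum]
      rw [Finset.sum_comm]
      apply Finset.sum_congr rfl
      intro y _
      rw [← h.stat y, Finset.sum_mul]
      apply Finset.sum_congr rfl; intros; ring
    rw [this]; ring
  have inj : Function.Injective T := by
    rw [injective_iff_map_eq_zero]
    intro u hu
    have h0 : ∑ x, μ x * u x = 0 := by rw [← key u, hu]; simp
    have h1 : ∀ x, u x = ∑ y, Q x y * u y := by
      intro x
      have := congrFun hu x
      rw [hT, h0] at this
      simp at this; linarith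
    obtain ⟨z, hz⟩ := Finite.exists_max u
    have h2 : ∑ y, Q z y * (u z - u y) = 0 := by
      simp only [mul_sub, Finset.sum_sub_distrib]
      rw [← Finset.sum_mul, h.row, ← h1 z]; ring
    have h3 : ∀ y, u y = u z := by
      intro y
      have := (Finset.sum_eq_zero_iff_of_nonneg
        (fun y _ => mul_nonneg (h.pos z y).le (sub_nonneg.2 (hz y)))).1 h2 y (Finset.mem_univ _)
      rcases mul_eq_zero.1 this with h4 | h4
      · exact absurd h4 (h.pos z y).ne'
      · linarith
    have h4 : u z = 0 := by
      have : ∑ x, μ x * u x = u z := by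
        simp_rw [h3]; rw [← Finset.sum_mul, h.sum, one_mul]
      rw [← this, h0]
    funext y
    simp [h3 y, h4]
  obtain ⟨u, hu⟩ := (LinearMap.injective_iff_surjective.1 inj) f
  refine ⟨u, fun x => ?_⟩
  have h0 : ∑ x, μ x * u x = 0 := by rw [← key u, hu, hf]
  have := congrFun hu x
  rw [hT, h0] at this
  linarith

end IsMk

namespace IsMk

variable {A : Type*} [Fintype A] [Nonempty A] [MeasurableSpace A] [MeasurableSingletonClass A]
  {Q : A → A → ℝ} {μ : A → ℝ} {P : Measure (ℕ → A)}

/-- additive functional -/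
def addF (d : A → A → ℝ) (n : ℕ) (ω : ℕ → A) : ℝ := ∑ i ∈ Finset.range n, d (ω i) (ω (i + 1))

lemma addF_dep (d : A → A → ℝ) (n : ℕ) (ω ω' : ℕ → A) (hh : ∀ i ≤ n, ω i = ω' i) :
    addF d n ω = addF d n ω' := by
  unfold addF
  apply Finset.sum_congr rfl
  intro i hi
  rw [Finset.mem_range] at hi
  rw [hh i (by omega), hh (i + 1) (by omega)]

lemma addF_succ (d : A → A → ℝ) (n : ℕ) (ω : ℕ → A) :
    addF d (n + 1) ω = addF d n ω + d (ω n) (ω (n + 1)) := Finset.sum_range_succ _ _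

lemma measurable_addF (d : A → A → ℝ) (n : ℕ) : Measurable (addF d n) := by
  unfold addF
  apply Finset.measurable_sum
  intro i _
  have : Measurable (fun p : A × A => d p.1 p.2) := measurable_of_finite _
  exact this.comp (by fun_prop : Measurable (fun ω : ℕ → A => (ω i, ω (i + 1))))

/-- asymptotic variance -/
noncomputable def sig (Q : A → A → ℝ) (μ : A → ℝ) (d : A → A → ℝ) : ℝ :=
  ∑ x, μ x * ∑ y, Q x y * d x y ^ 2

lemma sig_nonneg (h : IsMk Q μ P) (d : A → A → ℝ) : 0 ≤ sig Q μ d :=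
  Finset.sum_nonneg fun x _ => mul_nonneg (h.nonneg x)
    (Finset.sum_nonneg fun y _ => mul_nonneg (h.pos x y).le (sq_nonneg _))

lemma addF_mean (h : IsMk Q μ P) (d : A → A → ℝ) (hd : ∀ x, ∑ y, Q x y * d x y = 0) (n : ℕ) :
    ∫ ω, addF d n ω ∂P = 0 := by
  induction n with
  | zero => simp [addF]
  | succ n ih =>
    simp_rw [addF_succ]
    rw [h.markov n (fun ω y => addF d n ω + d (ω n) y)]
    · rw [← ih]
      congr 1
      funext ω
      simp only [smul_eq_mul, mul_add, Finset.sum_add_distrib, hd, add_zero]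
      rw [← Finset.sum_mul, h.row, one_mul]
    · intro ω ω' y hh
      rw [addF_dep d n ω ω' hh, hh n le_rfl]

lemma addF_sq (h : IsMk Q μ P) (d : A → A → ℝ) (hd : ∀ x, ∑ y, Q x y * d x y = 0) (n : ℕ) :
    ∫ ω, addF d n ω ^ 2 ∂P = n * sig Q μ d := by
  induction n with
  | zero => simp [addF]
  | succ n ih =>
    simp_rw [addF_succ]
    rw [h.markov n (fun ω y => (addF d n ω + d (ω n) y) ^ 2)]
    · have e : ∀ ω : ℕ → A, ∑ y, Q (ω n) y • (addF d n ω + d (ω n) y) ^ 2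
          = addF d n ω ^ 2 + ∑ y, Q (ω n) y * d (ω n) y ^ 2 := by
        intro ω
        have e1 : ∀ y, Q (ω n) y • (addF d n ω + d (ω n) y) ^ 2
          = Q (ω n) y * addF d n ω ^ 2 + 2 * addF d n ω * (Q (ω n) y * d (ω n) y)
            + Q (ω n) y * d (ω n) y ^ 2 := by intro y; simp only [smul_eq_mul]; ring
        simp_rw [e1]
        rw [Finset.sum_add_distrib, Finset.sum_add_distrib, ← Finset.mul_sum, hd,
          ← Finset.sum_mul, h.row]
        ring
      simp_rw [e]
      rw [integral_add, ih, h.integral_coord n (fun x => ∑ y, Q x y * d x y ^ 2)]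
      · simp only [smul_eq_mul, sig]; push_cast; ring
      · exact h.integrable_dep n _ (fun ω ω' hh => by rw [addF_dep d n ω ω' hh])
      · exact h.integrable_dep n _ (fun ω ω' hh => by rw [hh n le_rfl])
    · intro ω ω' y hh
      rw [addF_dep d n ω ω' hh, hh n le_rfl]

open Complex in
lemma taylor_bd (D C : ℝ) (hD : 0 ≤ D) (hC : 0 ≤ C) (s d w : ℝ) (hs : |s| ≤ 1) (hd : |d| ≤ D)
    (hw : |w| ≤ C) :
    ‖Complex.exp (I * (s * d : ℝ)) * (1 - (s ^ 2 / 2 * w : ℝ))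
      - (1 + I * (s * d : ℝ) - (s ^ 2 * d ^ 2 / 2 : ℝ) - (s ^ 2 / 2 * w : ℝ))‖
      ≤ (D ^ 3 * Real.exp D + D * C) * |s| ^ 3 := by
  have hsd : |s * d| ≤ |s| * D := by rw [abs_mul]; gcongr
  have hsd' : |s| * D ≤ D := by nlinarith
  have hn : ‖I * ((s * d : ℝ) : ℂ)‖ = |s * d| := by
    rw [norm_mul, norm_I, one_mul, Complex.norm_real, Real.norm_eq_abs]
  have h1 : ‖Complex.exp (I * (s * d : ℝ)) - (1 + I * (s * d : ℝ) - (s ^ 2 * d ^ 2 / 2 : ℝ))‖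
      ≤ D ^ 3 * Real.exp D * |s| ^ 3 := by
    have := Complex.norm_exp_sub_sum_le_norm_mul_exp (I * (s * d : ℝ)) 3
    rw [hn] at this
    have e : ∑ m ∈ Finset.range 3, (I * ((s * d : ℝ) : ℂ)) ^ m / (m.factorial : ℂ)
        = 1 + I * (s * d : ℝ) - (s ^ 2 * d ^ 2 / 2 : ℝ) := by
      simp only [Finset.sum_range_succ, Finset.sum_range_zero, Nat.factorial]
      push_cast
      have := I_sq
      ring_nf
      rw [this]; ring
    rw [e] at this
    refine this.trans ?_
    calc |s * d| ^ 3 * Real.exp |s * d| ≤ (|s| * D) ^ 3 * Real.exp D := by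
          gcongr; exact hsd.trans hsd'
      _ = _ := by ring
  have h2 : ‖(Complex.exp (I * (s * d : ℝ)) - 1) * (s ^ 2 / 2 * w : ℝ)‖ ≤ D * C * |s| ^ 3 := by
    rw [norm_mul, Complex.norm_real, Real.norm_eq_abs]
    have := Real.norm_exp_I_mul_ofReal_sub_one_le (x := s * d)
    rw [Real.norm_eq_abs] at this
    have h3 : |s ^ 2 / 2 * w| ≤ |s| ^ 2 * C := by
      rw [abs_mul, abs_div, abs_pow]
      have : |s| ^ 2 / |(2 : ℝ)| ≤ |s| ^ 2 := by
        rw [abs_two]; nlinarith [sq_nonneg |s|]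
      gcongr
    calc _ ≤ (|s| * D) * (|s| ^ 2 * C) := by
          gcongr; exact this.trans hsd
      _ = _ := by ring
  calc _ = ‖(Complex.exp (I * (s * d : ℝ)) - (1 + I * (s * d : ℝ) - (s ^ 2 * d ^ 2 / 2 : ℝ)))
        - (Complex.exp (I * (s * d : ℝ)) - 1) * (s ^ 2 / 2 * w : ℝ)‖ := by congr 1; ring
    _ ≤ _ := (norm_sub_le _ _).trans (by linarith)

lemma exists_bd (w : A → ℝ) : ∃ C, 0 ≤ C ∧ ∀ x, |w x| ≤ C := by
  obtain ⟨z, hz⟩ := Finite.exists_max (fun x => |w x|)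
  exact ⟨|w z|, abs_nonneg _, hz⟩

lemma exists_bd2 (w : A → A → ℝ) : ∃ C, 0 ≤ C ∧ ∀ x y, |w x y| ≤ C := by
  obtain ⟨z, hz⟩ := Finite.exists_max (fun x : A × A => |w x.1 x.2|)
  exact ⟨|w z.1 z.2|, abs_nonneg _, fun x y => hz (x, y)⟩

open Complex in
/-- One step of the perturbed transition operator. -/
lemma step_bd (h : IsMk Q μ P) (d : A → A → ℝ) (hd : ∀ x, ∑ y, Q x y * d x y = 0) :
    ∃ (w : A → ℝ) (K : ℝ), 0 ≤ K ∧ ∀ s : ℝ, |s| ≤ 1 → ∀ x,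
      ‖∑ y, Q x y • (Complex.exp (I * (s * d x y : ℝ)) * (1 - (s ^ 2 / 2 * w y : ℝ)))
        - ((1 - s ^ 2 * sig Q μ d / 2 : ℝ) : ℂ) * (1 - (s ^ 2 / 2 * w x : ℝ))‖ ≤ K * |s| ^ 3 := by
  have hσ := h.sig_nonneg d
  obtain ⟨w, hw⟩ := h.poisson (fun x => ∑ y, Q x y * d x y ^ 2 - sig Q μ d) (by
    simp only [mul_sub, Finset.sum_sub_distrib]
    rw [← Finset.sum_mul, h.sum, sig]; ring)
  obtain ⟨C, hC, hwC⟩ := exists_bd w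
  obtain ⟨D, hD, hdD⟩ := exists_bd2 d
  refine ⟨w, (D ^ 3 * Real.exp D + D * C) + sig Q μ d * C, by positivity, fun s hs x => ?_⟩
  have e1 : ∑ y, Q x y • ((1 : ℂ) + I * (s * d x y : ℝ) - (s ^ 2 * d x y ^ 2 / 2 : ℝ)
        - (s ^ 2 / 2 * w y : ℝ)) =
      ((1 - s ^ 2 * sig Q μ d / 2 : ℝ) : ℂ) * (1 - (s ^ 2 / 2 * w x : ℝ))
        - (s ^ 4 / 4 * sig Q μ d * w x : ℝ) := by
    have e2 : ∀ y, Q x y • ((1 : ℂ) + I * (s * d x y : ℝ) - (s ^ 2 * d x y ^ 2 / 2 : ℝ)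
        - (s ^ 2 / 2 * w y : ℝ)) = ((Q x y : ℝ) : ℂ) + I * s * ((Q x y * d x y : ℝ) : ℂ)
          - s ^ 2 / 2 * ((Q x y * d x y ^ 2 : ℝ) : ℂ) - s ^ 2 / 2 * ((Q x y * w y : ℝ) : ℂ) := by
      intro y
      rw [Complex.real_smul]; push_cast; ring
    simp_rw [e2]
    rw [Finset.sum_sub_distrib, Finset.sum_sub_distrib, Finset.sum_add_distrib,
      ← Finset.mul_sum, ← Finset.mul_sum, ← Finset.mul_sum, ← Complex.ofReal_sum,
      ← Complex.ofReal_sum, ← Complex.ofReal_sum, ← Complex.ofReal_sum, hd, h.row]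
    have e3 : ∑ y, Q x y * d x y ^ 2 = w x - ∑ y, Q x y * w y + sig Q μ d := by
      have := hw x; linarith
    rw [e3]
    push_cast
    ring
  have e4 : ‖∑ y, Q x y • (Complex.exp (I * (s * d x y : ℝ)) * (1 - (s ^ 2 / 2 * w y : ℝ)))
      - ∑ y, Q x y • ((1 : ℂ) + I * (s * d x y : ℝ) - (s ^ 2 * d x y ^ 2 / 2 : ℝ)
        - (s ^ 2 / 2 * w y : ℝ))‖ ≤ (D ^ 3 * Real.exp D + D * C) * |s| ^ 3 := by
    rw [← Finset.sum_sub_distrib]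
    refine (norm_sum_le _ _).trans ?_
    calc _ ≤ ∑ y, Q x y * ((D ^ 3 * Real.exp D + D * C) * |s| ^ 3) := by
          apply Finset.sum_le_sum
          intro y _
          rw [← smul_sub, norm_smul, Real.norm_eq_abs, abs_of_pos (h.pos x y)]
          exact mul_le_mul_of_nonneg_left
            (taylor_bd D C hD hC s (d x y) (w y) hs (hdD x y) (hwC y)) (h.pos x y).le
      _ = _ := by rw [← Finset.sum_mul, h.row, one_mul]
  rw [e1] at e4
  have e5 : ‖((s ^ 4 / 4 * sig Q μ d * w x : ℝ) : ℂ)‖ ≤ sig Q μ d * C * |s| ^ 3 := by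
    rw [Complex.norm_real, Real.norm_eq_abs, abs_mul, abs_mul, abs_of_nonneg hσ, abs_div, abs_pow]
    have : |s| ^ 4 / |(4 : ℝ)| ≤ |s| ^ 3 := by
      rw [abs_of_pos (by norm_num : (0 : ℝ) < 4)]
      have : |s| ^ 4 = |s| ^ 3 * |s| := by ring
      rw [this]
      have h3 : 0 ≤ |s| ^ 3 := by positivity
      nlinarith [mul_le_mul_of_nonneg_left hs h3]
    calc _ ≤ |s| ^ 3 * sig Q μ d * C := by gcongr; exact hwC x
      _ = _ := by ring
  calc _ = ‖(∑ y, Q x y • (Complex.exp (I * (s * d x y : ℝ)) * (1 - (s ^ 2 / 2 * w y : ℝ)))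
      - (((1 - s ^ 2 * sig Q μ d / 2 : ℝ) : ℂ) * (1 - (s ^ 2 / 2 * w x : ℝ))
        - (s ^ 4 / 4 * sig Q μ d * w x : ℝ))) - (s ^ 4 / 4 * sig Q μ d * w x : ℝ)‖ := by
        congr 1; ring
    _ ≤ _ := (norm_sub_le _ _).trans (by linarith)

open Complex in
lemma char_bd (h : IsMk Q μ P) (d : A → A → ℝ) (hd : ∀ x, ∑ y, Q x y * d x y = 0) :
    ∃ (K C : ℝ), 0 ≤ K ∧ 0 ≤ C ∧ ∀ s : ℝ, |s| ≤ 1 → s ^ 2 * sig Q μ d ≤ 2 → ∀ n : ℕ,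
      ‖∫ ω, Complex.exp (I * (s * addF d n ω : ℝ)) ∂P
        - ((1 - s ^ 2 * sig Q μ d / 2 : ℝ) : ℂ) ^ n‖ ≤ n * (K * |s| ^ 3) + C * s ^ 2 := by
  have := h.prob
  have hσ := h.sig_nonneg d
  obtain ⟨w, K, hK, hst⟩ := h.step_bd d hd
  obtain ⟨C, hC, hwC⟩ := exists_bd w
  refine ⟨K, C, hK, hC, fun s hs hs2 n => ?_⟩
  set l : ℂ := ((1 - s ^ 2 * sig Q μ d / 2 : ℝ) : ℂ) with hl
  have hl1 : ‖l‖ ≤ 1 := by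
    rw [hl, Complex.norm_real, Real.norm_eq_abs, abs_le]
    have : 0 ≤ s ^ 2 * sig Q μ d := by positivity
    constructor <;> linarith
  have hne : ∀ r : ℝ, ‖Complex.exp (I * (r : ℂ))‖ = 1 := Complex.norm_exp_I_mul_ofReal
  have hψ : ∀ x, ‖((s ^ 2 / 2 * w x : ℝ) : ℂ)‖ ≤ C * s ^ 2 / 2 := by
    intro x
    rw [Complex.norm_real, Real.norm_eq_abs, abs_mul, abs_of_nonneg (by positivity)]
    have := mul_le_mul_of_nonneg_left (hwC x) (by positivity : 0 ≤ s ^ 2 / 2)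
    linarith
  let a : ℕ → ℂ := fun k => ∫ ω, Complex.exp (I * (s * addF d k ω : ℝ)) *
    (1 - (s ^ 2 / 2 * w (ω k) : ℝ)) ∂P
  have ha : ∀ k, ‖a (k + 1) - l * a k‖ ≤ K * |s| ^ 3 := by
    intro k
    have e1 : a (k + 1) = ∫ ω, ∑ y, Q (ω k) y • (Complex.exp (I * (s * (addF d k ω + d (ω k) y) : ℝ)) *
        (1 - (s ^ 2 / 2 * w y : ℝ))) ∂P := by
      rw [← h.markov k (fun ω y => Complex.exp (I * (s * (addF d k ω + d (ω k) y) : ℝ)) *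
        (1 - (s ^ 2 / 2 * w y : ℝ)))]
      · simp only [a, addF_succ]
      · intro ω ω' y hh
        rw [addF_dep d k ω ω' hh, hh k le_rfl]
    rw [e1]
    simp only [a]
    rw [← integral_const_mul, ← integral_sub]
    · refine (norm_integral_le_of_norm_le_const (C := K * |s| ^ 3) (Eventually.of_forall ?_)).trans ?_
      · intro ω
        have e2 : ∑ y, Q (ω k) y • (Complex.exp (I * (s * (addF d k ω + d (ω k) y) : ℝ)) *
              (1 - (s ^ 2 / 2 * w y : ℝ)))
            - l * (Complex.exp (I * (s * addF d k ω : ℝ)) * (1 - (s ^ 2 / 2 * w (ω k) : ℝ)))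
            = Complex.exp (I * (s * addF d k ω : ℝ)) *
              (∑ y, Q (ω k) y • (Complex.exp (I * (s * d (ω k) y : ℝ)) * (1 - (s ^ 2 / 2 * w y : ℝ)))
              - l * (1 - (s ^ 2 / 2 * w (ω k) : ℝ))) := by
          rw [mul_sub (Complex.exp _) (Finset.sum _ _), Finset.mul_sum]
          congr 1
          · apply Finset.sum_congr rfl
            intro y _
            have : (I * ((s * (addF d k ω + d (ω k) y) : ℝ) : ℂ)) =
              I * (s * addF d k ω : ℝ) + I * (s * d (ω k) y : ℝ) := by push_cast; ring
            rw [this, Complex.exp_add, Complex.real_smul, Complex.real_smul]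
            ring
          · ring
        rw [e2, norm_mul, hne, one_mul]
        exact hst s hs (ω k)
      · simp
    · apply h.integrable_dep k
      intro ω ω' hh
      rw [addF_dep d k ω ω' hh, hh k le_rfl]
    · apply h.integrable_dep k
      intro ω ω' hh
      rw [addF_dep d k ω ω' hh, hh k le_rfl]
  have hb : ∀ k : ℕ, ‖a k - l ^ k * a 0‖ ≤ k * (K * |s| ^ 3) := by
    intro k
    induction k with
    | zero => simp
    | succ k ih =>
      have e : a (k + 1) - l ^ (k + 1) * a 0 = (a (k + 1) - l * a k) + l * (a k - l ^ k * a 0) := by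
        ring
      rw [e]
      refine (norm_add_le _ _).trans ?_
      rw [norm_mul]
      have h1 := ha k
      have h2 : ‖l‖ * ‖a k - l ^ k * a 0‖ ≤ 1 * (k * (K * |s| ^ 3)) := by gcongr
      push_cast
      linarith
  have hc : ∀ k : ℕ, ‖∫ ω, Complex.exp (I * (s * addF d k ω : ℝ)) ∂P - a k‖ ≤ C * s ^ 2 / 2 := by
    intro k
    simp only [a]
    rw [← integral_sub]
    · refine (norm_integral_le_of_norm_le_const (C := C * s ^ 2 / 2) (Eventually.of_forall ?_)).trans ?_
      · intro ω
        have : Complex.exp (I * (s * addF d k ω : ℝ)) - Complex.exp (I * (s * addF d k ω : ℝ)) *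
          (1 - (s ^ 2 / 2 * w (ω k) : ℝ)) = Complex.exp (I * (s * addF d k ω : ℝ)) *
            (s ^ 2 / 2 * w (ω k) : ℝ) := by ring
        rw [this, norm_mul, hne, one_mul]
        exact hψ _
      · simp
    · apply h.integrable_dep k
      intro ω ω' hh
      rw [addF_dep d k ω ω' hh]
    · apply h.integrable_dep k
      intro ω ω' hh
      rw [addF_dep d k ω ω' hh, hh k le_rfl]
  have h0 : ‖1 - a 0‖ ≤ C * s ^ 2 / 2 := by
    have := hc 0
    simpa [addF] using this
  have h1 : ‖l ^ n * (1 - a 0)‖ ≤ C * s ^ 2 / 2 := by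
    rw [norm_mul, norm_pow]
    have : ‖l‖ ^ n ≤ 1 := pow_le_one₀ (norm_nonneg _) hl1
    calc _ ≤ 1 * (C * s ^ 2 / 2) := by gcongr
      _ = _ := one_mul _
  calc _ = ‖(∫ ω, Complex.exp (I * (s * addF d n ω : ℝ)) ∂P - a n) + (a n - l ^ n * a 0)
        - l ^ n * (1 - a 0)‖ := by congr 1; ring
    _ ≤ _ := (norm_sub_le _ _).trans (add_le_add (norm_add_le _ _) le_rfl)
    _ ≤ _ := by linarith [hc n, hb n]

open Complex in
lemma char_tendsto (h : IsMk Q μ P) (d : A → A → ℝ) (hd : ∀ x, ∑ y, Q x y * d x y = 0) (t : ℝ) :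
    Tendsto (fun n : ℕ => ∫ ω, Complex.exp (I * (t * (addF d n ω / Real.sqrt n) : ℝ)) ∂P) atTop
      (nhds (Complex.exp (-(t ^ 2 * sig Q μ d / 2 : ℝ)))) := by
  obtain ⟨K, C, hK, hC, hb⟩ := h.char_bd d hd
  have hσ := h.sig_nonneg d
  have hsq : Tendsto (fun n : ℕ => Real.sqrt n) atTop atTop :=
    Real.tendsto_sqrt_atTop.comp tendsto_natCast_atTop_atTop
  have ht : Tendsto (fun n : ℕ => t / Real.sqrt n) atTop (nhds 0) :=
    hsq.const_div_atTop t
  have lim1 : Tendsto (fun n : ℕ => ((1 - (t / Real.sqrt n) ^ 2 * sig Q μ d / 2 : ℝ) : ℂ) ^ n) atTop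
      (nhds (Complex.exp (-(t ^ 2 * sig Q μ d / 2 : ℝ)))) := by
    have := Real.tendsto_one_add_div_pow_exp (-(t ^ 2 * sig Q μ d / 2))
    have := (Complex.continuous_ofReal.tendsto _).comp this
    rw [Complex.ofReal_exp, Complex.ofReal_neg] at this
    refine this.congr' ?_
    filter_upwards [eventually_gt_atTop 0] with n hn
    simp only [Function.comp]
    rw [Complex.ofReal_pow]
    congr 2
    rw [div_pow, Real.sq_sqrt (by positivity)]
    field_simp
    ring
  have hz : Tendsto (fun n : ℕ => (n : ℝ) * (K * |t / Real.sqrt n| ^ 3) + C * (t / Real.sqrt n) ^ 2)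
      atTop (nhds 0) := by
    have e1 : Tendsto (fun n : ℕ => K * t ^ 2 * |t / Real.sqrt n| + C * (t / Real.sqrt n) ^ 2)
        atTop (nhds (K * t ^ 2 * |(0 : ℝ)| + C * 0 ^ 2)) :=
      (ht.abs.const_mul _).add ((ht.pow 2).const_mul _)
    simp only [abs_zero, mul_zero, ne_eq, OfNat.ofNat_ne_zero, not_false_eq_true, zero_pow,
      add_zero] at e1
    refine e1.congr' ?_
    filter_upwards [eventually_gt_atTop 0] with n hn
    congr 1
    have : |t / Real.sqrt n| ^ 3 = |t / Real.sqrt n| * (t / Real.sqrt n) ^ 2 := by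
      rw [← sq_abs (t / Real.sqrt n)]; ring
    rw [this, div_pow, Real.sq_sqrt (by positivity)]
    field_simp
  have hdiff : Tendsto (fun n : ℕ => ∫ ω, Complex.exp (I * (t * (addF d n ω / Real.sqrt n) : ℝ)) ∂P
      - ((1 - (t / Real.sqrt n) ^ 2 * sig Q μ d / 2 : ℝ) : ℂ) ^ n) atTop (nhds 0) := by
    refine squeeze_zero_norm' ?_ hz
    have c1 : ∀ᶠ n : ℕ in atTop, |t / Real.sqrt n| < 1 := by
      have := ht.abs
      rw [abs_zero] at this
      exact this.eventually_lt_const one_pos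
    have c2 : ∀ᶠ n : ℕ in atTop, (t / Real.sqrt n) ^ 2 * sig Q μ d < 2 := by
      have := (ht.pow 2).mul_const (sig Q μ d)
      refine this.eventually_lt_const ?_
      simp
    filter_upwards [c1, c2] with n h1 h2
    have := hb _ h1.le h2.le n
    have e : ∀ ω, t * (addF d n ω / Real.sqrt n) = t / Real.sqrt n * addF d n ω := by
      intro ω; ring
    simp_rw [e]
    exact this
  simpa using hdiff.add lim1

end IsMk

namespace IsMk

variable {A : Type*} [Fintype A] [Nonempty A] [MeasurableSpace A] [MeasurableSingletonClass A]
  {Q : A → A → ℝ} {μ : A → ℝ} {P : Measure (ℕ → A)}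

/-- occurrence of the word `a` after position `k` -/
def occ (n : ℕ) (a : ℕ → A) (k : ℕ) (ω : ℕ → A) : Prop := ∀ i, 1 ≤ i → i ≤ n → ω (k + i) = a i

lemma occ_dep (n : ℕ) (a : ℕ → A) (k : ℕ) (ω ω' : ℕ → A) (hh : ∀ i ≤ k + n, ω i = ω' i) :
    occ n a k ω ↔ occ n a k ω' := by
  unfold occ
  constructor
  · intro H i h1 h2
    rw [← hh _ (by omega)]; exact H i h1 h2
  · intro H i h1 h2
    rw [hh _ (by omega)]; exact H i h1 h2

lemma occ_succ (n : ℕ) (a : ℕ → A) (k : ℕ) (ω : ℕ → A) :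
    occ (n + 1) a k ω ↔ occ n a k ω ∧ ω (k + n + 1) = a (n + 1) := by
  unfold occ
  constructor
  · intro H
    exact ⟨fun i h1 h2 => H i h1 (by omega), H (n + 1) (by omega) le_rfl⟩
  · rintro ⟨H1, H2⟩ i h1 h2
    rcases Nat.lt_or_ge n i with h3 | h3
    · obtain rfl : i = n + 1 := by omega
      exact H2
    · exact H1 i h1 h3

lemma measurableSet_occ (n : ℕ) (a : ℕ → A) (k : ℕ) : MeasurableSet {ω | occ n a k ω} := by
  have : {ω : ℕ → A | occ n a k ω} = ⋂ i ∈ Finset.Icc 1 n, {ω | ω (k + i) = a i} := by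
    ext ω; simp [occ]
  rw [this]
  apply Finset.measurableSet_biInter
  intro i _
  exact measurableSet_eq_fun (by fun_prop) measurable_const

open Classical in
lemma word_int (h : IsMk Q μ P) (k : ℕ) (a : ℕ → A) (G : (ℕ → A) → ℝ)
    (hG : ∀ ω ω', (∀ i ≤ k, ω i = ω' i) → G ω = G ω') (m : ℕ) :
    ∫ ω, G ω * (if occ (m + 1) a k ω then 1 else 0) ∂P
      = (∏ i ∈ Finset.range m, Q (a (i + 1)) (a (i + 2))) * ∫ ω, G ω * Q (ω k) (a 1) ∂P := by
  induction m with
  | zero =>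
    have e : ∀ ω : ℕ → A, occ 1 a k ω ↔ ω (k + 1) = a 1 := by
      intro ω
      rw [occ_succ]
      constructor
      · exact fun H => H.2
      · exact fun H => ⟨fun i h1 h2 => by omega, H⟩
    simp only [zero_add, e]
    rw [h.markov k (fun ω y => G ω * (if y = a 1 then 1 else 0))]
    · simp [mul_comm]
    · intro ω ω' y hh
      rw [hG ω ω' hh]
  | succ m ih =>
    have e : ∀ ω : ℕ → A, G ω * (if occ (m + 1 + 1) a k ω then (1 : ℝ) else 0)
        = (G ω * if occ (m + 1) a k ω then 1 else 0) *
          (if ω (k + (m + 1) + 1) = a (m + 2) then 1 else 0) := by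
      intro ω
      rw [occ_succ]
      by_cases h1 : occ (m + 1) a k ω <;> by_cases h2 : ω (k + (m + 1) + 1) = a (m + 2) <;>
        simp [h1, h2]
    simp only [e]
    rw [h.markov (k + (m + 1)) (fun ω y => (G ω * if occ (m + 1) a k ω then 1 else 0) *
          (if y = a (m + 2) then 1 else 0))]
    · have e2 : ∀ ω : ℕ → A, ∑ y, Q (ω (k + (m + 1))) y •
          ((G ω * if occ (m + 1) a k ω then 1 else 0) * (if y = a (m + 2) then 1 else 0))
          = Q (a (m + 1)) (a (m + 2)) * (G ω * if occ (m + 1) a k ω then 1 else 0) := by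
        intro ω
        by_cases h1 : occ (m + 1) a k ω
        · have := h1 (m + 1) (by omega) le_rfl
          rw [this]
          simp [h1]
        · simp [h1]
      simp only [e2]
      rw [integral_const_mul, ih, Finset.prod_range_succ]
      ring
    · intro ω ω' y hh
      rw [hG ω ω' (fun i hi => hh i (by omega))]
      congr 2
      exact if_congr (occ_dep (m + 1) a k ω ω' hh) rfl rfl

open Classical in
lemma real_eq_int (S : Set (ℕ → A)) (hS : MeasurableSet S) :
    P.real S = ∫ ω, (if ω ∈ S then (1 : ℝ) else 0) ∂P := by
  rw [← integral_indicator_one hS]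
  congr 1

lemma occ_real (h : IsMk Q μ P) (m k : ℕ) (a : ℕ → A) :
    P.real {ω | occ (m + 1) a k ω}
      = (∏ i ∈ Finset.range m, Q (a (i + 1)) (a (i + 2))) * μ (a 1) := by
  classical
  have := h.prob
  rw [real_eq_int _ (measurableSet_occ _ _ _)]
  have := h.word_int k a (fun _ => 1) (fun _ _ _ => rfl) m
  simp only [one_mul] at this
  simp only [Set.mem_ofPred_eq]
  rw [this, h.integral_coord k (fun x => Q x (a 1))]
  simp only [smul_eq_mul, h.stat]

lemma cylProb_eq_occ (n : ℕ) (a : ℕ → A) : cylProb P n a = P.real {ω | occ n a 0 ω} := by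
  simp [cylProb, occ, measureReal_def]

lemma cylProb_eq (h : IsMk Q μ P) (m : ℕ) (a : ℕ → A) :
    cylProb P (m + 1) a = (∏ i ∈ Finset.range m, Q (a (i + 1)) (a (i + 2))) * μ (a 1) := by
  rw [cylProb_eq_occ, h.occ_real]

lemma cylProb_pos (h : IsMk Q μ P) (m : ℕ) (a : ℕ → A) : 0 < cylProb P (m + 1) a := by
  rw [h.cylProb_eq]
  exact mul_pos (Finset.prod_pos fun i _ => h.pos _ _) (h.mu_pos _)

lemma cylProb_le_one (h : IsMk Q μ P) (n : ℕ) (a : ℕ → A) : cylProb P n a ≤ 1 := by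
  have := h.prob
  rw [cylProb_eq_occ]
  exact measureReal_le_one

lemma union_bd (h : IsMk Q μ P) (m N : ℕ) (a : ℕ → A) :
    P.real {ω | ∃ k ∈ Finset.Icc 1 N, occ (m + 1) a k ω} ≤ N * cylProb P (m + 1) a := by
  have := h.prob
  have e : {ω | ∃ k ∈ Finset.Icc 1 N, occ (m + 1) a k ω}
      = ⋃ k ∈ Finset.Icc 1 N, {ω | occ (m + 1) a k ω} := by ext ω; simp
  rw [e]
  refine (measureReal_biUnion_finset_le _ _).trans ?_
  simp only [h.occ_real, h.cylProb_eq]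
  simp

lemma block_bd (h : IsMk Q μ P) (m J : ℕ) (a : ℕ → A) (δ : ℝ) (hδ : 0 < δ) (hQ : ∀ x y, δ ≤ Q x y) :
    P.real {ω | ∀ j < J, ¬ occ (m + 1) a ((j + 1) * (m + 1)) ω}
      ≤ (1 - δ * cylProb P (m + 1) a) ^ J := by
  classical
  have hp := h.prob
  have hms : ∀ J, MeasurableSet {ω : ℕ → A | ∀ j < J, ¬ occ (m + 1) a ((j + 1) * (m + 1)) ω} := by
    intro J
    have : {ω : ℕ → A | ∀ j < J, ¬ occ (m + 1) a ((j + 1) * (m + 1)) ω}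
        = ⋂ j ∈ Finset.range J, {ω | occ (m + 1) a ((j + 1) * (m + 1)) ω}ᶜ := by
      ext ω; simp
    rw [this]
    exact Finset.measurableSet_biInter _ fun j _ => (measurableSet_occ _ _ _).compl
  obtain ⟨B, hB⟩ : ∃ B : ℕ → Set (ℕ → A),
      B = fun J => {ω : ℕ → A | ∀ j < J, ¬ occ (m + 1) a ((j + 1) * (m + 1)) ω} := ⟨_, rfl⟩
  have hBm : ∀ J ω, ω ∈ B J ↔ ∀ j < J, ¬ occ (m + 1) a ((j + 1) * (m + 1)) ω := by
    intro J ω; rw [hB]; simp only [Set.mem_ofPred_eq]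
  have hBJ : ∀ J, {ω : ℕ → A | ∀ j < J, ¬ occ (m + 1) a ((j + 1) * (m + 1)) ω} = B J := by
    intro J; rw [hB]
  simp only [hBJ] at hms ⊢
  have hδ1 : δ ≤ 1 := by
    obtain ⟨x⟩ := ‹Nonempty A›
    calc δ ≤ Q x x := hQ x x
      _ ≤ ∑ y, Q x y := Finset.single_le_sum (f := fun y => Q x y) (fun y _ => (h.pos x y).le) (Finset.mem_univ x)
      _ = 1 := h.row x
  have hc0 := h.cylProb_pos m a
  have hc1 := h.cylProb_le_one (m + 1) a
  have hx : 0 ≤ 1 - δ * cylProb P (m + 1) a := by nlinarith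
  induction J with
  | zero => exact measureReal_le_one.trans (by simp)
  | succ J ih =>
    rw [real_eq_int _ (hms _)] at ih ⊢
    set H : (ℕ → A) → ℝ := fun ω =>
      if ω ∈ B J then (1 : ℝ) else 0 with hH
    have hdep : ∀ ω ω', (∀ i ≤ (J + 1) * (m + 1), ω i = ω' i) → H ω = H ω' := by
      intro ω ω' hh
      simp only [hH, hBm]
      refine if_congr ?_ rfl rfl
      refine forall_congr' fun j => forall_congr' fun hj => not_congr ?_
      apply occ_dep
      intro i hi
      apply hh
      have : (j + 1) * (m + 1) + (m + 1) = (j + 1 + 1) * (m + 1) := by ring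
      rw [this] at hi
      exact hi.trans (Nat.mul_le_mul_right _ (by omega))
    have e : ∀ ω : ℕ → A, (if ω ∈ B (J + 1) then (1 : ℝ) else 0)
        = H ω - H ω * (if occ (m + 1) a ((J + 1) * (m + 1)) ω then 1 else 0) := by
      intro ω
      simp only [hH, hBm, Nat.lt_succ_iff_lt_or_eq, or_imp, forall_and, forall_eq]
      by_cases h1 : ∀ j < J, ¬ occ (m + 1) a ((j + 1) * (m + 1)) ω <;>
      by_cases h2 : occ (m + 1) a ((J + 1) * (m + 1)) ω <;> simp [h1, h2]
    have iH : Integrable H P := h.integrable_dep _ _ hdep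
    simp only [e]
    rw [integral_sub iH, h.word_int _ a H hdep m]
    · have i1 : δ * ∫ ω, H ω ∂P ≤ ∫ ω, H ω * Q (ω ((J + 1) * (m + 1))) (a 1) ∂P := by
        rw [← integral_const_mul]
        apply integral_mono (iH.const_mul _)
        · apply h.integrable_dep ((J + 1) * (m + 1))
          intro ω ω' hh
          rw [hdep ω ω' hh, hh _ le_rfl]
        · intro ω
          have : 0 ≤ H ω := by simp only [hH]; split_ifs <;> norm_num
          have := mul_le_mul_of_nonneg_left (hQ (ω ((J + 1) * (m + 1))) (a 1)) this
          simp only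
          linarith
      have i2 : cylProb P (m + 1) a ≤ ∏ i ∈ Finset.range m, Q (a (i + 1)) (a (i + 2)) := by
        rw [h.cylProb_eq]
        have : μ (a 1) ≤ 1 := by
          rw [← h.sum]
          exact Finset.single_le_sum (fun y _ => h.nonneg y) (Finset.mem_univ _)
        exact mul_le_of_le_one_right (Finset.prod_nonneg fun i _ => (h.pos _ _).le) this
      have i3 : 0 ≤ ∫ ω, H ω ∂P := by
        apply integral_nonneg
        intro ω
        simp only [hH]; split_ifs <;> norm_num
      have i4 : cylProb P (m + 1) a * (δ * ∫ ω, H ω ∂P)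
          ≤ (∏ i ∈ Finset.range m, Q (a (i + 1)) (a (i + 2))) *
            ∫ ω, H ω * Q (ω ((J + 1) * (m + 1))) (a 1) ∂P := by
        apply mul_le_mul i2 i1 (by positivity) (Finset.prod_nonneg fun i _ => (h.pos _ _).le)
      calc _ ≤ (1 - δ * cylProb P (m + 1) a) * ∫ ω, H ω ∂P := by linarith
        _ ≤ (1 - δ * cylProb P (m + 1) a) * (1 - δ * cylProb P (m + 1) a) ^ J := by gcongr
        _ = _ := by ring
    · apply h.integrable_dep ((J + 1) * (m + 1) + (m + 1))
      intro ω ω' hh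
      rw [hdep ω ω' (fun i hi => hh i (by omega))]
      congr 1
      exact if_congr (occ_dep _ _ _ _ _ hh) rfl rfl

/-- error rate -/
noncomputable def rate (δ ε : ℝ) (n : ℕ) : ℝ :=
  Real.exp (-(ε * Real.sqrt n)) + Real.exp (-(δ * (Real.exp (ε * Real.sqrt n) / n - 1)))

lemma rate_tendsto (δ ε : ℝ) (hδ : 0 < δ) (hε : 0 < ε) :
    Tendsto (rate δ ε) atTop (nhds 0) := by
  have hsq : Tendsto (fun n : ℕ => Real.sqrt n) atTop atTop :=
    Real.tendsto_sqrt_atTop.comp tendsto_natCast_atTop_atTop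
  have h1 : Tendsto (fun n : ℕ => Real.exp (-(ε * Real.sqrt n))) atTop (nhds 0) :=
    Real.tendsto_exp_neg_atTop_nhds_zero.comp (hsq.const_mul_atTop hε)
  have h2 : Tendsto (fun n : ℕ => Real.exp (ε * Real.sqrt n) / n - 1) atTop atTop := by
    have := (tendsto_exp_mul_div_rpow_atTop 2 ε hε).comp hsq
    have := tendsto_atTop_add_const_right _ (-1) this
    refine this.congr ?_
    intro n
    simp only [Function.comp]
    rw [Real.rpow_two, Real.sq_sqrt (by positivity)]
    ring
  have h3 := Real.tendsto_exp_neg_atTop_nhds_zero.comp (h2.const_mul_atTop hδ)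
  have := h1.add h3
  rw [add_zero] at this
  exact this

lemma wait_bd (h : IsMk Q μ P) (δ : ℝ) (hδ : 0 < δ) (hQ : ∀ x y, δ ≤ Q x y) (ε : ℝ)
    (m : ℕ) (a : ℕ → A) :
    P.real {y | ¬ (1 ≤ waitingTime (m + 1) a y ∧
      |Real.log (waitingTime (m + 1) a y) + Real.log (cylProb P (m + 1) a)|
        ≤ ε * Real.sqrt ((m + 1 : ℕ) : ℝ))} ≤ rate δ ε (m + 1) := by
  have hpr := h.prob
  set p := cylProb P (m + 1) a with hp
  have hp0 : 0 < p := h.cylProb_pos m a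
  have hp1 : p ≤ 1 := h.cylProb_le_one (m + 1) a
  set b := ε * Real.sqrt ((m + 1 : ℕ) : ℝ) with hb
  set N := ⌊Real.exp (-b) / p⌋₊ with hN
  set J := ⌊Real.exp b / (p * (m + 1 : ℕ))⌋₊ with hJ
  have hm : (0 : ℝ) < ((m + 1 : ℕ) : ℝ) := by positivity
  have hsub : {y | ¬ (1 ≤ waitingTime (m + 1) a y ∧
      |Real.log (waitingTime (m + 1) a y) + Real.log p| ≤ b)} ⊆
      {ω | ∃ k ∈ Finset.Icc 1 N, occ (m + 1) a k ω} ∪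
      {ω | ∀ j < J, ¬ occ (m + 1) a ((j + 1) * (m + 1)) ω} := by
    intro y hy
    by_contra hc
    simp only [Set.mem_union, Set.mem_ofPred_eq, not_or, not_exists, not_and, not_forall, not_not] at hc
    obtain ⟨hc1, j, hj, hc2⟩ := hc
    apply hy
    have hne : {k | 1 ≤ k ∧ ∀ i, 1 ≤ i → i ≤ m + 1 → y (k + i) = a i}.Nonempty :=
      ⟨(j + 1) * (m + 1), Nat.mul_pos (by omega) (by omega), hc2⟩
    have hW := Nat.sInf_mem hne
    have hle : waitingTime (m + 1) a y ≤ (j + 1) * (m + 1) :=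
      Nat.sInf_le ⟨Nat.mul_pos (by omega) (by omega), hc2⟩
    change 1 ≤ waitingTime (m + 1) a y ∧ occ (m + 1) a (waitingTime (m + 1) a y) y at hW
    obtain ⟨hW1, hW2⟩ := hW
    set W := waitingTime (m + 1) a y
    have hNW : N < W := by
      by_contra hlt
      exact hc1 W (Finset.mem_Icc.2 ⟨hW1, by omega⟩) hW2
    refine ⟨hW1, ?_⟩
    have hW0 : (0 : ℝ) < W := by exact_mod_cast hW1
    rw [← Real.log_mul hW0.ne' hp0.ne', abs_le]
    constructor
    · rw [Real.le_log_iff_exp_le (by positivity)]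
      have : Real.exp (-b) / p < W := (Nat.floor_lt (by positivity)).1 hNW
      rw [div_lt_iff₀ hp0] at this
      exact this.le
    · rw [Real.log_le_iff_le_exp (by positivity)]
      have h1 : (W : ℝ) ≤ J * (m + 1 : ℕ) := by
        have : W ≤ J * (m + 1) := hle.trans (Nat.mul_le_mul_right _ hj)
        exact_mod_cast this
      have h2 : (J : ℝ) ≤ Real.exp b / (p * (m + 1 : ℕ)) := Nat.floor_le (by positivity)
      rw [le_div_iff₀ (by positivity)] at h2
      calc (W : ℝ) * p ≤ J * (m + 1 : ℕ) * p := by gcongr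
        _ = J * (p * (m + 1 : ℕ)) := by ring
        _ ≤ _ := h2
  refine (measureReal_mono hsub).trans ((measureReal_union_le _ _).trans ?_)
  unfold rate
  apply add_le_add
  · refine (h.union_bd m N a).trans ?_
    have : (N : ℝ) ≤ Real.exp (-b) / p := Nat.floor_le (by positivity)
    rwa [le_div_iff₀ hp0] at this
  · refine (h.block_bd m J a δ hδ hQ).trans ?_
    rw [← hp, ← hb]
    have hx : 0 ≤ 1 - δ * p := by
      have hδ1 : δ ≤ 1 := by
        obtain ⟨x⟩ := ‹Nonempty A›
        calc δ ≤ Q x x := hQ x x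
          _ ≤ ∑ y, Q x y := Finset.single_le_sum (f := fun y => Q x y) (fun y _ => (h.pos x y).le) (Finset.mem_univ x)
          _ = 1 := h.row x
      nlinarith
    calc (1 - δ * p) ^ J ≤ (Real.exp (-(δ * p))) ^ J := by
          gcongr; exact Real.one_sub_le_exp_neg _
      _ = Real.exp (-(δ * (p * J))) := by rw [← Real.exp_nat_mul]; congr 1; ring
      _ ≤ _ := by
        rw [Real.exp_le_exp, neg_le_neg_iff]
        have h3 : Real.exp b / (p * (m + 1 : ℕ)) - 1 < J := Nat.sub_one_lt_floor _
        have h4 : Real.exp b / (m + 1 : ℕ) - 1 ≤ p * J := by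
          calc Real.exp b / (m + 1 : ℕ) - 1 ≤ Real.exp b / (m + 1 : ℕ) - p := by linarith
            _ = p * (Real.exp b / (p * (m + 1 : ℕ)) - 1) := by field_simp
            _ ≤ _ := by gcongr
        gcongr

/-- joint measurability of the waiting time -/
lemma measurable_wait (n : ℕ) :
    Measurable (fun z : (ℕ → A) × (ℕ → A) => waitingTime n z.1 z.2) := by
  let S : ℕ → Set ((ℕ → A) × (ℕ → A)) := fun k => {z | 1 ≤ k ∧ occ n z.1 k z.2}
  have hS : ∀ k, MeasurableSet (S k) := by
    intro k
    have : S k = ({z | 1 ≤ k} : Set ((ℕ → A) × (ℕ → A))) ∩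
        ⋂ i ∈ Finset.Icc 1 n, {z : (ℕ → A) × (ℕ → A) | z.2 (k + i) = z.1 i} := by
      ext z; simp [S, occ]
    rw [this]
    apply MeasurableSet.inter (MeasurableSet.const _)
    apply Finset.measurableSet_biInter
    intro i _
    exact measurableSet_eq_fun (by fun_prop) (by fun_prop)
  have hz : ∀ z : (ℕ → A) × (ℕ → A), waitingTime n z.1 z.2 = sInf {k | z ∈ S k} := fun z => rfl
  apply measurable_to_countable'
  intro j
  have : (fun z : (ℕ → A) × (ℕ → A) => waitingTime n z.1 z.2) ⁻¹' {j}
      = (S j ∩ ⋂ i ∈ Finset.range j, (S i)ᶜ) ∪ ({z | j = 0} ∩ ⋂ i, (S i)ᶜ) := by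
    ext z
    simp only [Set.mem_preimage, Set.mem_singleton_iff, hz, Set.mem_union, Set.mem_inter_iff,
      Set.mem_iInter, Set.mem_compl_iff, Set.mem_ofPred_eq, Finset.mem_range]
    constructor
    · intro hj
      by_cases hne : {k | z ∈ S k}.Nonempty
      · left
        have h1 := Nat.sInf_mem hne
        rw [hj] at h1
        exact ⟨h1, fun i hi hc => Nat.notMem_of_lt_sInf (hj.symm ▸ hi) hc⟩
      · right
        rw [Set.not_nonempty_iff_eq_empty] at hne
        rw [hne, Nat.sInf_empty] at hj
        refine ⟨hj.symm, fun i hi => ?_⟩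
        have : i ∈ {k | z ∈ S k} := hi
        rw [hne] at this; exact this
    · rintro (⟨h1, h2⟩ | ⟨h1, h2⟩)
      · apply le_antisymm (Nat.sInf_le h1)
        by_contra hlt
        push Not at hlt
        have hmem : sInf {k | z ∈ S k} ∈ {k | z ∈ S k} := Nat.sInf_mem ⟨j, h1⟩
        exact h2 _ hlt hmem
      · rw [h1]
        have : {k | z ∈ S k} = ∅ := by ext k; simp [h2 k]
        rw [this, Nat.sInf_empty]
  rw [this]
  apply MeasurableSet.union
  · exact (hS j).inter (Finset.measurableSet_biInter _ fun i _ => (hS i).compl)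
  · exact (MeasurableSet.const _).inter (MeasurableSet.iInter fun i => (hS i).compl)

end IsMk

namespace IsMk

variable {A : Type*} [Fintype A] [Nonempty A] [MeasurableSpace A] [MeasurableSingletonClass A]
  {Q : A → A → ℝ} {μ : A → ℝ} {P : Measure (ℕ → A)}

lemma measurable_dep (n : ℕ) (G : (ℕ → A) → ℝ)
    (hG : ∀ ω ω', (∀ i ≤ n, ω i = ω' i) → G ω = G ω') : Measurable G := by
  have e : G = (fun a => G (ext n a)) ∘ restr n := by
    funext ω
    apply hG
    intro i hi
    simp [ext, restr, hi]
  rw [e]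
  exact (measurable_of_finite _).comp (measurable_restr n)

lemma cylProb_dep (n : ℕ) (ω ω' : ℕ → A) (hh : ∀ i ≤ n, ω i = ω' i) :
    cylProb P n ω = cylProb P n ω' := by
  unfold cylProb
  congr 2
  ext y
  simp only [Set.mem_ofPred_eq]
  constructor
  · intro H i h1 h2; rw [H i h1 h2, hh i h2]
  · intro H i h1 h2; rw [H i h1 h2, hh i h2]

lemma measurable_cylProb (n : ℕ) : Measurable (fun ω : ℕ → A => cylProb P n ω) :=
  measurable_dep n _ (cylProb_dep n)

lemma prod_real_le {α β : Type*} [MeasurableSpace α] [MeasurableSpace β] (m : Measure α)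
    (ν : Measure β) [IsProbabilityMeasure m] [IsProbabilityMeasure ν] (S : Set (α × β))
    (hS : MeasurableSet S) (r : ℝ) (hr : 0 ≤ r) (h : ∀ x, ν.real (Prod.mk x ⁻¹' S) ≤ r) :
    (m.prod ν).real S ≤ r := by
  rw [measureReal_def]
  apply ENNReal.toReal_le_of_le_ofReal hr
  rw [Measure.prod_apply hS]
  calc _ ≤ ∫⁻ _ : α, ENNReal.ofReal r ∂m := by
        apply lintegral_mono
        intro x
        exact (ENNReal.le_ofReal_iff_toReal_le (measure_ne_top _ _) hr).2 (h x)
    _ = _ := by simp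

/-- the event that the waiting time is atypical -/
def bad (ν : Measure (ℕ → A)) (ε : ℝ) (n : ℕ) : Set ((ℕ → A) × (ℕ → A)) :=
  {z | ¬ (1 ≤ waitingTime n z.1 z.2 ∧
      |Real.log (waitingTime n z.1 z.2) + Real.log (cylProb ν n z.1)|
        ≤ ε * Real.sqrt (n : ℝ))}

lemma measurableSet_bad (ν : Measure (ℕ → A)) (ε : ℝ) (n : ℕ) : MeasurableSet (bad ν ε n) := by
  unfold bad
  apply MeasurableSet.compl (s := {z : (ℕ → A) × (ℕ → A) | (1 ≤ waitingTime n z.1 z.2 ∧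
      |Real.log (waitingTime n z.1 z.2) + Real.log (cylProb ν n z.1)|
        ≤ ε * Real.sqrt (n : ℝ))})
  have hW := measurable_wait (A := A) n
  have hWr : Measurable (fun z : (ℕ → A) × (ℕ → A) => (waitingTime n z.1 z.2 : ℝ)) :=
    (measurable_of_countable (fun k : ℕ => (k : ℝ))).comp hW
  have hc : Measurable (fun z : (ℕ → A) × (ℕ → A) => cylProb ν n z.1) :=
    (measurable_cylProb n).comp measurable_fst
  have hf : Measurable (fun z : (ℕ → A) × (ℕ → A) =>
      |Real.log (waitingTime n z.1 z.2) + Real.log (cylProb ν n z.1)|) :=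
    continuous_abs.measurable.comp ((Real.measurable_log.comp hWr).add (Real.measurable_log.comp hc))
  exact (measurableSet_le measurable_const hW).inter (measurableSet_le hf measurable_const)

lemma rate_nonneg (δ ε : ℝ) (n : ℕ) : 0 ≤ rate δ ε n := by unfold rate; positivity

/-- variance of a martingale plus a bounded perturbation -/
lemma var_bd (h : IsMk Q μ P) (n : ℕ) (hn : 1 ≤ n) (M B : (ℕ → A) → ℝ) (s C c : ℝ) (hC : 0 ≤ C)
    (hM : ∀ ω ω', (∀ i ≤ n, ω i = ω' i) → M ω = M ω')
    (hB : ∀ ω ω', (∀ i ≤ n, ω i = ω' i) → B ω = B ω')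
    (hBC : ∀ ω, |B ω| ≤ C) (hM1 : ∫ ω, M ω ∂P = 0) (hM2 : ∫ ω, M ω ^ 2 ∂P = n * s) :
    |variance (fun ω => M ω + B ω + c) P - n * s| ≤ C * (s + 1) * Real.sqrt n + 2 * C ^ 2 := by
  have := h.prob
  have iM := h.integrable_dep n M hM
  have iB := h.integrable_dep n B hB
  have iM2 : Integrable (fun ω => M ω ^ 2) P := h.integrable_dep n _ fun ω ω' hh => by rw [hM _ _ hh]
  have iB2 : Integrable (fun ω => B ω ^ 2) P := h.integrable_dep n _ fun ω ω' hh => by rw [hB _ _ hh]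
  have iMB : Integrable (fun ω => M ω * B ω) P :=
    h.integrable_dep n _ fun ω ω' hh => by rw [hB _ _ hh, hM _ _ hh]
  have iT : Integrable (fun ω => M ω + B ω) P := iM.add iB
  have iT2 : Integrable (fun ω => (M ω + B ω) ^ 2) P :=
    h.integrable_dep n _ fun ω ω' hh => by rw [hB _ _ hh, hM _ _ hh]
  rw [variance_add_const iT.aestronglyMeasurable,
    variance_eq_sub ((memLp_two_iff_integrable_sq iT.aestronglyMeasurable).2 iT2)]
  have e1 : ∫ ω, (M ω + B ω) ∂P = ∫ ω, B ω ∂P := by rw [integral_add iM iB, hM1, zero_add]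
  have e2 : ∫ ω, ((fun ω => M ω + B ω) ^ 2) ω ∂P
      = n * s + 2 * ∫ ω, M ω * B ω ∂P + ∫ ω, B ω ^ 2 ∂P := by
    have : ∀ ω, ((fun ω => M ω + B ω) ^ 2) ω = M ω ^ 2 + 2 * (M ω * B ω) + B ω ^ 2 := by
      intro ω; simp only [Pi.pow_apply]; ring
    simp_rw [this]
    have i12 : Integrable (fun ω => M ω ^ 2 + 2 * (M ω * B ω)) P := iM2.add (iMB.const_mul 2)
    rw [integral_add i12 iB2, integral_add iM2 (iMB.const_mul 2), hM2,
      integral_const_mul]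
  rw [e1, e2]
  have hsn : 0 < Real.sqrt n := Real.sqrt_pos.2 (by exact_mod_cast hn)
  have hss : Real.sqrt n ^ 2 = n := Real.sq_sqrt (by positivity)
  have b1 : |∫ ω, B ω ∂P| ≤ C := by
    have := norm_integral_le_of_norm_le_const (μ := P) (f := B) (C := C) (Eventually.of_forall hBC)
    simpa using this
  have b2 : |∫ ω, B ω ^ 2 ∂P| ≤ C ^ 2 := by
    have := norm_integral_le_of_norm_le_const (μ := P) (f := fun ω => B ω ^ 2) (C := C ^ 2)
      (Eventually.of_forall fun ω => by
        rw [Real.norm_eq_abs, abs_pow]; exact pow_le_pow_left₀ (abs_nonneg _) (hBC ω) 2)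
    simpa using this
  have b2' : 0 ≤ ∫ ω, B ω ^ 2 ∂P := integral_nonneg fun ω => sq_nonneg _
  have b3 : 2 * |∫ ω, M ω * B ω ∂P| ≤ C * (s + 1) * Real.sqrt n := by
    have i1 : |∫ ω, M ω * B ω ∂P| ≤ ∫ ω, C / 2 * (M ω ^ 2 / Real.sqrt n + Real.sqrt n) ∂P := by
      refine (abs_integral_le_integral_abs).trans ?_
      apply integral_mono iMB.abs
      · exact ((iM2.div_const _).add (integrable_const _)).const_mul _
      · intro ω
        simp only [abs_mul]
        have j1 : |M ω| ≤ (M ω ^ 2 / Real.sqrt n + Real.sqrt n) / 2 := by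
          rw [← sq_abs (M ω)]
          have : |M ω| ^ 2 / Real.sqrt n + Real.sqrt n - 2 * |M ω|
            = (|M ω| - Real.sqrt n) ^ 2 / Real.sqrt n := by field_simp; ring
          have : 0 ≤ (|M ω| - Real.sqrt n) ^ 2 / Real.sqrt n := by positivity
          linarith
        calc |M ω| * |B ω| ≤ (M ω ^ 2 / Real.sqrt n + Real.sqrt n) / 2 * C :=
              mul_le_mul j1 (hBC ω) (abs_nonneg _) (by positivity)
          _ = _ := by ring
    rw [integral_const_mul, integral_add (iM2.div_const _) (integrable_const _), integral_div,
      hM2] at i1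
    simp only [integral_const, probReal_univ, smul_eq_mul, one_mul] at i1
    have : (n : ℝ) * s / Real.sqrt n = s * Real.sqrt n := by
      rw [div_eq_iff hsn.ne', mul_assoc, ← sq, hss]; ring
    rw [this] at i1
    nlinarith
  have b4 : (∫ ω, B ω ∂P) ^ 2 ≤ C ^ 2 := by
    rw [← sq_abs]; exact pow_le_pow_left₀ (abs_nonneg _) b1 2
  have b5 := abs_le.1 b2
  have b6 := neg_abs_le (∫ ω, M ω * B ω ∂P)
  have b7 := le_abs_self (∫ ω, M ω * B ω ∂P)
  have b8 := sq_nonneg (∫ ω, B ω ∂P)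
  have b9 := sq_nonneg C
  rw [abs_le]
  constructor <;> linarith [b5.1, b5.2]

/-- decomposition of the log-likelihood ratio -/
lemma decomp {QY : A → A → ℝ} {μt : A → ℝ} {Pt : Measure (ℕ → A)} (hX : IsMk Q μ P)
    (hY : IsMk QY μt Pt) :
    ∃ (d : A → A → ℝ) (C : ℝ), 0 ≤ C ∧ (∀ x, ∑ y, Q x y * d x y = 0) ∧ ∀ (m : ℕ) (ω : ℕ → A),
      |Real.log (cylProb P (m + 1) ω / cylProb Pt (m + 1) ω)
        - ((m + 1 : ℕ) : ℝ) * (∑ x, ∑ y, μ x * Q x y * Real.log (Q x y / QY x y))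
        - addF d (m + 1) ω| ≤ C := by
  set H := ∑ x, ∑ y, μ x * Q x y * Real.log (Q x y / QY x y) with hH
  obtain ⟨u, hu⟩ := hX.poisson (fun x => ∑ y, Q x y * Real.log (Q x y / QY x y) - H) (by
    simp only [mul_sub, Finset.sum_sub_distrib]
    rw [← Finset.sum_mul, hX.sum, hH]
    simp only [Finset.mul_sum, mul_assoc, one_mul, sub_self])
  let d : A → A → ℝ := fun x y => Real.log (Q x y / QY x y) - H + u y - u x
  obtain ⟨D, hD, hdD⟩ := exists_bd2 d
  obtain ⟨U, hU, huU⟩ := exists_bd u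
  obtain ⟨B, hB, hbB⟩ := exists_bd (fun x => Real.log (μ x / μt x))
  refine ⟨d, B + |H| + 2 * U + D, by positivity, ?_, ?_⟩
  · intro x
    simp only [d, mul_sub, mul_add, Finset.sum_sub_distrib, Finset.sum_add_distrib]
    rw [← Finset.sum_mul, ← Finset.sum_mul, hX.row]
    have := hu x
    linarith
  · intro m ω
    have key : Real.log (cylProb P (m + 1) ω / cylProb Pt (m + 1) ω)
        - ((m + 1 : ℕ) : ℝ) * H - addF d (m + 1) ω
        = Real.log (μ (ω 1) / μt (ω 1)) - H - u (ω (m + 1)) + u (ω 1) - d (ω 0) (ω 1) := by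
      induction m with
      | zero => simp [hX.cylProb_eq, hY.cylProb_eq, addF]
      | succ m ih =>
        have p1 := (hX.cylProb_pos m ω).ne'
        have p2 := (hY.cylProb_pos m ω).ne'
        have q1 := (hX.pos (ω (m + 1)) (ω (m + 2))).ne'
        have q2 := (hY.pos (ω (m + 1)) (ω (m + 2))).ne'
        have e1 : cylProb P (m + 1 + 1) ω = cylProb P (m + 1) ω * Q (ω (m + 1)) (ω (m + 2)) := by
          rw [hX.cylProb_eq, hX.cylProb_eq, Finset.prod_range_succ]; ring
        have e2 : cylProb Pt (m + 1 + 1) ω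
            = cylProb Pt (m + 1) ω * QY (ω (m + 1)) (ω (m + 2)) := by
          rw [hY.cylProb_eq, hY.cylProb_eq, Finset.prod_range_succ]; ring
        rw [e1, e2, mul_div_mul_comm, Real.log_mul (div_ne_zero p1 p2) (div_ne_zero q1 q2),
          addF_succ]
        have e3 : d (ω (m + 1)) (ω (m + 1 + 1)) =
          Real.log (Q (ω (m + 1)) (ω (m + 2)) / QY (ω (m + 1)) (ω (m + 2))) - H
            + u (ω (m + 2)) - u (ω (m + 1)) := rfl
        rw [e3]
        push_cast at ih ⊢
        linarith
    rw [key]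
    have h1 := abs_le.1 (hbB (ω 1))
    have h2 := abs_le.1 (huU (ω 1))
    have h3 := abs_le.1 (huU (ω (m + 1)))
    have h4 := abs_le.1 (hdD (ω 0) (ω 1))
    have h5 := neg_abs_le H
    have h6 := le_abs_self H
    rw [abs_le]
    constructor <;> linarith [h1.1, h1.2, h2.1, h2.2, h3.1, h3.2, h4.1, h4.2]

end IsMk

/-- Central limit theorem for `log(W_n(X|Y)/W_n(X|X'))`: the asymptotic variance
`σ² = lim (1/n) Var_P(log(P_n/P~_n))` exists and
`(1/√n)(log(W_n(X|Y)/W_n(X|X')) - n h)` converges in distribution to `N(0, σ²)`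
(convergence in distribution is stated via bounded continuous test functions). -/
theorem stmt11
    {A : Type*} [Fintype A] [Nonempty A] [MeasurableSpace A] [MeasurableSingletonClass A]
    (QX QY : A → A → ℝ) (μ μt : A → ℝ)
    (hQXpos : ∀ x y, 0 < QX x y) (hQXrow : ∀ x, ∑ y, QX x y = 1)
    (hQYpos : ∀ x y, 0 < QY x y) (hQYrow : ∀ x, ∑ y, QY x y = 1)
    (hμnonneg : ∀ x, 0 ≤ μ x) (hμsum : ∑ x, μ x = 1)
    (hμstat : ∀ y, ∑ x, μ x * QX x y = μ y)
    (hμtnonneg : ∀ x, 0 ≤ μt x) (hμtsum : ∑ x, μt x = 1)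
    (hμtstat : ∀ y, ∑ x, μt x * QY x y = μt y)
    (P Pt : Measure (ℕ → A)) [IsProbabilityMeasure P] [IsProbabilityMeasure Pt]
    (hP : ∀ (n : ℕ) (a : ℕ → A),
      (P {ω | ∀ i ≤ n, ω i = a i}).toReal
        = μ (a 0) * ∏ i ∈ Finset.range n, QX (a i) (a (i + 1)))
    (hPt : ∀ (n : ℕ) (a : ℕ → A),
      (Pt {ω | ∀ i ≤ n, ω i = a i}).toReal
        = μt (a 0) * ∏ i ∈ Finset.range n, QY (a i) (a (i + 1))) :
    ∃ σ2 : NNReal,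
      Tendsto (fun n : ℕ =>
          variance (fun ω : ℕ → A => Real.log (cylProb P n ω / cylProb Pt n ω)) P / n)
        atTop (nhds σ2) ∧
      ∀ f : BoundedContinuousFunction ℝ ℝ,
        Tendsto (fun n : ℕ =>
            ∫ z, f ((Real.log ((waitingTime n z.1.1 z.1.2 : ℝ) / (waitingTime n z.1.1 z.2 : ℝ))
                - n * (∑ x, ∑ y, μ x * QX x y * Real.log (QX x y / QY x y))) / Real.sqrt n)
              ∂((P.prod Pt).prod P))
          atTop (nhds (∫ x, f x ∂(gaussianReal 0 σ2))) := by
  have hX : IsMk QX μ P := ⟨hQXpos, hQXrow, hμnonneg, hμsum, hμstat, inferInstance, hP⟩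
  have hY : IsMk QY μt Pt := ⟨hQYpos, hQYrow, hμtnonneg, hμtsum, hμtstat, inferInstance, hPt⟩
  obtain ⟨d, C, hC, hd, hdec⟩ := hX.decomp hY
  set H := ∑ x, ∑ y, μ x * QX x y * Real.log (QX x y / QY x y) with hH
  have hσ := hX.sig_nonneg d
  have hsq : Tendsto (fun n : ℕ => Real.sqrt n) atTop atTop :=
    Real.tendsto_sqrt_atTop.comp tendsto_natCast_atTop_atTop
  obtain ⟨σ2, hσ2⟩ : ∃ σ2 : NNReal, (σ2 : ℝ) = IsMk.sig QX μ d :=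
    ⟨Real.toNNReal _, Real.coe_toNNReal _ hσ⟩
  refine ⟨σ2, ?_, ?_⟩
  · -- the variance
    rw [hσ2]
    set s := IsMk.sig QX μ d with hs
    have hz : Tendsto (fun n : ℕ => C * (s + 1) / Real.sqrt n + 2 * C ^ 2 / n) atTop (nhds 0) := by
      have := (hsq.const_div_atTop (C * (s + 1))).add
        ((tendsto_natCast_atTop_atTop (R := ℝ)).const_div_atTop (2 * C ^ 2))
      rwa [add_zero] at this
    rw [tendsto_iff_norm_sub_tendsto_zero]
    refine squeeze_zero' (Eventually.of_forall fun n => norm_nonneg _) ?_ hz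
    filter_upwards [eventually_ge_atTop 1] with n hn
    obtain ⟨m, rfl⟩ : ∃ m, n = m + 1 := ⟨n - 1, by omega⟩
    have hb := hX.var_bd (m + 1) hn (IsMk.addF d (m + 1))
      (fun ω => Real.log (cylProb P (m + 1) ω / cylProb Pt (m + 1) ω) - ((m + 1 : ℕ) : ℝ) * H
        - IsMk.addF d (m + 1) ω) s C (((m + 1 : ℕ) : ℝ) * H) hC (IsMk.addF_dep d (m + 1))
      (fun ω ω' hh => by
        rw [IsMk.addF_dep d (m + 1) ω ω' hh, IsMk.cylProb_dep (m + 1) ω ω' hh,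
          IsMk.cylProb_dep (m + 1) ω ω' hh]) (hdec m) (hX.addF_mean d hd _) (hX.addF_sq d hd _)
    have e : ∀ ω, IsMk.addF d (m + 1) ω + (Real.log (cylProb P (m + 1) ω / cylProb Pt (m + 1) ω)
        - ((m + 1 : ℕ) : ℝ) * H - IsMk.addF d (m + 1) ω) + ((m + 1 : ℕ) : ℝ) * H
        = Real.log (cylProb P (m + 1) ω / cylProb Pt (m + 1) ω) := by intro ω; ring
    simp only [e] at hb
    have hm : (0 : ℝ) < ((m + 1 : ℕ) : ℝ) := by positivity
    have hss : Real.sqrt ((m + 1 : ℕ) : ℝ) ^ 2 = ((m + 1 : ℕ) : ℝ) := Real.sq_sqrt hm.le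
    have hs0 : 0 < Real.sqrt ((m + 1 : ℕ) : ℝ) := Real.sqrt_pos.2 hm
    rw [Real.norm_eq_abs]
    have e2 : ∀ V : ℝ, V / ((m + 1 : ℕ) : ℝ) - s
        = (V - ((m + 1 : ℕ) : ℝ) * s) / ((m + 1 : ℕ) : ℝ) := by
      intro V; field_simp
    rw [e2, abs_div, abs_of_pos hm, div_le_iff₀ hm]
    refine hb.trans (le_of_eq ?_)
    rw [add_mul, div_mul_cancel₀ _ hm.ne']
    congr 1
    nth_rewrite 3 [← hss]
    field_simp
  · -- the central limit theorem
    set R := (P.prod Pt).prod P with hR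
    let X : ℕ → ((ℕ → A) × (ℕ → A)) × (ℕ → A) → ℝ := fun n z =>
      IsMk.addF d n z.1.1 / Real.sqrt n
    let Z : ℕ → ((ℕ → A) × (ℕ → A)) × (ℕ → A) → ℝ := fun n z =>
      (Real.log ((waitingTime n z.1.1 z.1.2 : ℝ) / (waitingTime n z.1.1 z.2 : ℝ))
                - n * H) / Real.sqrt n
    have mX : ∀ n, Measurable (X n) := fun n =>
      ((IsMk.measurable_addF d n).comp (measurable_fst.comp measurable_fst)).div_const _
    have mW1 : ∀ n, Measurable (fun z : ((ℕ → A) × (ℕ → A)) × (ℕ → A) =>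
        (waitingTime n z.1.1 z.1.2 : ℝ)) := fun n =>
      (measurable_of_countable (fun k : ℕ => (k : ℝ))).comp
        ((IsMk.measurable_wait n).comp measurable_fst)
    have mpr : Measurable (fun z : ((ℕ → A) × (ℕ → A)) × (ℕ → A) => (z.1.1, z.2)) := by fun_prop
    have mW2 : ∀ n, Measurable (fun z : ((ℕ → A) × (ℕ → A)) × (ℕ → A) =>
        (waitingTime n z.1.1 z.2 : ℝ)) := fun n =>
      (measurable_of_countable (fun k : ℕ => (k : ℝ))).comp ((IsMk.measurable_wait n).comp mpr)
    have mZ : ∀ n, Measurable (Z n) := fun n =>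
      ((Real.measurable_log.comp ((mW1 n).div (mW2 n))).sub_const _).div_const _
    have hXd : TendstoInDistribution X atTop (id : ℝ → ℝ) (fun _ => R)
        (gaussianReal 0 σ2) := by
      refine ⟨fun n => (mX n).aemeasurable, measurable_id.aemeasurable, ?_⟩
      refine ProbabilityMeasure.tendsto_iff_tendsto_charFun.2 fun t => ?_
      simp only [ProbabilityMeasure.coe_mk, Measure.map_id]
      rw [charFun_gaussianReal]
      have hlim := hX.char_tendsto d hd t
      have e1 : Complex.exp (t * ((0 : ℝ) : ℂ) * Complex.I
          - ((σ2 : ℝ) : ℂ) * t ^ 2 / 2)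
          = Complex.exp (-(t ^ 2 * IsMk.sig QX μ d / 2 : ℝ)) := by
        congr 1
        rw [hσ2]
        push_cast
        ring
      rw [e1]
      refine hlim.congr fun n => ?_
      rw [charFun_apply_real, integral_map (mX n).aemeasurable (by fun_prop)]
      have mp : MeasurePreserving (fun z : ((ℕ → A) × (ℕ → A)) × (ℕ → A) => z.1.1) R P :=
        (measurePreserving_fst (μ := P) (ν := Pt)).comp
          (measurePreserving_fst (μ := P.prod Pt) (ν := P))
      have mF : Measurable (fun ω : ℕ → A =>
          Complex.exp (Complex.I * (t * (IsMk.addF d n ω / Real.sqrt n) : ℝ))) := by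
        have := IsMk.measurable_addF d n
        fun_prop
      rw [← mp.map_eq, integral_map mp.aemeasurable mF.aestronglyMeasurable]
      congr 1
      funext z
      simp only [X]
      congr 1
      push_cast
      ring
    have hZX : TendstoInMeasure R (Z - X) atTop 0 := by
      obtain ⟨δ1, hδ1, hQ1⟩ := hX.exists_delta
      obtain ⟨δ2, hδ2, hQ2⟩ := hY.exists_delta
      rw [tendstoInMeasure_iff_measureReal_norm]
      intro η hη
      set ε := η / 4 with hε
      have hε0 : 0 < ε := by positivity
      have hr : Tendsto (fun n => IsMk.rate δ2 ε n + IsMk.rate δ1 ε n) atTop (nhds 0) := by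
        have := (IsMk.rate_tendsto δ2 ε hδ2 hε0).add (IsMk.rate_tendsto δ1 ε hδ1 hε0)
        rwa [add_zero] at this
      have hCs : ∀ᶠ n : ℕ in atTop, C / Real.sqrt n < ε :=
        (hsq.const_div_atTop C).eventually_lt_const hε0
      refine squeeze_zero' (Eventually.of_forall fun n => measureReal_nonneg) ?_ hr
      filter_upwards [hCs, eventually_ge_atTop 1] with n hn1 hn
      obtain ⟨m, rfl⟩ : ∃ m, n = m + 1 := ⟨n - 1, by omega⟩
      set n := m + 1 with hnm
      have hs0 : 0 < Real.sqrt (n : ℝ) := Real.sqrt_pos.2 (by exact_mod_cast hn)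
      have hsub : {z | η ≤ ‖(Z - X) n z - (0 : ((ℕ → A) × (ℕ → A)) × (ℕ → A) → ℝ) z‖} ⊆
          (Prod.fst ⁻¹' IsMk.bad Pt ε n) ∪
          ((fun z : ((ℕ → A) × (ℕ → A)) × (ℕ → A) => (z.1.1, z.2)) ⁻¹' IsMk.bad P ε n) := by
        intro z hz
        by_contra hc
        simp only [IsMk.bad, Set.mem_union, Set.mem_preimage, Set.mem_ofPred_eq, not_or,
          not_not] at hc
        obtain ⟨⟨a1, a2⟩, b1, b2⟩ := hc
        have hW1 : (waitingTime n z.1.1 z.1.2 : ℝ) ≠ 0 := by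
          have : waitingTime n z.1.1 z.1.2 ≠ 0 := by omega
          exact_mod_cast this
        have hW2 : (waitingTime n z.1.1 z.2 : ℝ) ≠ 0 := by
          have : waitingTime n z.1.1 z.2 ≠ 0 := by omega
          exact_mod_cast this
        have c0 := hdec m z.1.1
        rw [Real.log_div (hX.cylProb_pos m z.1.1).ne' (hY.cylProb_pos m z.1.1).ne'] at c0
        simp only [Set.mem_ofPred_eq, Pi.sub_apply, Pi.zero_apply, sub_zero, Z, X,
          Real.norm_eq_abs] at hz
        rw [Real.log_div hW1 hW2, ← sub_div, abs_div, abs_of_pos hs0, le_div_iff₀ hs0] at hz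
        rw [div_lt_iff₀ hs0] at hn1
        have a2' := abs_le.1 a2
        have b2' := abs_le.1 b2
        have c0' := abs_le.1 c0
        have : |Real.log (waitingTime n z.1.1 z.1.2) - Real.log (waitingTime n z.1.1 z.2) - n * H
            - IsMk.addF d n z.1.1| ≤ 3 * (ε * Real.sqrt n) := by
          rw [abs_le]
          constructor <;> linarith [a2'.1, a2'.2, b2'.1, b2'.2, c0'.1, c0'.2]
        have h4 : η * Real.sqrt n = 4 * (ε * Real.sqrt n) := by rw [hε]; ring
        have : 0 < ε * Real.sqrt n := by positivity
        linarith
      refine (measureReal_mono hsub).trans ((measureReal_union_le _ _).trans ?_)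
      apply add_le_add
      · rw [hR, (measurePreserving_fst (μ := P.prod Pt) (ν := P)).measureReal_preimage
          (IsMk.measurableSet_bad _ _ _).nullMeasurableSet]
        exact IsMk.prod_real_le _ _ _ (IsMk.measurableSet_bad _ _ _) _ (IsMk.rate_nonneg _ _ _)
          fun x => hY.wait_bd δ2 hδ2 hQ2 ε m x
      · exact IsMk.prod_real_le _ _ _ (mpr (IsMk.measurableSet_bad _ _ _)) _
          (IsMk.rate_nonneg _ _ _) fun x => hX.wait_bd δ1 hδ1 hQ1 ε m x.1
    have hZd := tendstoInDistribution_of_tendstoInMeasure_sub Z id hXd hZX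
      (fun n => (mZ n).aemeasurable)
    intro f
    have := (ProbabilityMeasure.tendsto_iff_forall_integral_tendsto.1 hZd.tendsto) f
    simp only [ProbabilityMeasure.coe_mk, Measure.map_id] at this
    refine this.congr fun n => ?_
    rw [integral_map (mZ n).aemeasurable f.continuous.aestronglyMeasurable]
end
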